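/- arXiv:1002.1679 — 5 statements merged into one kernel-verified Lean document; each statement's English description precedes it below -/
import Mathlib

section
/- Let (P_1,Q_1) and (P_2,Q_2) be distinct pairs of integers with P_1 > 0, P_2 > 0, |Q_1| = |Q_2| = 1, and (P_i,Q_i) not in {(1,1),(2,1)} for i = 1,2. Then the set {V_n(P_1,Q_1) : n >= 0} ∩ {V_m(P_2,Q_2) : m >= 0} is infinite if and only if the product (P_1^2 - 4*Q_1)*(P_2^2 - 4*Q_2) is a perfect square. -/
/-- Lucas sequence of the first kind: `U 0 = 0`, `U 1 = 1`,
`U (n+2) = P * U (n+1) - Q * U n`. -/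
def lucasU (P Q : ℤ) : ℕ → ℤ
  | 0 => 0
  | 1 => 1
  | n + 2 => P * lucasU P Q (n + 1) - Q * lucasU P Q n

/-- Lucas sequence of the second kind: `V 0 = 2`, `V 1 = P`,
`V (n+2) = P * V (n+1) - Q * V n`. -/
def lucasV (P Q : ℤ) : ℕ → ℤ
  | 0 => 2
  | 1 => P
  | n + 2 => P * lucasV P Q (n + 1) - Q * lucasV P Q n

theorem exists_partialFraction {A : Type*} [CommRing A] [Algebra ℝ A] {X Y Z : A}
    (hXY : X * Y = Y - X) (hXZ : X * Z = X - Z) (hYZ : Y * Z = (1 / 2 : ℝ) • (Y - Z))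
    (N s : ℕ) : ∀ a b c : ℕ, a + b + c = s + 1 → a ≤ N → b ≤ N → c ≤ N →
    ∃ u v w : ℕ → ℝ,
      X ^ a * Y ^ b * Z ^ c = ∑ m ∈ Finset.range N,
        (u m • X ^ (m + 1) + v m • Y ^ (m + 1) + w m • Z ^ (m + 1)) ∧
      (∀ m, (∃ z : ℤ, 2 ^ s * u m = z) ∧ (∃ z : ℤ, 2 ^ s * v m = z) ∧
        ∃ z : ℤ, 2 ^ s * w m = z) ∧
      (∀ m, |u m| ≤ 2 ^ s ∧ |v m| ≤ 2 ^ s ∧ |w m| ≤ 2 ^ s) ∧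
      (b = 0 → v 0 = 0) ∧ (c = 0 → w 0 = 0) ∧
      0 ≤ (-1) ^ (b + 1) * v 0 ∧ 0 ≤ (-1) ^ (a + b) * w 0 ∧
      (1 ≤ b → 1 ≤ c ∨ b = 1 → 0 < (-1) ^ (b + 1) * v 0) ∧
      (1 ≤ c → 1 ≤ b ∨ c = 1 → 0 < (-1) ^ (a + b) * w 0) := by
  have integral_sub : ∀ (s : ℕ) (r p q : ℝ), (r = 1 ∨ r = 1 / 2) →
      (∃ z : ℤ, 2 ^ s * p = z) → (∃ z : ℤ, 2 ^ s * q = z) →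
      ∃ z : ℤ, 2 ^ (s + 1) * (r * (p - q)) = z := by
    rintro s r p q (rfl | rfl) ⟨z, hz⟩ ⟨z', hz'⟩
    · exact ⟨2 * (z - z'), by push_cast; rw [← hz, ← hz']; ring⟩
    · exact ⟨z - z', by push_cast; rw [← hz, ← hz']; ring⟩
  have abs_sub_le : ∀ (s : ℕ) (r p q : ℝ), (r = 1 ∨ r = 1 / 2) → |p| ≤ 2 ^ s → |q| ≤ 2 ^ s →
      |r * (p - q)| ≤ 2 ^ (s + 1) := by
    intro s r p q hr hp hq
    have h2 : |p - q| ≤ 2 ^ (s + 1) := (abs_sub p q).trans (by rw [pow_succ]; linarith)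
    rw [abs_mul]
    have : |r| ≤ 1 := by rcases hr with rfl | rfl <;> norm_num
    calc |r| * |p - q| ≤ 1 * 2 ^ (s + 1) := by gcongr
      _ = _ := one_mul _
  have combine : ∀ (s : ℕ) (r : ℝ) (T T' T'' : A) (u v w u' v' w' : ℕ → ℝ),
      (r = 1 ∨ r = 1 / 2) → T = r • (T' - T'') →
      T' = ∑ m ∈ Finset.range N, (u m • X ^ (m + 1) + v m • Y ^ (m + 1) + w m • Z ^ (m + 1)) →
      T'' = ∑ m ∈ Finset.range N,
        (u' m • X ^ (m + 1) + v' m • Y ^ (m + 1) + w' m • Z ^ (m + 1)) →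
      (∀ m, (∃ z : ℤ, 2 ^ s * u m = z) ∧ (∃ z : ℤ, 2 ^ s * v m = z) ∧
        ∃ z : ℤ, 2 ^ s * w m = z) →
      (∀ m, |u m| ≤ 2 ^ s ∧ |v m| ≤ 2 ^ s ∧ |w m| ≤ 2 ^ s) →
      (∀ m, (∃ z : ℤ, 2 ^ s * u' m = z) ∧ (∃ z : ℤ, 2 ^ s * v' m = z) ∧
        ∃ z : ℤ, 2 ^ s * w' m = z) →
      (∀ m, |u' m| ≤ 2 ^ s ∧ |v' m| ≤ 2 ^ s ∧ |w' m| ≤ 2 ^ s) →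
      T = ∑ m ∈ Finset.range N, ((r * (u m - u' m)) • X ^ (m + 1) +
        (r * (v m - v' m)) • Y ^ (m + 1) + (r * (w m - w' m)) • Z ^ (m + 1)) ∧
      (∀ m, (∃ z : ℤ, 2 ^ (s + 1) * (r * (u m - u' m)) = z) ∧
        (∃ z : ℤ, 2 ^ (s + 1) * (r * (v m - v' m)) = z) ∧
        ∃ z : ℤ, 2 ^ (s + 1) * (r * (w m - w' m)) = z) ∧
      (∀ m, |r * (u m - u' m)| ≤ 2 ^ (s + 1) ∧ |r * (v m - v' m)| ≤ 2 ^ (s + 1) ∧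
        |r * (w m - w' m)| ≤ 2 ^ (s + 1)) := by
    intro s r T T' T'' u v w u' v' w' hr hT hT' hT'' h1 h2 h1' h2'
    refine ⟨?_, fun m => ⟨?_, ?_, ?_⟩, fun m => ⟨?_, ?_, ?_⟩⟩
    · rw [hT, hT', hT'', ← Finset.sum_sub_distrib, Finset.smul_sum]
      refine Finset.sum_congr rfl fun m _ => ?_
      module
    · exact integral_sub _ _ _ _ hr (h1 m).1 (h1' m).1
    · exact integral_sub _ _ _ _ hr (h1 m).2.1 (h1' m).2.1
    · exact integral_sub _ _ _ _ hr (h1 m).2.2 (h1' m).2.2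
    · exact abs_sub_le _ _ _ _ hr (h2 m).1 (h2' m).1
    · exact abs_sub_le _ _ _ _ hr (h2 m).2.1 (h2' m).2.1
    · exact abs_sub_le _ _ _ _ hr (h2 m).2.2 (h2' m).2.2
  have hint : ∀ s m : ℕ, ∃ z : ℤ, (2 : ℝ) ^ s * (if m = s then (1 : ℝ) else 0) = z := by
    intro s m; by_cases hm : m = s
    · exact ⟨2 ^ s, by simp [hm]⟩
    · exact ⟨0, by simp [hm]⟩
  have habs : ∀ s m : ℕ, |if m = s then (1 : ℝ) else 0| ≤ 2 ^ s := by
    intro s m; by_cases hm : m = s <;> simp [hm, one_le_pow₀]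
  have hint0 : ∀ s : ℕ, ∃ z : ℤ, (2 : ℝ) ^ s * 0 = z := fun s => ⟨0, by simp⟩
  induction s with
  | zero =>
    intro a b c h ha hb hc
    have : (a = 1 ∧ b = 0 ∧ c = 0) ∨ (a = 0 ∧ b = 1 ∧ c = 0) ∨ (a = 0 ∧ b = 0 ∧ c = 1) := by
      omega
    rcases this with ⟨rfl, rfl, rfl⟩ | ⟨rfl, rfl, rfl⟩ | ⟨rfl, rfl, rfl⟩
    · refine ⟨fun m => if m = 0 then 1 else 0, fun _ => 0, fun _ => 0, ?_,
        fun m => ⟨hint 0 m, hint0 0, hint0 0⟩, fun m => ⟨habs 0 m, by simp, by simp⟩, ?_⟩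
      · simp [ite_smul, Finset.sum_ite_eq', show 0 < N by omega]
      · simp
    · refine ⟨fun _ => 0, fun m => if m = 0 then 1 else 0, fun _ => 0, ?_,
        fun m => ⟨hint0 0, hint 0 m, hint0 0⟩, fun m => ⟨by simp, habs 0 m, by simp⟩, ?_⟩
      · simp [ite_smul, Finset.sum_ite_eq', show 0 < N by omega]
      · simp
    · refine ⟨fun _ => 0, fun _ => 0, fun m => if m = 0 then 1 else 0, ?_,
        fun m => ⟨hint0 0, hint0 0, hint 0 m⟩, fun m => ⟨by simp, by simp, habs 0 m⟩, ?_⟩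
      · simp [ite_smul, Finset.sum_ite_eq', show 0 < N by omega]
      · simp
  | succ s ih =>
    intro a b c h ha hb hc
    have hcases : (1 ≤ b ∧ 1 ≤ c) ∨ (1 ≤ a ∧ 1 ≤ b ∧ c = 0) ∨ (1 ≤ a ∧ b = 0 ∧ 1 ≤ c) ∨
        (a = s + 1 + 1 ∧ b = 0 ∧ c = 0) ∨ (a = 0 ∧ b = s + 1 + 1 ∧ c = 0) ∨
        (a = 0 ∧ b = 0 ∧ c = s + 1 + 1) := by
      omega
    rcases hcases with ⟨hb1, hc1⟩ | ⟨ha1, hb1, rfl⟩ | ⟨ha1, rfl, hc1⟩ | ⟨rfl, rfl, rfl⟩ |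
      ⟨rfl, rfl, rfl⟩ | ⟨rfl, rfl, rfl⟩
    · obtain ⟨b, rfl⟩ := Nat.exists_eq_add_of_le' hb1
      obtain ⟨c, rfl⟩ := Nat.exists_eq_add_of_le' hc1
      obtain ⟨u, v, w, hT, hi, ha', hv0, hw0, hv, hw, hvs, hws⟩ :=
        ih a (b + 1) c (by omega) (by omega) (by omega) (by omega)
      obtain ⟨u', v', w', hT', hi', ha'', hv0', hw0', hv', hw', hvs', hws'⟩ :=
        ih a b (c + 1) (by omega) (by omega) (by omega) (by omega)
      have hT0 : X ^ a * Y ^ (b + 1) * Z ^ (c + 1) = (1 / 2 : ℝ) •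
          (X ^ a * Y ^ (b + 1) * Z ^ c - X ^ a * Y ^ b * Z ^ (c + 1)) := by
        have : X ^ a * Y ^ (b + 1) * Z ^ (c + 1) = X ^ a * Y ^ b * Z ^ c * (Y * Z) := by ring
        rw [this, hYZ, mul_smul_comm]
        congr 1; ring
      obtain ⟨h1, h2, h3⟩ := combine s _ _ _ _ u v w u' v' w' (Or.inr rfl) hT0 hT hT' hi ha' hi' ha''
      refine ⟨_, _, _, h1, h2, h3, by simp, by simp, ?_, ?_, ?_, ?_⟩ <;>
        simp only [pow_succ, pow_add] at hv hw hvs hws hv' hw' hvs' hws' ⊢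
      · linarith
      · linarith
      · intro _ _
        by_cases hb : 1 ≤ b
        · have := hvs' hb (by simp)
          linarith
        · by_cases hc : 1 ≤ c
          · have := hvs (by simp) (Or.inl hc)
            linarith
          · have := hvs (by simp) (Or.inr (by omega))
            linarith
      · intro _ _
        by_cases hc : 1 ≤ c
        · have := hws hc (by simp)
          linarith
        · have := hws' (by simp) (Or.inr (by omega))
          linarith
    · obtain ⟨a, rfl⟩ := Nat.exists_eq_add_of_le' ha1
      obtain ⟨b, rfl⟩ := Nat.exists_eq_add_of_le' hb1
      obtain ⟨u, v, w, hT, hi, ha', hv0, hw0, hv, hw, hvs, hws⟩ :=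
        ih a (b + 1) 0 (by omega) (by omega) (by omega) (by omega)
      obtain ⟨u', v', w', hT', hi', ha'', hv0', hw0', hv', hw', hvs', hws'⟩ :=
        ih (a + 1) b 0 (by omega) (by omega) (by omega) (by omega)
      have hT0 : X ^ (a + 1) * Y ^ (b + 1) * Z ^ 0 = (1 : ℝ) •
          (X ^ a * Y ^ (b + 1) * Z ^ 0 - X ^ (a + 1) * Y ^ b * Z ^ 0) := by
        rw [one_smul]
        linear_combination X ^ a * Y ^ b * hXY
      obtain ⟨h1, h2, h3⟩ := combine s _ _ _ _ u v w u' v' w' (Or.inl rfl) hT0 hT hT' hi ha' hi' ha''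
      refine ⟨_, _, _, h1, h2, h3, by simp, ?_, ?_, ?_, ?_, ?_⟩
      · intro _; rw [hw0 rfl, hw0' rfl]; simp
      · simp only [pow_succ] at hv hv' ⊢
        linarith
      · rw [hw0 rfl, hw0' rfl]; simp
      · intro _ h'
        have hb0 : b = 0 := by omega
        have := hvs (by simp) (Or.inr (by omega))
        rw [hv0' hb0]
        simpa using this
      · simp
    · obtain ⟨a, rfl⟩ := Nat.exists_eq_add_of_le' ha1
      obtain ⟨c, rfl⟩ := Nat.exists_eq_add_of_le' hc1
      obtain ⟨u, v, w, hT, hi, ha', hv0, hw0, hv, hw, hvs, hws⟩ :=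
        ih (a + 1) 0 c (by omega) (by omega) (by omega) (by omega)
      obtain ⟨u', v', w', hT', hi', ha'', hv0', hw0', hv', hw', hvs', hws'⟩ :=
        ih a 0 (c + 1) (by omega) (by omega) (by omega) (by omega)
      have hT0 : X ^ (a + 1) * Y ^ 0 * Z ^ (c + 1) = (1 : ℝ) •
          (X ^ (a + 1) * Y ^ 0 * Z ^ c - X ^ a * Y ^ 0 * Z ^ (c + 1)) := by
        rw [one_smul]
        linear_combination X ^ a * Z ^ c * hXZ
      obtain ⟨h1, h2, h3⟩ := combine s _ _ _ _ u v w u' v' w' (Or.inl rfl) hT0 hT hT' hi ha' hi' ha''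
      refine ⟨_, _, _, h1, h2, h3, ?_, by simp, ?_, ?_, ?_, ?_⟩
      · intro _; rw [hv0 rfl, hv0' rfl]; simp
      · rw [hv0 rfl, hv0' rfl]; simp
      · simp only [pow_succ, pow_add] at hw hw' ⊢
        linarith
      · simp
      · intro _ h'
        have hc0 : c = 0 := by omega
        have := hws' (by simp) (Or.inr (by omega))
        rw [hw0 hc0]
        simp only [pow_succ, pow_add] at this ⊢
        linarith
    · refine ⟨fun m => if m = s + 1 then 1 else 0, fun _ => 0, fun _ => 0, ?_,
        fun m => ⟨hint _ m, hint0 _, hint0 _⟩, fun m => ⟨habs _ m, by simp, by simp⟩, ?_⟩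
      · simp [ite_smul, Finset.sum_ite_eq', show s + 1 < N by omega]
      · simp
    · refine ⟨fun _ => 0, fun m => if m = s + 1 then 1 else 0, fun _ => 0, ?_,
        fun m => ⟨hint0 _, hint _ m, hint0 _⟩, fun m => ⟨by simp, habs _ m, by simp⟩, ?_⟩
      · simp [ite_smul, Finset.sum_ite_eq', show s + 1 < N by omega]
      · simp
    · refine ⟨fun _ => 0, fun _ => 0, fun m => if m = s + 1 then 1 else 0, ?_,
        fun m => ⟨hint0 _, hint0 _, hint _ m⟩, fun m => ⟨by simp, by simp, habs _ m⟩, ?_⟩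
      · simp [ite_smul, Finset.sum_ite_eq', show s + 1 < N by omega]
      · simp

open PowerSeries in
theorem coeff_X_mul_geometric_pow (a : ℝ) (m h : ℕ) :
    coeff (h + 1) ((X * PowerSeries.mk fun n => a ^ n : PowerSeries ℝ) ^ (m + 1)) =
      h.choose m * a ^ (h - m) := by
  have h1 : (PowerSeries.mk fun n => a ^ n : PowerSeries ℝ) = rescale a (PowerSeries.mk 1) := by
    ext n; simp [coeff_rescale]
  rw [mul_pow, h1, ← map_pow, PowerSeries.mk_one_pow_eq_mk_choose_add, coeff_X_pow_mul']
  by_cases hm : m ≤ h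
  · rw [if_pos (by omega), coeff_rescale, coeff_mk, show h + 1 - (m + 1) = h - m by omega,
      Nat.add_sub_cancel' hm, mul_comm]
  · rw [if_neg (by omega), Nat.choose_eq_zero_of_lt (by omega)]
    simp

/-- The three nodes `0`, `1`, `-1` of the Padé approximation. -/
def padeNode : Fin 3 → ℝ := ![0, 1, -1]

open PowerSeries in
theorem exists_vanishing_combination (k i : ℕ) (hk : 1 ≤ k) (hi : i < 3) :
    ∃ e : Fin 3 → ℕ → ℝ,
      (∀ h, h + i < 3 * k + 2 →
        ∑ m ∈ Finset.range (k + 1), ∑ j, e j m * (h.choose m * padeNode j ^ (h - m)) = 0) ∧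
      (∀ h, h + i = 3 * k + 2 →
        ∑ m ∈ Finset.range (k + 1), ∑ j, e j m * (h.choose m * padeNode j ^ (h - m)) = 1) ∧
      (∀ j m, ∃ z : ℤ, 2 ^ (3 * k + 2) * e j m = z) ∧
      (∀ j m, |e j m| ≤ 2 ^ (3 * k + 2)) ∧
      0 < (-1) ^ k * e 1 0 ∧ 0 < (-1) ^ i * e 2 0 := by
  set Y : ℝ → PowerSeries ℝ := fun a => X * PowerSeries.mk fun n => a ^ n with hY
  have hrel : ∀ a : ℝ, Y a = X + C a * (X * Y a) := by
    intro a
    have : (PowerSeries.mk fun n => a ^ n : PowerSeries ℝ) =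
        1 + C a * X * PowerSeries.mk fun n => a ^ n := by
      ext n
      rcases n with _ | n
      · simp
      · rw [mul_assoc]
        simp [coeff_one, coeff_succ_X_mul, pow_succ']
    calc Y a = X * PowerSeries.mk fun n => a ^ n := rfl
      _ = X * (1 + C a * X * PowerSeries.mk fun n => a ^ n) := by rw [← this]
      _ = X + C a * (X * Y a) := by simp only [hY]; ring
  have hX : Y 0 = X := by rw [hrel 0]; simp
  have hY1 := hrel 1
  have hZ1 := hrel (-1)
  simp only [map_one, map_neg] at hY1 hZ1
  have hXY : Y 0 * Y 1 = Y 1 - Y 0 := by rw [hX]; linear_combination -hY1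
  have hXZ : Y 0 * Y (-1) = Y 0 - Y (-1) := by rw [hX]; linear_combination hZ1
  have hYZ : Y 1 * Y (-1) = (1 / 2 : ℝ) • (Y 1 - Y (-1)) := by
    have : (2 : ℝ) • (Y 1 * Y (-1)) = Y 1 - Y (-1) := by
      rw [hX] at hXY hXZ
      rw [show (2 : ℝ) = 1 + 1 by norm_num, add_smul, one_smul]
      linear_combination (1 - Y (-1)) * hXY + (1 + Y 1) * hXZ
    rw [← this, smul_smul]; norm_num
  obtain ⟨u, v, w, hT, hint, habs, -, -, -, -, hv, hw⟩ :=
    exists_partialFraction hXY hXZ hYZ (k + 1) (3 * k + 2 - i) (k + 1 - i) (k + 1) (k + 1)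
      (by omega) (by omega) le_rfl le_rfl
  have hcoeff : ∀ h, coeff (h + 1) (Y 0 ^ (k + 1 - i) * Y 1 ^ (k + 1) * Y (-1) ^ (k + 1)) =
      ∑ m ∈ Finset.range (k + 1), ∑ j, (![u, v, w] : Fin 3 → ℕ → ℝ) j m *
        (h.choose m * padeNode j ^ (h - m)) := by
    intro h
    rw [hT, map_sum]
    refine Finset.sum_congr rfl fun m _ => ?_
    simp only [map_add, map_smul, smul_eq_mul, hY]
    rw [coeff_X_mul_geometric_pow, coeff_X_mul_geometric_pow, coeff_X_mul_geometric_pow,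
      Fin.sum_univ_three]
    rfl
  have hprod : Y 0 ^ (k + 1 - i) * Y 1 ^ (k + 1) * Y (-1) ^ (k + 1) =
      X ^ (3 * k + 3 - i) * ((PowerSeries.mk fun n => (1 : ℝ) ^ n) ^ (k + 1) *
        (PowerSeries.mk fun n => (-1 : ℝ) ^ n) ^ (k + 1)) := by
    rw [hX]
    simp only [hY, mul_pow]
    rw [show 3 * k + 3 - i = (k + 1 - i) + (k + 1) + (k + 1) by omega, pow_add, pow_add]
    ring
  have hpow : (2 : ℝ) ^ (3 * k + 2) = 2 ^ i * 2 ^ (3 * k + 2 - i) := by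
    rw [← pow_add]; congr 1; omega
  have hint' : ∀ x : ℝ, (∃ z : ℤ, 2 ^ (3 * k + 2 - i) * x = z) →
      ∃ z : ℤ, 2 ^ (3 * k + 2) * x = z := by
    rintro x ⟨z, hz⟩
    exact ⟨2 ^ i * z, by rw [hpow, mul_assoc, hz]; push_cast; ring⟩
  have habs' : (2 : ℝ) ^ (3 * k + 2 - i) ≤ 2 ^ (3 * k + 2) :=
    pow_le_pow_right₀ (by norm_num) (by omega)
  refine ⟨![u, v, w], fun h hh => ?_, fun h hh => ?_, ?_, ?_, ?_, ?_⟩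
  · rw [← hcoeff, hprod, coeff_X_pow_mul', if_neg (by omega)]
  · rw [← hcoeff, hprod, coeff_X_pow_mul', if_pos (by omega),
      show h + 1 - (3 * k + 3 - i) = 0 by omega]
    simp [coeff_zero_eq_constantCoeff]
  · intro j m
    fin_cases j
    · exact hint' _ (hint m).1
    · exact hint' _ (hint m).2.1
    · exact hint' _ (hint m).2.2
  · intro j m
    fin_cases j
    · exact (habs m).1.trans habs'
    · exact (habs m).2.1.trans habs'
    · exact (habs m).2.2.trans habs'
  · have := hv (by omega) (Or.inl (by omega))
    simpa [pow_succ] using this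
  · have := hw (by omega) (Or.inl (by omega))
    have h2 : ((-1 : ℝ)) ^ (k + 1 - i + (k + 1)) = (-1) ^ i := by
      rcases Nat.even_or_odd i with h | h
      · rw [h.neg_one_pow, Even.neg_one_pow]
        have := Nat.even_iff.mp h; rw [Nat.even_iff]; omega
      · rw [h.neg_one_pow, Odd.neg_one_pow]
        have := Nat.odd_iff.mp h; rw [Nat.odd_iff]; omega
    rw [h2] at this
    exact this

/-- The polynomial `∑ e m * choose (k + 1/2) m * X ^ m * (1 + a X) ^ (k - m)`. -/
noncomputable def padePoly (k : ℕ) (a : ℝ) (e : ℕ → ℝ) : Polynomial ℝ :=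
  ∑ m ∈ Finset.range (k + 1), Polynomial.C (e m * Ring.choose (k + 1 / 2 : ℝ) m) *
    Polynomial.X ^ m * (1 + Polynomial.C a * Polynomial.X) ^ (k - m)

theorem natDegree_padePoly_le (k : ℕ) (a : ℝ) (e : ℕ → ℝ) : (padePoly k a e).natDegree ≤ k := by
  refine Polynomial.natDegree_sum_le_of_forall_le _ _ fun m hm => ?_
  have hm' : m ≤ k := by simpa [Nat.lt_succ_iff] using hm
  have h1 : ((1 + Polynomial.C a * Polynomial.X : Polynomial ℝ)).natDegree ≤ 1 := by
    compute_degree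
  calc _ ≤ (Polynomial.C (e m * Ring.choose (k + 1 / 2 : ℝ) m) * Polynomial.X ^ m).natDegree +
        ((1 + Polynomial.C a * Polynomial.X : Polynomial ℝ) ^ (k - m)).natDegree :=
        Polynomial.natDegree_mul_le
    _ ≤ m + (k - m) := by
        gcongr
        · exact Polynomial.natDegree_C_mul_X_pow_le _ _
        · exact (Polynomial.natDegree_pow_le_of_le _ h1).trans (by simp)
    _ = k := Nat.add_sub_cancel' hm'

theorem eval_padePoly (k : ℕ) (a : ℝ) (e : ℕ → ℝ) (x : ℝ) :
    (padePoly k a e).eval x = ∑ m ∈ Finset.range (k + 1),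
      e m * Ring.choose (k + 1 / 2 : ℝ) m * x ^ m * (1 + a * x) ^ (k - m) := by
  simp [padePoly, Polynomial.eval_finsetSum]

theorem eval_zero_padePoly (k : ℕ) (a : ℝ) (e : ℕ → ℝ) : (padePoly k a e).eval 0 = e 0 := by
  rw [eval_padePoly, Finset.sum_range_succ', Finset.sum_eq_zero]
  · simp
  · simp

theorem choose_mul_natChoose (k h m : ℕ) (hm : m ≤ k) :
    Ring.choose (k + 1 / 2 : ℝ) h * h.choose m = if m ≤ h then
      Ring.choose (k + 1 / 2 : ℝ) m * Ring.choose (1 / 2 + (k - m : ℕ) : ℝ) (h - m) else 0 := by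
  split_ifs with h1
  · have := Ring.choose_smul_choose (k + 1 / 2 : ℝ) h1
    rw [nsmul_eq_mul] at this
    rw [mul_comm, this]
    congr 2
    push_cast [hm]; ring
  · rw [Nat.choose_eq_zero_of_lt (by omega)]; simp

open PowerSeries in
theorem mk_choose_mul_sum_eq (k : ℕ) (a : ℝ) (e : ℕ → ℝ) :
    (PowerSeries.mk fun h => Ring.choose (k + 1 / 2 : ℝ) h *
      ∑ m ∈ Finset.range (k + 1), e m * (h.choose m * a ^ (h - m))) =
    (padePoly k a e : PowerSeries ℝ) * rescale a (PowerSeries.binomialSeries ℝ (1 / 2 : ℝ)) := by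
  have hp : (padePoly k a e : PowerSeries ℝ) = ∑ m ∈ Finset.range (k + 1),
      C (e m * Ring.choose (k + 1 / 2 : ℝ) m) * X ^ m * (1 + C a * X) ^ (k - m) := by
    have : (padePoly k a e : PowerSeries ℝ) =
      Polynomial.coeToPowerSeries.ringHom (padePoly k a e) := rfl
    rw [this, padePoly, map_sum]
    simp
  have hterm : ∀ m, (1 + C a * X) ^ (k - m) * rescale a (PowerSeries.binomialSeries ℝ (1 / 2 : ℝ))
      = rescale a (PowerSeries.binomialSeries ℝ (1 / 2 + (k - m : ℕ) : ℝ)) := by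
    intro m
    rw [PowerSeries.binomialSeries_add, PowerSeries.binomialSeries_nat]
    simp [mul_comm, rescale_X]
  rw [hp, Finset.sum_mul]
  simp_rw [mul_assoc _ _ (rescale a _), hterm]
  ext h
  rw [coeff_mk, map_sum, Finset.mul_sum]
  refine Finset.sum_congr rfl fun m hm => ?_
  have hm' : m ≤ k := by simpa [Nat.lt_succ_iff] using hm
  rw [mul_assoc, coeff_C_mul, coeff_X_pow_mul', coeff_rescale, binomialSeries_coeff]
  have := choose_mul_natChoose k h m hm'
  calc _ = e m * a ^ (h - m) * (Ring.choose (k + 1 / 2 : ℝ) h * h.choose m) := by ring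
    _ = _ := by rw [this]; split_ifs <;> simp; ring

theorem choose_half_ne_zero (k n : ℕ) : Ring.choose (k + 1 / 2 : ℝ) n ≠ 0 := by
  rw [Ring.choose_eq_smul, smul_ne_zero_iff]
  refine ⟨inv_ne_zero (by exact_mod_cast n.factorial_ne_zero), ?_⟩
  induction n with
  | zero => simp
  | succ n ih =>
    rw [descPochhammer_succ_right, Polynomial.smeval_mul]
    refine mul_ne_zero ih ?_
    simp only [Polynomial.smeval_sub, Polynomial.smeval_X, pow_one, Polynomial.smeval_natCast]
    intro h
    have h2 : (2 * k + 1 : ℝ) = 2 * n := by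
      simp at h
      linarith
    have : 2 * k + 1 = 2 * n := by exact_mod_cast h2
    omega

open PowerSeries in
theorem exists_padePoly_row_ne_zero (k : ℕ) (e : Fin 3 → Fin 3 → ℕ → ℝ)
    (hvan : ∀ (i : Fin 3) (h : ℕ), h + (i : ℕ) < 3 * k + 2 →
      ∑ m ∈ Finset.range (k + 1), ∑ j, e i j m * (h.choose m * padeNode j ^ (h - m)) = 0)
    (hone : ∀ (i : Fin 3) (h : ℕ), h + (i : ℕ) = 3 * k + 2 →
      ∑ m ∈ Finset.range (k + 1), ∑ j, e i j m * (h.choose m * padeNode j ^ (h - m)) = 1)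
    (h1 : ∀ i : Fin 3, 0 < (-1) ^ k * e i 1 0) (h2 : ∀ i : Fin 3, 0 < (-1) ^ (i : ℕ) * e i 2 0)
    (t : ℝ) (ht : t ≠ 0) (w : Fin 3 → ℝ) (hw : w 0 ≠ 0) :
    ∃ i, ∑ j, (padePoly k (padeNode j) (e i j)).eval t * w j ≠ 0 := by
  set p : Fin 3 → Fin 3 → Polynomial ℝ := fun i j => padePoly k (padeNode j) (e i j) with hp
  set F : Fin 3 → PowerSeries ℝ :=
    fun j => rescale (padeNode j) (PowerSeries.binomialSeries ℝ (1 / 2 : ℝ)) with hF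
  have hF0 : F 0 = 1 := by
    simp only [hF, padeNode, Matrix.cons_val_zero]
    ext n
    rw [coeff_rescale, coeff_one]
    rcases n with _ | n <;> simp
  have hL : ∀ i, ∑ j, (p i j : PowerSeries ℝ) * F j = PowerSeries.mk fun h =>
      Ring.choose (k + 1 / 2 : ℝ) h *
      ∑ m ∈ Finset.range (k + 1), ∑ j, e i j m * (h.choose m * padeNode j ^ (h - m)) := by
    intro i
    simp only [hp, hF, ← mk_choose_mul_sum_eq]
    ext h
    rw [map_sum]
    simp only [coeff_mk]
    rw [Finset.sum_comm, Finset.mul_sum]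
  set Dt : Polynomial ℝ := p 0 0 * (p 1 1 * p 2 2 - p 1 2 * p 2 1)
    - p 1 0 * (p 0 1 * p 2 2 - p 0 2 * p 2 1) + p 2 0 * (p 0 1 * p 1 2 - p 0 2 * p 1 1) with hDt
  have hdeg : Dt.natDegree ≤ 3 * k := by
    have hd : ∀ i j, (p i j).natDegree ≤ k := fun i j => natDegree_padePoly_le _ _ _
    have h2 : ∀ a b c d : Polynomial ℝ, a.natDegree ≤ k → b.natDegree ≤ k → c.natDegree ≤ k →
        d.natDegree ≤ k → (a * b - c * d).natDegree ≤ k + k := fun a b c d ha hb hc hd =>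
      (Polynomial.natDegree_sub_le_of_le (Polynomial.natDegree_mul_le_of_le ha hb)
        (Polynomial.natDegree_mul_le_of_le hc hd)).trans (max_self _).le
    have h3 : ∀ a b c d e : Polynomial ℝ, a.natDegree ≤ k → b.natDegree ≤ k → c.natDegree ≤ k →
        d.natDegree ≤ k → e.natDegree ≤ k → (e * (a * b - c * d)).natDegree ≤ 3 * k :=
      fun a b c d e ha hb hc hd he =>
      (Polynomial.natDegree_mul_le_of_le he (h2 a b c d ha hb hc hd)).trans (by omega)
    refine Polynomial.natDegree_add_le_of_degree_le
      (Polynomial.natDegree_sub_le_of_le ?_ ?_ |>.trans (max_self _).le) ?_ <;>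
    exact h3 _ _ _ _ _ (hd _ _) (hd _ _) (hd _ _) (hd _ _) (hd _ _)
  have hdvd : ∀ i : Fin 3, ∃ G : PowerSeries ℝ,
      (∑ j, (p i j : PowerSeries ℝ) * F j = X ^ (3 * k) * G) ∧
      constantCoeff G = if i = 2 then Ring.choose (k + 1 / 2 : ℝ) (3 * k) else 0 := by
    intro i
    have : (X : PowerSeries ℝ) ^ (3 * k) ∣ ∑ j, (p i j : PowerSeries ℝ) * F j := by
      rw [X_pow_dvd_iff]
      intro h hh
      rw [hL, coeff_mk, hvan i h (by omega), mul_zero]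
    obtain ⟨G, hG⟩ := this
    refine ⟨G, hG, ?_⟩
    have hc : constantCoeff G = coeff (3 * k) (∑ j, (p i j : PowerSeries ℝ) * F j) := by
      rw [hG, coeff_X_pow_mul', if_pos le_rfl, Nat.sub_self, coeff_zero_eq_constantCoeff]
    rw [hc, hL, coeff_mk]
    split_ifs with hi
    · subst hi
      rw [hone 2 _ (by simp), mul_one]
    · rw [hvan i _ (by omega), mul_zero]
  choose G hG hG0 using hdvd
  have hDps : (Dt : PowerSeries ℝ) = X ^ (3 * k) *
      (G 0 * ((p 1 1 * p 2 2 - p 1 2 * p 2 1 : Polynomial ℝ) : PowerSeries ℝ)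
      - G 1 * ((p 0 1 * p 2 2 - p 0 2 * p 2 1 : Polynomial ℝ) : PowerSeries ℝ) +
      G 2 * ((p 0 1 * p 1 2 - p 0 2 * p 1 1 : Polynomial ℝ) : PowerSeries ℝ)) := by
    have e0 := hG 0
    have e1 := hG 1
    have e2 := hG 2
    simp only [Fin.sum_univ_three, hF0] at e0 e1 e2
    rw [hDt]
    push_cast
    linear_combination (p 1 1 * p 2 2 - p 1 2 * p 2 1 : PowerSeries ℝ) * e0
      - (p 0 1 * p 2 2 - p 0 2 * p 2 1 : PowerSeries ℝ) * e1
      + (p 0 1 * p 1 2 - p 0 2 * p 1 1 : PowerSeries ℝ) * e2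
  have hcoeff : ∀ n, Dt.coeff n = coeff n (Dt : PowerSeries ℝ) := fun n =>
    (Polynomial.coeff_coe _ _).symm
  have hp0 : ∀ i j, (p i j).coeff 0 = e i j 0 := by
    intro i j
    rw [Polynomial.coeff_zero_eq_eval_zero, eval_zero_padePoly]
  have hlead : Dt.coeff (3 * k) = Ring.choose (k + 1 / 2 : ℝ) (3 * k) *
      (e 0 1 0 * e 1 2 0 - e 0 2 0 * e 1 1 0) := by
    rw [hcoeff, hDps, coeff_X_pow_mul', if_pos le_rfl, Nat.sub_self, coeff_zero_eq_constantCoeff]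
    simp [hG0, hp0]
  have hc : e 0 1 0 * e 1 2 0 - e 0 2 0 * e 1 1 0 ≠ 0 := by
    have a1 := h1 0
    have a2 := h1 1
    have b1 := h2 0
    have b2 := h2 1
    simp only [Fin.val_zero, Fin.val_one, pow_zero, pow_one, one_mul] at b1 b2
    intro h
    have c1 := mul_pos a1 b2
    have c2 := mul_pos a2 b1
    have : ((-1) ^ k * e 0 1 0) * (-1 * e 1 2 0) + ((-1) ^ k * e 1 1 0) * e 0 2 0 =
      -(-1) ^ k * (e 0 1 0 * e 1 2 0 - e 0 2 0 * e 1 1 0) := by ring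
    rw [h, mul_zero] at this
    linarith
  have hDeval : Dt.eval t ≠ 0 := by
    have : Dt = Polynomial.C (Dt.coeff (3 * k)) * Polynomial.X ^ (3 * k) := by
      ext n
      rw [Polynomial.coeff_C_mul_X_pow]
      split_ifs with hn
      · rw [hn]
      · rcases lt_or_gt_of_ne hn with h | h
        · rw [hcoeff, hDps, coeff_X_pow_mul', if_neg (by omega)]
        · exact Polynomial.coeff_eq_zero_of_natDegree_lt (by omega)
    rw [this, hlead]
    simp only [Polynomial.eval_mul, Polynomial.eval_C, Polynomial.eval_pow, Polynomial.eval_X]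
    exact mul_ne_zero (mul_ne_zero (choose_half_ne_zero _ _) hc) (pow_ne_zero _ ht)
  by_contra! hall
  have e0 := hall 0
  have e1 := hall 1
  have e2 := hall 2
  simp only [Fin.sum_univ_three] at e0 e1 e2
  refine mul_ne_zero hDeval hw ?_
  simp only [hDt, Polynomial.eval_add, Polynomial.eval_sub, Polynomial.eval_mul]
  linear_combination ((p 1 1).eval t * (p 2 2).eval t - (p 1 2).eval t * (p 2 1).eval t) * e0
      - ((p 0 1).eval t * (p 2 2).eval t - (p 0 2).eval t * (p 2 1).eval t) * e1
      + ((p 0 1).eval t * (p 1 2).eval t - (p 0 2).eval t * (p 1 1).eval t) * e2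

theorem four_pow_mul_choose_neg_half (n : ℕ) :
    4 ^ n * Ring.choose (-(1 / 2) : ℝ) n = (-1) ^ n * n.centralBinom := by
  induction n with
  | zero => simp
  | succ n ih =>
    have h1 := Ring.choose_smul_choose (-(1 / 2) : ℝ) n.le_succ
    rw [Nat.choose_succ_self_right, nsmul_eq_mul, Nat.succ_eq_add_one, Nat.add_sub_cancel_left,
      Ring.choose_one_right] at h1
    have h2 : ((n + 1 : ℕ) : ℝ) * (n + 1).centralBinom = 2 * (2 * n + 1) * n.centralBinom := by
      exact_mod_cast n.succ_mul_centralBinom_succ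
    have hn : ((n + 1 : ℕ) : ℝ) ≠ 0 := by positivity
    refine mul_left_cancel₀ hn ?_
    linear_combination 4 ^ (n + 1) * h1 + 4 * (-(1 / 2) - (n : ℝ)) * ih + (-1) ^ n * h2

theorem choose_half_add_bound_and_integral (j n : ℕ) :
    |Ring.choose (-(1 / 2) + j : ℝ) n| ≤ 2 ^ j ∧
      ∃ z : ℤ, 4 ^ n * Ring.choose (-(1 / 2) + j : ℝ) n = z := by
  induction j generalizing n with
  | zero =>
    have h := four_pow_mul_choose_neg_half n
    simp only [Nat.cast_zero, add_zero, pow_zero]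
    refine ⟨?_, (-1) ^ n * n.centralBinom, by rw [h]; push_cast; ring⟩
    have h4 : (0 : ℝ) < 4 ^ n := by positivity
    have hcb : (n.centralBinom : ℝ) ≤ 4 ^ n := by
      have : n.centralBinom ≤ 2 ^ (2 * n) := by
        rw [Nat.centralBinom_eq_two_mul_choose]; exact Nat.choose_le_two_pow _ _
      rw [pow_mul] at this
      exact_mod_cast this
    have habs : 4 ^ n * |Ring.choose (-(1 / 2) : ℝ) n| = n.centralBinom := by
      rw [← abs_of_pos h4, ← abs_mul, h, abs_mul, abs_pow]
      simp
    by_contra! hlt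
    nlinarith
  | succ j ih =>
    rcases n with _ | n
    · simp only [Ring.choose_zero_right, abs_one]
      exact ⟨one_le_pow₀ (by norm_num), 1, by simp⟩
    · have hr : (-(1 / 2) + (j + 1 : ℕ) : ℝ) = (-(1 / 2) + j) + 1 := by push_cast; ring
      rw [hr, Ring.choose_succ_succ]
      obtain ⟨h1, z, hz⟩ := ih n
      obtain ⟨h2, z', hz'⟩ := ih (n + 1)
      refine ⟨(abs_add_le _ _).trans (by rw [pow_succ]; linarith), 4 * z + z', ?_⟩
      push_cast
      rw [← hz, ← hz']; ring

theorem choose_half_bound_and_integral (k n : ℕ) :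
    |Ring.choose (k + 1 / 2 : ℝ) n| ≤ 2 ^ (k + 1) ∧
      ∃ z : ℤ, 4 ^ n * Ring.choose (k + 1 / 2 : ℝ) n = z := by
  have h := choose_half_add_bound_and_integral (k + 1) n
  rwa [show (-(1 / 2) + (k + 1 : ℕ) : ℝ) = k + 1 / 2 by push_cast; ring] at h

theorem hasSum_choose_mul_pow (r x : ℝ) (hx : |x| < 1) :
    HasSum (fun n => Ring.choose r n * x ^ n) ((1 + x) ^ r) := by
  have h := (Real.one_add_rpow_hasFPowerSeriesOnBall_zero (a := r)).hasSum (y := x)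
    (by simpa [← ofReal_norm] using hx)
  simpa [binomialSeries, FormalMultilinearSeries.coeff_ofScalars, mul_comm] using h

theorem hasSum_padePoly_mul_sqrt (k : ℕ) (a : ℝ) (e : ℕ → ℝ) (t : ℝ) (hat : |a * t| < 1) :
    HasSum (fun h => Ring.choose (k + 1 / 2 : ℝ) h *
      (∑ m ∈ Finset.range (k + 1), e m * (h.choose m * a ^ (h - m))) * t ^ h)
      ((padePoly k a e).eval t * √(1 + a * t)) := by
  have hpos : 0 < 1 + a * t := by linarith [(abs_lt.mp hat).1]
  rw [eval_padePoly, Finset.sum_mul]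
  simp_rw [Finset.mul_sum, Finset.sum_mul]
  refine hasSum_sum fun m hm => ?_
  have hm' : m ≤ k := by simpa [Nat.lt_succ_iff] using hm
  have h1 := hasSum_choose_mul_pow (1 / 2 + (k - m : ℕ) : ℝ) (a * t) hat
  rw [Real.rpow_add hpos, Real.rpow_natCast, ← Real.sqrt_eq_rpow] at h1
  have h2 := h1.mul_left (e m * Ring.choose (k + 1 / 2 : ℝ) m * t ^ m)
  have h0 : ∑ h ∈ Finset.range m, Ring.choose (k + 1 / 2 : ℝ) h *
      (e m * (h.choose m * a ^ (h - m))) * t ^ h = 0 := by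
    refine Finset.sum_eq_zero fun h hh => ?_
    rw [Nat.choose_eq_zero_of_lt (Finset.mem_range.mp hh)]
    simp
  rw [← hasSum_nat_add_iff' m, h0, sub_zero]
  have hf : ∀ n : ℕ, Ring.choose (k + 1 / 2 : ℝ) (n + m) *
      (e m * ((n + m).choose m * a ^ (n + m - m))) * t ^ (n + m) =
      e m * Ring.choose (k + 1 / 2 : ℝ) m * t ^ m *
        (Ring.choose (1 / 2 + (k - m : ℕ) : ℝ) n * (a * t) ^ n) := by
    intro n
    have h3 := choose_mul_natChoose k (n + m) m hm'
    rw [if_pos (by omega), Nat.add_sub_cancel] at h3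
    rw [Nat.add_sub_cancel, mul_pow, pow_add]
    linear_combination e m * a ^ n * (t ^ n * t ^ m) * h3
  simp_rw [hf]
  rw [mul_assoc (_ * t ^ m), mul_comm (_ ^ (k - m))]
  exact h2

theorem abs_padeNode_le (j : Fin 3) : |padeNode j| ≤ 1 := by
  fin_cases j <;> simp [padeNode]

theorem succ_le_two_pow (k : ℕ) : (k + 1 : ℝ) ≤ 2 ^ k := by
  exact_mod_cast k.lt_two_pow_self

theorem abs_sum_padePoly_mul_sqrt_le (k : ℕ) (hk : 1 ≤ k) (e : Fin 3 → ℕ → ℝ)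
    (hvan : ∀ h, h < 3 * k →
      ∑ m ∈ Finset.range (k + 1), ∑ j, e j m * (h.choose m * padeNode j ^ (h - m)) = 0)
    (he : ∀ j m, |e j m| ≤ 2 ^ (3 * k + 2)) (t : ℝ) (ht : 0 < t) (ht' : t ≤ 1 / 4) :
    |∑ j, (padePoly k (padeNode j) (e j)).eval t * √(1 + padeNode j * t)| ≤
      2 ^ (14 * k) * t ^ (3 * k) := by
  set c : ℕ → ℝ := fun h =>
    ∑ m ∈ Finset.range (k + 1), ∑ j, e j m * (h.choose m * padeNode j ^ (h - m)) with hc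
  have hsum : HasSum (fun h => Ring.choose (k + 1 / 2 : ℝ) h * c h * t ^ h)
      (∑ j, (padePoly k (padeNode j) (e j)).eval t * √(1 + padeNode j * t)) := by
    have := hasSum_sum (s := Finset.univ) fun j _ => hasSum_padePoly_mul_sqrt k (padeNode j) (e j) t
      (by rw [abs_mul, abs_of_pos ht]; nlinarith [abs_padeNode_le j])
    convert this using 1
    ext h
    rw [← Finset.sum_mul, ← Finset.mul_sum, Finset.sum_comm]
  have hcb : ∀ h, |c h| ≤ 2 ^ (4 * k + 4) * 2 ^ h := by
    intro h
    have hterm : ∀ m j, |e j m * (h.choose m * padeNode j ^ (h - m))| ≤ 2 ^ (3 * k + 2) * 2 ^ h := by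
      intro m j
      rw [abs_mul, abs_mul, abs_pow, Nat.abs_cast]
      have h1 : (h.choose m : ℝ) ≤ 2 ^ h := by exact_mod_cast Nat.choose_le_two_pow h m
      have h2 : |padeNode j| ^ (h - m) ≤ 1 := pow_le_one₀ (abs_nonneg _) (abs_padeNode_le j)
      calc _ ≤ 2 ^ (3 * k + 2) * ((2 : ℝ) ^ h * 1) := by
            gcongr
            exact he j m
        _ = _ := by ring
    calc |c h| ≤ ∑ m ∈ Finset.range (k + 1), ∑ j : Fin 3, 2 ^ (3 * k + 2) * (2 : ℝ) ^ h :=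
          (Finset.abs_sum_le_sum_abs _ _).trans <| Finset.sum_le_sum fun m _ =>
            (Finset.abs_sum_le_sum_abs _ _).trans <| Finset.sum_le_sum fun j _ => hterm m j
      _ = (k + 1) * 3 * (2 ^ (3 * k + 2) * 2 ^ h) := by simp; ring
      _ ≤ 2 ^ k * 4 * (2 ^ (3 * k + 2) * 2 ^ h) := by
          have := succ_le_two_pow k
          gcongr; norm_num
      _ = _ := by
          rw [show 4 * k + 4 = k + (3 * k + 2) + 2 by ring]
          simp only [pow_add]; ring
  have hgeom : HasSum (fun n : ℕ => (2 : ℝ) ^ (5 * k + 5) * (2 * t) ^ (3 * k) * (1 / 2) ^ n)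
      (2 ^ (5 * k + 5) * (2 * t) ^ (3 * k) * 2) := hasSum_geometric_two.mul_left _
  have h0 : ∑ h ∈ Finset.range (3 * k), Ring.choose (k + 1 / 2 : ℝ) h * c h * t ^ h = 0 := by
    refine Finset.sum_eq_zero fun h hh => ?_
    rw [show c h = 0 from hvan h (Finset.mem_range.mp hh)]; simp
  rw [← hasSum_nat_add_iff' (3 * k), h0, sub_zero] at hsum
  have hb := tsum_of_norm_bounded hgeom (f := fun n =>
    Ring.choose (k + 1 / 2 : ℝ) (n + 3 * k) * c (n + 3 * k) * t ^ (n + 3 * k)) fun n => by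
      rw [Real.norm_eq_abs, abs_mul, abs_mul, abs_pow, abs_of_pos ht]
      have h1 := (choose_half_bound_and_integral k (n + 3 * k)).1
      have h2 := hcb (n + 3 * k)
      have h3 : (2 * t) ^ n ≤ (1 / 2) ^ n := by gcongr; linarith
      calc _ ≤ 2 ^ (k + 1) * (2 ^ (4 * k + 4) * 2 ^ (n + 3 * k)) * t ^ (n + 3 * k) := by gcongr
        _ = 2 ^ (5 * k + 5) * (2 * t) ^ (3 * k) * (2 * t) ^ n := by
          rw [mul_pow, mul_pow, show 5 * k + 5 = k + 1 + (4 * k + 4) by ring]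
          simp only [pow_add]; ring
        _ ≤ _ := by gcongr
  rw [hsum.tsum_eq, Real.norm_eq_abs] at hb
  refine hb.trans ?_
  calc (2 : ℝ) ^ (5 * k + 5) * (2 * t) ^ (3 * k) * 2 = 2 ^ (8 * k + 6) * t ^ (3 * k) := by
        rw [mul_pow, show 8 * k + 6 = 5 * k + 5 + 3 * k + 1 by ring]
        simp only [pow_add]; ring
    _ ≤ _ := by
        gcongr
        · norm_num
        · omega

theorem abs_eval_padePoly_le (k : ℕ) (hk : 1 ≤ k) (a : ℝ) (ha : |a| ≤ 1) (e : ℕ → ℝ)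
    (he : ∀ m, |e m| ≤ 2 ^ (3 * k + 2)) (t : ℝ) (ht : 0 < t) (ht' : t ≤ 1 / 4) :
    |(padePoly k a e).eval t| ≤ 2 ^ (9 * k) := by
  rw [eval_padePoly]
  have h1 : |1 + a * t| ≤ 2 := by
    have := abs_le.mp ha
    rw [abs_le]; constructor <;> nlinarith
  calc _ ≤ ∑ m ∈ Finset.range (k + 1), (2 : ℝ) ^ (3 * k + 2) * 2 ^ (k + 1) * 1 * 2 ^ k := by
        refine (Finset.abs_sum_le_sum_abs _ _).trans <| Finset.sum_le_sum fun m _ => ?_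
        rw [abs_mul, abs_mul, abs_mul, abs_pow, abs_pow, abs_of_pos ht]
        have h2 := (choose_half_bound_and_integral k m).1
        have h3 : t ^ m ≤ 1 := pow_le_one₀ ht.le (by linarith)
        have h4 : |1 + a * t| ^ (k - m) ≤ 2 ^ k :=
          (pow_le_pow_left₀ (abs_nonneg _) h1 _).trans
            (pow_le_pow_right₀ (by norm_num) (Nat.sub_le _ _))
        gcongr
        exact he m
    _ = (k + 1) * 2 ^ (5 * k + 3) := by
        simp only [Finset.sum_const, Finset.card_range, nsmul_eq_mul]
        rw [show 5 * k + 3 = 3 * k + 2 + (k + 1) + k by ring]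
        push_cast
        simp only [pow_add]; ring
    _ ≤ 2 ^ k * 2 ^ (5 * k + 3) := by
        have := succ_le_two_pow k
        gcongr
    _ = 2 ^ (6 * k + 3) := by rw [← pow_add]; congr 1; ring
    _ ≤ 2 ^ (9 * k) := by
        gcongr
        · norm_num
        · omega

theorem exists_int_eq_mul_eval_padePoly (k : ℕ) (a : ℤ) (e : ℕ → ℝ)
    (he : ∀ m, ∃ z : ℤ, 2 ^ (3 * k + 2) * e m = z) (x : ℝ) (x' : ℤ) (hx : x = x') (hx0 : x ≠ 0) :
    ∃ z : ℤ, 2 ^ (3 * k + 2) * x ^ (2 * k) * (padePoly k a e).eval (4 / x ^ 2) = z := by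
  choose f hf using he
  choose g hg using fun m => (choose_half_bound_and_integral k m).2
  refine ⟨∑ m ∈ Finset.range (k + 1), f m * g m * (x' ^ 2 + 4 * a) ^ (k - m), ?_⟩
  rw [eval_padePoly, Finset.mul_sum]
  push_cast
  refine Finset.sum_congr rfl fun m hm => ?_
  have hm' : m ≤ k := by simpa [Nat.lt_succ_iff] using hm
  rw [← hf, ← hg, ← hx, show 1 + a * (4 / x ^ 2) = (x ^ 2 + 4 * a) / x ^ 2 by field_simp,
    div_pow, div_pow]
  have : x ^ (2 * k) = (x ^ 2) ^ m * (x ^ 2) ^ (k - m) := by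
    rw [← pow_add, Nat.add_sub_cancel' hm', pow_mul]
  rw [this]
  field_simp

theorem abs_sqrt_one_add_sub_one_le (u : ℝ) (hu : -1 ≤ u) : |√(1 + u) - 1| ≤ |u| := by
  have h1 : (√(1 + u) - 1) * (√(1 + u) + 1) = u := by
    linear_combination Real.sq_sqrt (show 0 ≤ 1 + u by linarith)
  have h2 : 1 ≤ |√(1 + u) + 1| := by
    rw [abs_of_nonneg (by positivity)]; linarith [Real.sqrt_nonneg (1 + u)]
  calc |√(1 + u) - 1| ≤ |√(1 + u) - 1| * |√(1 + u) + 1| := le_mul_of_one_le_right (abs_nonneg _) h2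
    _ = |u| := by rw [← abs_mul, h1]

theorem one_le_of_simultaneous_pell {D₁ D₂ x₁ y₁ z₁ x y z : ℕ} (k : ℕ) (hk : 1 ≤ k)
    (hx₁ : 4 ≤ x₁) (hx : 2 ≤ x)
    (hy₁ : x₁ ^ 2 = D₁ * y₁ ^ 2 + 4) (hz₁ : x₁ ^ 2 + 4 = D₂ * z₁ ^ 2)
    (hy : x ^ 2 = D₁ * y ^ 2 + 4) (hz : x ^ 2 + 4 = D₂ * z ^ 2) :
    (1 : ℝ) ≤ 2 ^ (25 * k) * (x * x₁ / x₁ ^ (4 * k) + x₁ ^ (2 * k + 1) / x) := by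
  have hX₁ : (4 : ℝ) ≤ x₁ := by exact_mod_cast hx₁
  have hX : (2 : ℝ) ≤ x := by exact_mod_cast hx
  have hX₁0 : (0 : ℝ) < x₁ := by linarith
  have hX0 : (0 : ℝ) < x := by linarith
  have hnode : ∀ j, padeNode j = ((![0, 1, -1] : Fin 3 → ℤ) j : ℝ) := by
    intro j; fin_cases j <;> simp [padeNode]
  set t : ℝ := 4 / (x₁ : ℝ) ^ 2 with ht
  have ht0 : 0 < t := by positivity
  have ht1 : t ≤ 1 / 4 := by
    rw [ht, div_le_iff₀ (by positivity)]; nlinarith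
  set σ : ℝ := 4 / (x : ℝ) ^ 2 with hσ
  have hσ0 : 0 < σ := by positivity
  have hσ1 : σ ≤ 1 := by
    rw [hσ, div_le_iff₀ (by positivity)]; nlinarith
  choose e hvan hone hint habs h1 h2 using
    fun i : Fin 3 => exists_vanishing_combination k i hk i.isLt
  set w : Fin 3 → ℕ := ![x₁ * x, D₂ * z₁ * z, D₁ * y₁ * y] with hw
  obtain ⟨i, hi⟩ := exists_padePoly_row_ne_zero k e hvan hone h1 h2 t ht0.ne'
    (fun j => (w j : ℝ)) (by simp [hw]; omega)
  set p : Fin 3 → ℝ := fun j => (padePoly k (padeNode j) (e i j)).eval t with hp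
  have hwsq : ∀ j, (w j : ℝ) ^ 2 = (x₁ ^ 2 + 4 * padeNode j) * (x ^ 2 + 4 * padeNode j) := by
    have e1 : (x₁ : ℝ) ^ 2 = D₁ * y₁ ^ 2 + 4 := by exact_mod_cast hy₁
    have e2 : (x₁ : ℝ) ^ 2 + 4 = D₂ * z₁ ^ 2 := by exact_mod_cast hz₁
    have e3 : (x : ℝ) ^ 2 = D₁ * y ^ 2 + 4 := by exact_mod_cast hy
    have e4 : (x : ℝ) ^ 2 + 4 = D₂ * z ^ 2 := by exact_mod_cast hz
    intro j
    fin_cases j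
    · simp [hw, padeNode]; ring
    · simp [hw, padeNode]; rw [e2, e4]; ring
    · simp [hw, padeNode]; rw [e1, e3]; ring
  have hweq : ∀ j, (w j : ℝ) = x₁ * x * (√(1 + padeNode j * t) * √(1 + padeNode j * σ)) := by
    intro j
    have ha := abs_le.mp (abs_padeNode_le j)
    have hn1 : 0 ≤ 1 + padeNode j * t := by nlinarith
    have hn2 : 0 ≤ 1 + padeNode j * σ := by nlinarith
    refine (pow_left_inj₀ (Nat.cast_nonneg _) (by positivity) two_ne_zero).mp ?_
    rw [mul_pow, mul_pow, mul_pow, Real.sq_sqrt hn1, Real.sq_sqrt hn2, hwsq, ht, hσ]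
    field_simp
  have hdiff : ∀ j, |(w j : ℝ) - x₁ * x * √(1 + padeNode j * t)| ≤ 8 * x₁ / x := by
    intro j
    have ha := abs_le.mp (abs_padeNode_le j)
    have hb : √(1 + padeNode j * t) ≤ 2 := by
      rw [Real.sqrt_le_left (by norm_num)]; nlinarith
    have hc : |√(1 + padeNode j * σ) - 1| ≤ σ := by
      refine (abs_sqrt_one_add_sub_one_le _ (by nlinarith)).trans ?_
      rw [abs_mul, abs_of_pos hσ0]
      exact mul_le_of_le_one_left hσ0.le (abs_padeNode_le j)
    rw [hweq, show x₁ * x * (√(1 + padeNode j * t) * √(1 + padeNode j * σ)) -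
      x₁ * x * √(1 + padeNode j * t) =
      x₁ * x * √(1 + padeNode j * t) * (√(1 + padeNode j * σ) - 1) by ring, abs_mul,
      abs_of_nonneg (by positivity)]
    calc _ ≤ x₁ * x * 2 * σ := by gcongr
      _ = _ := by rw [hσ]; field_simp; ring
  have hS : |∑ j, p j * w j| ≤ x₁ * x * (2 ^ (14 * k) * t ^ (3 * k)) +
      3 * (2 ^ (9 * k) * (8 * x₁ / x)) := by
    have hsplit : ∑ j, p j * w j = x₁ * x * ∑ j, p j * √(1 + padeNode j * t) +
        ∑ j, p j * (w j - x₁ * x * √(1 + padeNode j * t)) := by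
      rw [Finset.mul_sum, ← Finset.sum_add_distrib]
      exact Finset.sum_congr rfl fun j _ => by ring
    rw [hsplit]
    refine (abs_add_le _ _).trans (add_le_add ?_ ?_)
    · rw [abs_mul, abs_of_pos (by positivity : (0 : ℝ) < x₁ * x)]
      gcongr
      exact abs_sum_padePoly_mul_sqrt_le k hk (e i) (fun h hh => hvan i h (by omega)) (habs i)
        t ht0 ht1
    · calc _ ≤ ∑ j : Fin 3, (2 : ℝ) ^ (9 * k) * (8 * x₁ / x) := by
            refine (Finset.abs_sum_le_sum_abs _ _).trans (Finset.sum_le_sum fun j _ => ?_)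
            rw [abs_mul]
            gcongr
            · exact abs_eval_padePoly_le k hk _ (abs_padeNode_le j) _ (habs i j) t ht0 ht1
            · exact hdiff j
        _ = _ := by simp
  have hM : ∃ M : ℤ, 2 ^ (3 * k + 2) * (x₁ : ℝ) ^ (2 * k) * ∑ j, p j * w j = M := by
    choose q hq using fun j => exists_int_eq_mul_eval_padePoly k ((![0, 1, -1] : Fin 3 → ℤ) j)
      (e i j) (hint i j) x₁ x₁ (by simp) hX₁0.ne'
    refine ⟨∑ j, q j * w j, ?_⟩
    rw [Finset.mul_sum]
    push_cast
    refine Finset.sum_congr rfl fun j _ => ?_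
    rw [← hq, ← hnode]
    simp only [hp]; ring
  obtain ⟨M, hM⟩ := hM
  have hM1 : (1 : ℝ) ≤ |(M : ℝ)| := by
    have : M ≠ 0 := by
      rintro rfl
      rw [Int.cast_zero] at hM
      exact mul_ne_zero (by positivity) hi hM
    exact_mod_cast Int.one_le_abs this
  rw [← hM, abs_mul, abs_of_pos (by positivity)] at hM1
  refine hM1.trans ?_
  calc _ ≤ 2 ^ (3 * k + 2) * (x₁ : ℝ) ^ (2 * k) * (x₁ * x * (2 ^ (14 * k) * t ^ (3 * k)) +
      3 * (2 ^ (9 * k) * (8 * x₁ / x))) := by gcongr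
    _ = 2 ^ (23 * k + 2) * (x * x₁ / x₁ ^ (4 * k)) +
        3 * 2 ^ (12 * k + 5) * (x₁ ^ (2 * k + 1) / x) := by
      have h4 : (4 : ℝ) ^ (3 * k) = 2 ^ (6 * k) := by
        rw [show (4 : ℝ) = 2 ^ 2 by norm_num, ← pow_mul]; congr 1; ring
      have h6 : ((x₁ : ℝ) ^ 2) ^ (3 * k) = x₁ ^ (2 * k) * x₁ ^ (4 * k) := by
        rw [← pow_mul, ← pow_add]; congr 1; ring
      rw [ht, div_pow, h4, h6, show 23 * k + 2 = 3 * k + 2 + 14 * k + 6 * k by ring,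
        show 12 * k + 5 = 3 * k + 2 + 9 * k + 3 by ring]
      simp only [pow_add]
      field_simp
      ring
    _ ≤ 2 ^ (25 * k) * (x * x₁ / x₁ ^ (4 * k)) + 2 ^ (25 * k) * (x₁ ^ (2 * k + 1) / x) := by
      gcongr
      · norm_num
      · omega
      · calc (3 : ℝ) * 2 ^ (12 * k + 5) ≤ 2 ^ 2 * 2 ^ (12 * k + 5) := by gcongr; norm_num
          _ = 2 ^ (12 * k + 7) := by rw [← pow_add]; congr 1; ring
          _ ≤ _ := by
            gcongr
            · norm_num
            · omega
    _ = _ := by ring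

theorem not_large_of_simultaneous_pell {D₁ D₂ x₁ y₁ z₁ x y z : ℕ}
    (hx₁ : 2 ^ 51 ≤ x₁)
    (hy₁ : x₁ ^ 2 = D₁ * y₁ ^ 2 + 4) (hz₁ : x₁ ^ 2 + 4 = D₂ * z₁ ^ 2)
    (hy : x ^ 2 = D₁ * y ^ 2 + 4) (hz : x ^ 2 + 4 = D₂ * z ^ 2) : x ≤ x₁ ^ 26 := by
  by_contra! hlt
  have hx1 : 1 < x₁ := lt_of_lt_of_le (by norm_num) hx₁
  obtain ⟨j, hj4, hjl, hju⟩ : ∃ j, 4 ≤ j ∧ x₁ ^ (5 * j + 1) < x ∧ x < x₁ ^ (7 * j - 1) := by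
    have hex : ∃ j, x ≤ x₁ ^ (5 * j + 1) :=
      ⟨x, (Nat.lt_pow_self hx1).le.trans (Nat.pow_le_pow_right hx1.le (by omega))⟩
    obtain ⟨n, hn⟩ : ∃ n, n = Nat.find hex := ⟨_, rfl⟩
    have hn1 := Nat.find_spec hex
    rw [← hn] at hn1
    have hn5 : 5 < n := by
      by_contra! h
      have : x₁ ^ (5 * n + 1) ≤ x₁ ^ 26 := Nat.pow_le_pow_right hx1.le (by omega)
      omega
    have hn2 := Nat.find_min hex (m := n - 1) (by omega)
    refine ⟨n - 1, by omega, by simpa using hn2, hn1.trans_lt ?_⟩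
    exact Nat.pow_lt_pow_right hx1 (by omega)
  have hx2 : 2 ≤ x := by
    have := Nat.one_le_pow 26 x₁ (by omega)
    omega
  have hmain := one_le_of_simultaneous_pell (2 * j) (by omega) (by omega) hx2 hy₁ hz₁ hy hz
  have hX₁ : (2 : ℝ) ^ 51 ≤ x₁ := by exact_mod_cast hx₁
  have hX₁0 : (0 : ℝ) < x₁ := by positivity
  have hX0 : (0 : ℝ) < x := by positivity
  have hB : (2 : ℝ) * 2 ^ (25 * (2 * j)) ≤ x₁ ^ j := by
    calc (2 : ℝ) * 2 ^ (25 * (2 * j)) ≤ 2 ^ j * 2 ^ (25 * (2 * j)) := by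
          gcongr
          exact le_self_pow₀ (by norm_num) (by omega)
      _ = (2 ^ 51) ^ j := by rw [← pow_add, ← pow_mul]; congr 1; ring
      _ ≤ _ := by gcongr
  have hjl' : (x₁ : ℝ) ^ (5 * j + 1) < x := by exact_mod_cast hjl
  have hju' : (x : ℝ) < x₁ ^ (7 * j - 1) := by exact_mod_cast hju
  have t1 : 2 * (2 ^ (25 * (2 * j)) * (x * x₁ / (x₁ : ℝ) ^ (4 * (2 * j)))) < 1 := by
    calc _ = 2 * 2 ^ (25 * (2 * j)) * (x * x₁ / (x₁ : ℝ) ^ (4 * (2 * j))) := by ring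
      _ ≤ x₁ ^ j * (x * x₁ / (x₁ : ℝ) ^ (4 * (2 * j))) := by gcongr
      _ < x₁ ^ j * (x₁ ^ (7 * j - 1) * x₁ / (x₁ : ℝ) ^ (4 * (2 * j))) := by gcongr
      _ = 1 := by
        rw [← pow_succ, show 7 * j - 1 + 1 = 7 * j by omega, ← mul_div_assoc, ← pow_add,
          show j + 7 * j = 4 * (2 * j) by ring, div_self (by positivity)]
  have t2 : 2 * (2 ^ (25 * (2 * j)) * ((x₁ : ℝ) ^ (2 * (2 * j) + 1) / x)) < 1 := by
    calc _ = 2 * 2 ^ (25 * (2 * j)) * ((x₁ : ℝ) ^ (2 * (2 * j) + 1) / x) := by ring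
      _ ≤ x₁ ^ j * ((x₁ : ℝ) ^ (2 * (2 * j) + 1) / x) := by gcongr
      _ = x₁ ^ (5 * j + 1) / x := by
        rw [← mul_div_assoc, ← pow_add]; congr 2; ring
      _ < 1 := by rwa [div_lt_one hX0]
  rw [mul_add] at hmain
  linarith

/-- The system `x² - 4 = D₁ y²`, `x² + 4 = D₂ z²` has finitely many solutions. -/
theorem finite_simultaneous_pell (D₁ D₂ : ℕ) :
    {x : ℕ | (∃ y, x ^ 2 = D₁ * y ^ 2 + 4) ∧ ∃ z, x ^ 2 + 4 = D₂ * z ^ 2}.Finite := by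
  by_contra hinf
  obtain ⟨x₁, ⟨⟨y₁, hy₁⟩, z₁, hz₁⟩, hx₁⟩ := Set.Infinite.exists_gt hinf (2 ^ 51)
  obtain ⟨x, ⟨⟨y, hy⟩, z, hz⟩, hx⟩ := Set.Infinite.exists_gt hinf (x₁ ^ 26)
  exact absurd (not_large_of_simultaneous_pell hx₁.le hy₁ hz₁ hy hz) hx.not_ge

theorem lucas_add_lucas (P Q : ℤ) (n : ℕ) :
    2 * lucasU P Q (n + 1) = P * lucasU P Q n + lucasV P Q n ∧
      2 * lucasV P Q (n + 1) = P * lucasV P Q n + (P ^ 2 - 4 * Q) * lucasU P Q n := by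
  induction n using Nat.twoStepInduction with
  | zero => simp [lucasU, lucasV]; ring
  | one => simp [lucasU, lucasV]; constructor <;> ring
  | more n h1 h2 =>
    have hU : ∀ m, lucasU P Q (m + 2) = P * lucasU P Q (m + 1) - Q * lucasU P Q m := fun _ => rfl
    have hV : ∀ m, lucasV P Q (m + 2) = P * lucasV P Q (m + 1) - Q * lucasV P Q m := fun _ => rfl
    constructor
    · linear_combination 2 * hU (n + 1) + P * h2.1 - Q * h1.1 - P * hU n - hV n
    · linear_combination 2 * hV (n + 1) + P * h2.2 - Q * h1.2 - P * hV n -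
        (P ^ 2 - 4 * Q) * hU n

theorem lucasV_sq (P Q : ℤ) (n : ℕ) :
    lucasV P Q n ^ 2 - (P ^ 2 - 4 * Q) * lucasU P Q n ^ 2 = 4 * Q ^ n := by
  induction n with
  | zero => simp [lucasU, lucasV]
  | succ n ih =>
    obtain ⟨h1, h2⟩ := lucas_add_lucas P Q n
    refine mul_left_cancel₀ (four_ne_zero : (4 : ℤ) ≠ 0) ?_
    linear_combination 4 * Q * ih + (2 * lucasV P Q (n + 1) + (P * lucasV P Q n +
      (P ^ 2 - 4 * Q) * lucasU P Q n)) * h2 - (P ^ 2 - 4 * Q) * (2 * lucasU P Q (n + 1) +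
      (P * lucasU P Q n + lucasV P Q n)) * h1

theorem lucas_nondegenerate_cases {P Q : ℤ} (hP : 0 < P) (hQ : |Q| = 1)
    (hnd : (P, Q) ≠ (1, 1) ∧ (P, Q) ≠ (2, 1)) : (Q = -1 ∧ 1 ≤ P) ∨ (Q = 1 ∧ 3 ≤ P) := by
  rcases eq_or_eq_neg_of_abs_eq hQ with rfl | rfl
  · right
    refine ⟨rfl, ?_⟩
    by_contra! h
    have : P = 1 ∨ P = 2 := by omega
    rcases this with rfl | rfl
    · exact hnd.1 rfl
    · exact hnd.2 rfl
  · exact Or.inl ⟨rfl, hP⟩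

theorem lucasU_succ_pos {P Q : ℤ} (h : (Q = -1 ∧ 1 ≤ P) ∨ (Q = 1 ∧ 3 ≤ P)) (n : ℕ) :
    0 ≤ lucasU P Q n ∧ lucasU P Q n ≤ lucasU P Q (n + 1) ∧ 0 < lucasU P Q (n + 1) := by
  induction n with
  | zero => simp [lucasU]
  | succ n ih =>
    obtain ⟨h1, h2, h3⟩ := ih
    rw [lucasU]
    rcases h with ⟨rfl, hP⟩ | ⟨rfl, hP⟩
    · refine ⟨h3.le, ?_, ?_⟩ <;> nlinarith
    · refine ⟨h3.le, ?_, ?_⟩ <;> nlinarith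

theorem not_isSquare_lucas_discr {P Q : ℤ} (h : (Q = -1 ∧ 1 ≤ P) ∨ (Q = 1 ∧ 3 ≤ P)) :
    0 < P ^ 2 - 4 * Q ∧ ¬ IsSquare (P ^ 2 - 4 * Q) := by
  refine ⟨by rcases h with ⟨rfl, hP⟩ | ⟨rfl, hP⟩ <;> nlinarith, ?_⟩
  rintro ⟨r, hr⟩
  have hr' : |r| * |r| = P ^ 2 - 4 * Q := by rw [hr, abs_mul_abs_self]
  have h0 := abs_nonneg r
  generalize |r| = s at hr' h0
  rcases h with ⟨rfl, hP⟩ | ⟨rfl, hP⟩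
  · have h1 : P < s := by nlinarith
    have h2 : s < P + 2 := by nlinarith
    have h3 : s = P + 1 := by omega
    subst h3
    have : 2 * P = 3 := by linarith
    omega
  · have h1 : s < P := by nlinarith
    have h2 : P - 1 < s := by nlinarith
    omega

theorem exists_pell_pow_eq_lucasV {P Q g s : ℤ} (h : (Q = -1 ∧ 1 ≤ P) ∨ (Q = 1 ∧ 3 ≤ P))
    (hs : 0 ≤ s) (hD : P ^ 2 - 4 * Q = g * s ^ 2) :
    ∃ a : Pell.Solution₁ g, 1 < a.x ∧ 0 ≤ a.y ∧ ∀ n, lucasV P Q (6 * n) = 2 * (a ^ n).x := by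
  have hQ2 : Q ^ 2 = 1 := by rcases h with ⟨rfl, -⟩ | ⟨rfl, -⟩ <;> norm_num
  obtain ⟨R, hR⟩ : ∃ R, P * (P ^ 2 - 3 * Q) = 2 * R := by
    rcases Int.even_or_odd' P with ⟨c, rfl | rfl⟩
    · exact ⟨c * ((2 * c) ^ 2 - 3 * Q), by ring⟩
    · rcases h with ⟨rfl, -⟩ | ⟨rfl, -⟩
      · exact ⟨(2 * c + 1) * (2 * c ^ 2 + 2 * c + 2), by ring⟩
      · exact ⟨(2 * c + 1) * (2 * c ^ 2 + 2 * c - 1), by ring⟩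
  have hR2 : 2 ≤ R := by
    rcases h with ⟨rfl, hP⟩ | ⟨rfl, hP⟩
    · have : 4 ≤ P * (P ^ 2 - 3 * -1) := by nlinarith [sq_nonneg P]
      linarith
    · have : 6 ≤ P ^ 2 - 3 * 1 := by nlinarith
      nlinarith
  have hQ1 : Q ≤ 1 ∧ 0 ≤ P ^ 2 - Q := by
    rcases h with ⟨rfl, hP⟩ | ⟨rfl, hP⟩ <;> constructor <;> nlinarith
  have hQ3 : Q ^ 3 = Q := by rw [pow_succ, hQ2, one_mul]
  let a : Pell.Solution₁ g := .mk (2 * R ^ 2 - Q ^ 3) ((P ^ 2 - Q) * R * s) <| by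
    linear_combination (P ^ 2 - Q) ^ 2 * R ^ 2 * hD
      - R ^ 2 * (2 * R + P * (P ^ 2 - 3 * Q)) * hR + (Q ^ 4 + Q ^ 2 + 1) * hQ2
  have hax : a.x = 2 * R ^ 2 - Q ^ 3 := Pell.Solution₁.x_mk _ _ _
  have hay : a.y = (P ^ 2 - Q) * R * s := Pell.Solution₁.y_mk _ _ _
  refine ⟨a, ?_, ?_, ?_⟩
  · rw [hax, hQ3]; nlinarith
  · rw [hay]
    have := hQ1.2
    positivity
  · have hV6 : lucasV P Q 6 = 2 * a.x := by
      simp only [lucasV, hax]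
      linear_combination (2 * R + P * (P ^ 2 - 3 * Q)) * hR
    intro n
    induction n using Nat.twoStepInduction with
    | zero => simp [lucasV]
    | one => simpa using hV6
    | more n h1 h2 =>
      have hrec : ∀ m, lucasV P Q (m + 12) =
          lucasV P Q 6 * lucasV P Q (m + 6) - lucasV P Q m := by
        intro m
        simp only [lucasV]
        linear_combination -(Q ^ 4 + Q ^ 2 + 1) * lucasV P Q m * hQ2
      rw [show 6 * (n + 2) = 6 * n + 12 by ring, hrec, show 6 * n + 6 = 6 * (n + 1) by ring, h1, h2,
        hV6]
      have hp := a.prop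
      simp only [pow_succ, Pell.Solution₁.x_mul, Pell.Solution₁.y_mul]
      linear_combination (2 * (a ^ n).x) * hp

theorem lucasV_inter_infinite_of_isSquare {P₁ Q₁ P₂ Q₂ : ℤ}
    (h₁ : (Q₁ = -1 ∧ 1 ≤ P₁) ∨ (Q₁ = 1 ∧ 3 ≤ P₁)) (h₂ : (Q₂ = -1 ∧ 1 ≤ P₂) ∨ (Q₂ = 1 ∧ 3 ≤ P₂))
    (hsq : IsSquare ((P₁ ^ 2 - 4 * Q₁) * (P₂ ^ 2 - 4 * Q₂))) :
    ({x : ℤ | ∃ n : ℕ, x = lucasV P₁ Q₁ n} ∩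
        {x : ℤ | ∃ m : ℕ, x = lucasV P₂ Q₂ m}).Infinite := by
  obtain ⟨hD₁, hns⟩ := not_isSquare_lucas_discr h₁
  obtain ⟨hD₂, -⟩ := not_isSquare_lucas_discr h₂
  obtain ⟨g, s, r, hg, hs, hr, hgs, hgr⟩ : ∃ g s r : ℤ, 0 < g ∧ 0 ≤ s ∧ 0 ≤ r ∧
      P₁ ^ 2 - 4 * Q₁ = g * s ^ 2 ∧ P₂ ^ 2 - 4 * Q₂ = g * r ^ 2 := by
    generalize P₁ ^ 2 - 4 * Q₁ = D₁ at hsq hD₁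
    generalize P₂ ^ 2 - 4 * Q₂ = D₂ at hsq hD₂
    obtain ⟨c, hc⟩ := hsq
    have hg0 : 0 < Int.gcd D₁ D₂ := Int.gcd_pos_of_ne_zero_left _ hD₁.ne'
    obtain ⟨a, b, hab, ha, hb⟩ := Int.exists_gcd_one hg0
    generalize Int.gcd D₁ D₂ = G at ha hb hg0
    have hG : (0 : ℤ) < G := by exact_mod_cast hg0
    have ha0 : 0 < a := by
      rw [ha] at hD₁; exact pos_of_mul_pos_left hD₁ hG.le
    have hb0 : 0 < b := by
      rw [hb] at hD₂; exact pos_of_mul_pos_left hD₂ hG.le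
    obtain ⟨c', rfl⟩ : (G : ℤ) ∣ c := by
      rw [← Int.pow_dvd_pow_iff two_ne_zero]
      exact ⟨a * b, by rw [sq c, ← hc, ha, hb]; ring⟩
    have hab2 : a * b = c' ^ 2 := by
      refine mul_left_cancel₀ (pow_ne_zero 2 hG.ne') ?_
      rw [ha, hb] at hc
      linear_combination hc
    have key : ∀ a b : ℤ, 0 < a → Int.gcd a b = 1 → a * b = c' ^ 2 → ∃ s, 0 ≤ s ∧ a = s ^ 2 := by
      intro a b ha hab h
      obtain ⟨s, hs | hs⟩ := Int.sq_of_gcd_eq_one hab h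
      · exact ⟨|s|, abs_nonneg _, by rw [sq_abs, hs]⟩
      · nlinarith [sq_nonneg s]
    obtain ⟨s, hs, rfl⟩ := key a b ha0 hab hab2
    obtain ⟨r, hr, rfl⟩ := key b _ hb0 (by rwa [Int.gcd_comm]) (by rw [mul_comm]; exact hab2)
    exact ⟨G, s, r, hG, hs, hr, by rw [ha]; ring, by rw [hb]; ring⟩
  have hgns : ¬ IsSquare g := by
    rintro ⟨q, rfl⟩
    exact hns ⟨q * s, by rw [hgs]; ring⟩
  obtain ⟨η, hη⟩ := Pell.IsFundamental.exists_of_not_isSquare hg hgns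
  obtain ⟨a, hax, hay, ha⟩ := exists_pell_pow_eq_lucasV h₁ hs hgs
  obtain ⟨b, hbx, hby, hb⟩ := exists_pell_pow_eq_lucasV h₂ hr hgr
  obtain ⟨n, rfl⟩ := hη.eq_pow_of_nonneg (by linarith) hay
  obtain ⟨m, rfl⟩ := hη.eq_pow_of_nonneg (by linarith) hby
  have hn : n ≠ 0 := by rintro rfl; simp at hax
  have hm : m ≠ 0 := by rintro rfl; simp at hbx
  refine Set.infinite_of_injective_forall_mem (f := fun k : ℕ => 2 * (η ^ (n * m * k)).x) ?_ ?_
  · intro k l hkl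
    have hx : (η ^ (n * m * k)).x = (η ^ (n * m * l)).x := by simpa using hkl
    have hnonneg : ∀ i : ℕ, 0 ≤ (η ^ i).y := by
      intro i
      have := hη.y_strictMono.monotone (Int.natCast_nonneg i)
      simpa using this
    have hy : (η ^ (n * m * k)).y = (η ^ (n * m * l)).y := by
      refine (pow_left_inj₀ (hnonneg _) (hnonneg _) two_ne_zero).mp ?_
      refine mul_left_cancel₀ hg.ne' ?_
      rw [Pell.Solution₁.prop_y, Pell.Solution₁.prop_y, hx]
    have h := hη.y_strictMono.injective (a₁ := ((n * m * k : ℕ) : ℤ)) (a₂ := ((n * m * l : ℕ) : ℤ))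
      (by simpa only [zpow_natCast] using hy)
    have h' : n * m * k = n * m * l := by exact_mod_cast h
    exact Nat.eq_of_mul_eq_mul_left (by positivity) h'
  · intro k
    refine ⟨⟨6 * (m * k), ?_⟩, 6 * (n * k), ?_⟩
    · rw [ha, ← pow_mul]; congr 3; ring
    · rw [hb, ← pow_mul]; congr 3; ring

theorem isSquare_mul_of_mul_sq_eq {a b u v : ℤ} (hu : u ≠ 0) (h : a * u ^ 2 = b * v ^ 2) :
    IsSquare (a * b) := by
  obtain ⟨c, hc⟩ : u ∣ b * v := by
    rw [← Int.pow_dvd_pow_iff two_ne_zero]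
    exact ⟨a * b, by linear_combination -b * h⟩
  refine ⟨c, mul_right_cancel₀ (pow_ne_zero 2 hu) ?_⟩
  linear_combination b * h + (b * v + u * c) * hc

theorem finite_simultaneous_pell_int {D₁ D₂ : ℤ} (h₁ : 0 ≤ D₁) (h₂ : 0 ≤ D₂) :
    {x : ℤ | (∃ y, x ^ 2 - D₁ * y ^ 2 = 4) ∧ ∃ z, x ^ 2 - D₂ * z ^ 2 = -4}.Finite := by
  lift D₁ to ℕ using h₁
  lift D₂ to ℕ using h₂
  have hfin := finite_simultaneous_pell D₁ D₂
  refine ((hfin.image fun n : ℕ => (n : ℤ)).union (hfin.image fun n : ℕ => -(n : ℤ))).subset ?_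
  rintro x ⟨⟨y, hy⟩, z, hz⟩
  have hmem : x.natAbs ∈ {x : ℕ | (∃ y, x ^ 2 = D₁ * y ^ 2 + 4) ∧ ∃ z, x ^ 2 + 4 = D₂ * z ^ 2} := by
    refine ⟨⟨y.natAbs, ?_⟩, z.natAbs, ?_⟩
    · zify
      rw [sq_abs, sq_abs]
      linear_combination hy
    · zify
      rw [sq_abs, sq_abs]
      linear_combination hz
  rcases Int.natAbs_eq x with h | h
  · exact Or.inl ⟨_, hmem, h.symm⟩
  · exact Or.inr ⟨_, hmem, h.symm⟩

theorem lucasV_inter_finite_of_not_isSquare {P₁ Q₁ P₂ Q₂ : ℤ}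
    (h₁ : (Q₁ = -1 ∧ 1 ≤ P₁) ∨ (Q₁ = 1 ∧ 3 ≤ P₁)) (h₂ : (Q₂ = -1 ∧ 1 ≤ P₂) ∨ (Q₂ = 1 ∧ 3 ≤ P₂))
    (hsq : ¬ IsSquare ((P₁ ^ 2 - 4 * Q₁) * (P₂ ^ 2 - 4 * Q₂))) :
    ({x : ℤ | ∃ n : ℕ, x = lucasV P₁ Q₁ n} ∩
        {x : ℤ | ∃ m : ℕ, x = lucasV P₂ Q₂ m}).Finite := by
  have hD₁ := (not_isSquare_lucas_discr h₁).1.le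
  have hD₂ := (not_isSquare_lucas_discr h₂).1.le
  refine ((Set.finite_singleton (2 : ℤ)).union ((finite_simultaneous_pell_int hD₁ hD₂).union
    (finite_simultaneous_pell_int hD₂ hD₁))).subset ?_
  rintro x ⟨⟨n, hn⟩, m, hm⟩
  have e₁ := lucasV_sq P₁ Q₁ n
  have e₂ := lucasV_sq P₂ Q₂ m
  rw [← hn] at e₁
  rw [← hm] at e₂
  have hpow : ∀ {P Q : ℤ}, (Q = -1 ∧ 1 ≤ P) ∨ (Q = 1 ∧ 3 ≤ P) → ∀ n : ℕ,
      Q ^ n = 1 ∨ Q ^ n = -1 := by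
    rintro P Q (⟨rfl, -⟩ | ⟨rfl, -⟩) n
    · exact neg_one_pow_eq_or ℤ n
    · simp
  have hsame : Q₁ ^ n = Q₂ ^ m → x = 2 := by
    intro hQ
    rcases n with _ | n
    · exact hn
    · exfalso
      refine hsq (isSquare_mul_of_mul_sq_eq (lucasU_succ_pos h₁ n).2.2.ne'
        (v := lucasU P₂ Q₂ m) ?_)
      linear_combination e₂ - e₁ - 4 * hQ
  rcases hpow h₁ n with q₁ | q₁ <;> rcases hpow h₂ m with q₂ | q₂
  · exact Or.inl (hsame (q₁.trans q₂.symm))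
  · rw [q₁] at e₁
    rw [q₂] at e₂
    exact Or.inr (Or.inl ⟨⟨_, e₁⟩, _, e₂⟩)
  · rw [q₁] at e₁
    rw [q₂] at e₂
    exact Or.inr (Or.inr ⟨⟨_, e₂⟩, _, e₁⟩)
  · exact Or.inl (hsame (q₁.trans q₂.symm))

theorem VV_intersection_infinite_iff_square (P₁ Q₁ P₂ Q₂ : ℤ)
    (hP₁ : 0 < P₁) (hP₂ : 0 < P₂) (hQ₁ : |Q₁| = 1) (hQ₂ : |Q₂| = 1)
    (hne : (P₁, Q₁) ≠ (P₂, Q₂))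
    (hnd₁ : (P₁, Q₁) ≠ (1, 1) ∧ (P₁, Q₁) ≠ (2, 1))
    (hnd₂ : (P₂, Q₂) ≠ (1, 1) ∧ (P₂, Q₂) ≠ (2, 1)) :
    ({x : ℤ | ∃ n : ℕ, x = lucasV P₁ Q₁ n} ∩
        {x : ℤ | ∃ m : ℕ, x = lucasV P₂ Q₂ m}).Infinite ↔
      IsSquare ((P₁ ^ 2 - 4 * Q₁) * (P₂ ^ 2 - 4 * Q₂)) := by
  have h₁ := lucas_nondegenerate_cases hP₁ hQ₁ hnd₁
  have h₂ := lucas_nondegenerate_cases hP₂ hQ₂ hnd₂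
  refine ⟨fun hinf => ?_, lucasV_inter_infinite_of_isSquare h₁ h₂⟩
  by_contra hsq
  exact hinf (lucasV_inter_finite_of_not_isSquare h₁ h₂ hsq)
end

section
/- Let (P_1,Q_1) and (P_2,Q_2) be distinct pairs of integers with P_1 > 0, P_2 > 0, |Q_1| = |Q_2| = 1, (P_i,Q_i) not in {(1,1),(2,1)} for i = 1,2, and suppose the product (P_1^2 - 4*Q_1)*(P_2^2 - 4*Q_2) is a perfect square. Then there exist an integer P' > 0 and Q' ∈ {1,-1} such that {V_n(P_1,Q_1) : n >= 0} ∩ {V_m(P_2,Q_2) : m >= 0} = {V_k(P',Q') : k >= 0}. -/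
/-- `x` and `x'` are the roots of `X ^ 2 - P * X + Q`, where `Q = ±1` and `x > 1`. -/
structure IsUnitRoots (P Q : ℤ) (x x' : ℝ) : Prop where
  one_lt : 1 < x
  add_eq : x + x' = P
  mul_eq : x * x' = Q
  unit : Q = 1 ∨ Q = -1

theorem lucasV_eq_add_pow {P Q : ℤ} {x x' : ℝ} (hadd : x + x' = P) (hmul : x * x' = Q) (n : ℕ) :
    (lucasV P Q n : ℝ) = x ^ n + x' ^ n := by
  induction n using Nat.twoStepInduction with
  | zero => norm_num [lucasV]
  | one => simp [lucasV, hadd]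
  | more n ih₁ ih₂ =>
    rw [lucasV]
    push_cast
    rw [ih₁, ih₂, ← hadd, ← hmul]
    ring

theorem lucasV_pos_and_lt_succ {P Q : ℤ} (hP : 0 < P) (h : Q = -1 ∨ Q = 1 ∧ 3 ≤ P) (k : ℕ) :
    0 < lucasV P Q (k + 1) ∧ lucasV P Q (k + 1) < lucasV P Q (k + 2) := by
  induction k with
  | zero =>
    refine ⟨hP, ?_⟩
    simp only [lucasV]
    rcases h with rfl | ⟨rfl, h⟩ <;> nlinarith
  | succ k ih =>
    refine ⟨ih.1.trans ih.2, ?_⟩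
    rw [lucasV.eq_3 P Q (k + 1)]
    rcases h with rfl | ⟨rfl, h⟩ <;> nlinarith [ih.1, ih.2]

namespace IsUnitRoots

variable {P Q P₁ Q₁ P₂ Q₂ : ℤ} {x x' y y' : ℝ}

theorem pos_and_cases (h : IsUnitRoots P Q x x') : 0 < P ∧ (Q = -1 ∨ Q = 1 ∧ 3 ≤ P) := by
  obtain ⟨h1, ha, hm, rfl | rfl⟩ := h
  · have : (2 : ℝ) < P := by
      push_cast at hm
      nlinarith [mul_pos (sub_pos.2 h1) (sub_pos.2 h1)]
    have : 2 < P := by exact_mod_cast this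
    exact ⟨by omega, Or.inr ⟨rfl, by omega⟩⟩
  · have : (0 : ℝ) < P := by
      push_cast at hm
      nlinarith
    exact ⟨by exact_mod_cast this, Or.inl rfl⟩

theorem three_halves_lt (h : IsUnitRoots P Q x x') : 3 / 2 < x := by
  obtain ⟨hP, hc⟩ := h.pos_and_cases
  obtain ⟨h1, ha, hm, -⟩ := h
  by_contra! hx
  rcases hc with rfl | ⟨rfl, h3⟩
  · have : (1 : ℝ) ≤ P := by exact_mod_cast hP
    push_cast at hm
    nlinarith
  · have : (3 : ℝ) ≤ P := by exact_mod_cast h3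
    push_cast at hm
    nlinarith

theorem conj_unique (h₁ : IsUnitRoots P₁ Q₁ x x') (h₂ : IsUnitRoots P₂ Q₂ x y') : x' = y' := by
  have h32 := h₁.three_halves_lt
  obtain ⟨h1, ha, hm, hQ₁⟩ := h₁
  obtain ⟨-, hb, hn, hQ₂⟩ := h₂
  have key : x * ((P₁ - P₂ : ℤ) : ℝ) = ((Q₁ - Q₂ : ℤ) : ℝ) := by
    push_cast
    rw [← ha, ← hb, ← hm, ← hn]
    ring
  have hd : P₁ - P₂ = 0 ∨ 1 ≤ P₁ - P₂ ∨ P₁ - P₂ ≤ -1 := by omega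
  have hlt : ((P₁ - P₂ : ℤ) : ℝ) < 2 ∧ (-2 : ℝ) < ((P₁ - P₂ : ℤ) : ℝ) := by
    rcases hQ₁ with rfl | rfl <;> rcases hQ₂ with rfl | rfl <;> push_cast at key ⊢ <;>
      constructor <;> nlinarith
  have hlt1 : P₁ - P₂ < 2 := by exact_mod_cast hlt.1
  have hlt2 : -2 < P₁ - P₂ := by exact_mod_cast hlt.2
  have hx0 : x ≠ 0 := by positivity
  have hQ : x = 2 → x' = y' := by
    rintro rfl
    exfalso
    have e : (4 + Q₁ : ℝ) = 2 * P₁ := by linarith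
    have e' : 4 + Q₁ = 2 * P₁ := by exact_mod_cast e
    omega
  rcases hd with hd | hd | hd
  · rw [hd] at key
    have : (Q₁ : ℝ) = Q₂ := by push_cast at key; linarith
    exact mul_left_cancel₀ hx0 (by rw [hm, hn, this])
  · have hd : P₁ - P₂ = 1 := by omega
    rw [hd] at key
    apply hQ
    rcases hQ₁ with rfl | rfl <;> rcases hQ₂ with rfl | rfl <;> push_cast at key <;> linarith
  · have hd : P₁ - P₂ = -1 := by omega
    rw [hd] at key
    apply hQ
    rcases hQ₁ with rfl | rfl <;> rcases hQ₂ with rfl | rfl <;> push_cast at key <;> linarith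

/-- Commensurability of `x` and `y` makes their quotient `x / y = Q₂ * (x * y')` a root of the same
kind, commensurable with `y`. -/
theorem exists_quotient (h₁ : IsUnitRoots P₁ Q₁ x x') (h₂ : IsUnitRoots P₂ Q₂ y y') {s : ℤ}
    (hs : (x - x') * (y - y') = s) (hlt : y < x) :
    ∃ (P : ℤ) (w w' : ℝ) (s' : ℤ), IsUnitRoots P (Q₁ * Q₂) w w' ∧ w * y = x ∧ w' * y' = x' ∧
      (w - w') * (y - y') = s' := by
  obtain ⟨hx1, ha, hm, hQ₁⟩ := h₁
  obtain ⟨hy1, hb, hn, hQ₂⟩ := h₂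
  have hQ₂' : (Q₂ : ℝ) * Q₂ = 1 := by rcases hQ₂ with rfl | rfl <;> norm_num
  have hsq : (s : ℝ) ^ 2 = (P₁ ^ 2 - 4 * Q₁) * (P₂ ^ 2 - 4 * Q₂) := by
    rw [← hs, ← ha, ← hb, ← hm, ← hn]
    ring
  have hsq' : s ^ 2 = (P₁ ^ 2 - 4 * Q₁) * (P₂ ^ 2 - 4 * Q₂) := by exact_mod_cast hsq
  have hpar : Even (P₁ * P₂ - s) := by
    have h := congrArg Even hsq'
    have h4 (q : ℤ) : Even (4 * q) := ⟨2 * q, by ring⟩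
    simp only [Int.even_pow, Int.even_mul, Int.even_sub, h4, eq_iff_iff] at h ⊢
    simp only [ne_eq, OfNat.ofNat_ne_zero, not_false_eq_true, and_true, iff_true] at h
    tauto
  obtain ⟨m, hm2⟩ := hpar
  have hm2 : (P₁ * P₂ - s : ℝ) = m + m := by exact_mod_cast hm2
  have hwy : Q₂ * (x * y') * y = x := by
    linear_combination (Q₂ : ℝ) * x * hn + x * hQ₂'
  have hmr : x * y' + x' * y = m := by
    rw [← ha, ← hb, ← hs] at hm2
    linarith
  refine ⟨Q₂ * m, Q₂ * (x * y'), Q₂ * (x' * y), Q₂ * (2 * P₁ * Q₂ - m * P₂),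
    ⟨?_, ?_, ?_, ?_⟩, hwy, ?_, ?_⟩
  · by_contra! hle
    nlinarith
  · push_cast
    rw [← hmr]
    ring
  · push_cast
    linear_combination hQ₂' * (x * x' * (y * y')) + (y * y') * hm + Q₁ * hn
  · rcases hQ₁ with rfl | rfl <;> rcases hQ₂ with rfl | rfl <;> norm_num
  · linear_combination (Q₂ : ℝ) * x' * hn + x' * hQ₂'
  · push_cast
    rw [← hmr, ← ha, ← hb, ← hn]
    ring

theorem exists_common_root_of_mul_le (n : ℕ) :
    ∀ {P₁ Q₁ P₂ Q₂ : ℤ} {x x' y y' : ℝ} {s : ℤ}, IsUnitRoots P₁ Q₁ x x' →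
      IsUnitRoots P₂ Q₂ y y' → (x - x') * (y - y') = s → x * y ≤ (3 / 2) ^ n →
      ∃ (P Q : ℤ) (z z' : ℝ) (a b : ℕ), IsUnitRoots P Q z z' ∧ 0 < a ∧ 0 < b ∧
        x = z ^ a ∧ x' = z' ^ a ∧ y = z ^ b ∧ y' = z' ^ b := by
  induction n with
  | zero =>
    intro P₁ Q₁ P₂ Q₂ x x' y y' s h₁ h₂ hs hle
    nlinarith [h₁.one_lt, h₂.one_lt]
  | succ n ih =>
    intro P₁ Q₁ P₂ Q₂ x x' y y' s h₁ h₂ hs hle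
    have hx := h₁.three_halves_lt
    have hy := h₂.three_halves_lt
    rw [pow_succ] at hle
    rcases lt_trichotomy y x with hlt | rfl | hlt
    · obtain ⟨P, w, w', s', hw, hwy, hwy', hs'⟩ := h₁.exists_quotient h₂ hs hlt
      obtain ⟨P, Q, z, z', a, b, hz, ha, hb, rfl, rfl, rfl, rfl⟩ := ih hw h₂ hs' (by nlinarith)
      exact ⟨P, Q, z, z', a + b, b, hz, by omega, hb, by rw [← hwy, pow_add],
        by rw [← hwy', pow_add], rfl, rfl⟩
    · have := h₁.conj_unique h₂
      exact ⟨P₁, Q₁, y, x', 1, 1, h₁, one_pos, one_pos, by simp, by simp, by simp, by simp [this]⟩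
    · obtain ⟨P, w, w', s', hw, hwx, hwx', hs'⟩ :=
        h₂.exists_quotient h₁ ((mul_comm _ _).trans hs) hlt
      obtain ⟨P, Q, z, z', a, b, hz, ha, hb, rfl, rfl, rfl, rfl⟩ := ih hw h₁ hs' (by nlinarith)
      exact ⟨P, Q, z, z', b, a + b, hz, hb, by omega, rfl, rfl, by rw [← hwx, pow_add],
        by rw [← hwx', pow_add]⟩

theorem exists_common_root (h₁ : IsUnitRoots P₁ Q₁ x x') (h₂ : IsUnitRoots P₂ Q₂ y y') {s : ℤ}
    (hs : (x - x') * (y - y') = s) :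
    ∃ (P Q : ℤ) (z z' : ℝ) (a b : ℕ), IsUnitRoots P Q z z' ∧ 0 < a ∧ 0 < b ∧
      x = z ^ a ∧ x' = z' ^ a ∧ y = z ^ b ∧ y' = z' ^ b := by
  obtain ⟨n, hn⟩ := pow_unbounded_of_one_lt (x * y) (by norm_num : (1 : ℝ) < 3 / 2)
  exact exists_common_root_of_mul_le n h₁ h₂ hs hn.le

theorem lucasV_pos (h : IsUnitRoots P Q x x') {n : ℕ} (hn : 0 < n) : 0 < lucasV P Q n := by
  obtain ⟨k, rfl⟩ := Nat.exists_eq_succ_of_ne_zero hn.ne'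
  exact (lucasV_pos_and_lt_succ h.pos_and_cases.1 h.pos_and_cases.2 k).1

theorem lucasV_injOn (h : IsUnitRoots P Q x x') : Set.InjOn (lucasV P Q) (Set.Ioi 0) := by
  have hmono : StrictMono fun k => lucasV P Q (k + 1) :=
    strictMono_nat_of_lt_succ fun k =>
      (lucasV_pos_and_lt_succ h.pos_and_cases.1 h.pos_and_cases.2 k).2
  intro i hi j hj hij
  obtain ⟨i, rfl⟩ := Nat.exists_eq_succ_of_ne_zero (Set.mem_Ioi.1 hi).ne'
  obtain ⟨j, rfl⟩ := Nat.exists_eq_succ_of_ne_zero (Set.mem_Ioi.1 hj).ne'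
  exact congrArg Nat.succ (hmono.injective hij)

theorem of_nondegenerate (hP : 0 < P) (hQ : |Q| = 1) (hnd : (P, Q) ≠ (1, 1) ∧ (P, Q) ≠ (2, 1)) :
    IsUnitRoots P Q ((P + √((P ^ 2 - 4 * Q : ℤ) : ℝ)) / 2)
      ((P - √((P ^ 2 - 4 * Q : ℤ) : ℝ)) / 2) := by
  have hQ : Q = 1 ∨ Q = -1 := eq_or_eq_neg_of_abs_eq hQ
  have hD : 5 ≤ P ^ 2 - 4 * Q := by
    rcases hQ with rfl | rfl
    · have : 3 ≤ P := by
        by_contra! hlt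
        interval_cases P <;> simp at hnd
      nlinarith
    · nlinarith
  have hD : (5 : ℝ) ≤ ((P ^ 2 - 4 * Q : ℤ) : ℝ) := by exact_mod_cast hD
  have hP : (1 : ℝ) ≤ P := by exact_mod_cast hP
  have h1 : 1 < √((P ^ 2 - 4 * Q : ℤ) : ℝ) := Real.lt_sqrt_of_sq_lt (by linarith)
  have hsq := Real.mul_self_sqrt (by linarith : (0 : ℝ) ≤ ((P ^ 2 - 4 * Q : ℤ) : ℝ))
  refine ⟨by linarith, by ring, ?_, hQ⟩
  rw [show (Q : ℝ) = (P ^ 2 - ((P ^ 2 - 4 * Q : ℤ) : ℝ)) / 4 by push_cast; ring]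
  linear_combination -hsq / 4

end IsUnitRoots


theorem VV_intersection_is_lucas (P₁ Q₁ P₂ Q₂ : ℤ)
    (hP₁ : 0 < P₁) (hP₂ : 0 < P₂) (hQ₁ : |Q₁| = 1) (hQ₂ : |Q₂| = 1)
    (hne : (P₁, Q₁) ≠ (P₂, Q₂))
    (hnd₁ : (P₁, Q₁) ≠ (1, 1) ∧ (P₁, Q₁) ≠ (2, 1))
    (hnd₂ : (P₂, Q₂) ≠ (1, 1) ∧ (P₂, Q₂) ≠ (2, 1))
    (hsq : IsSquare ((P₁ ^ 2 - 4 * Q₁) * (P₂ ^ 2 - 4 * Q₂))) :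
    ∃ P' Q' : ℤ, 0 < P' ∧ (Q' = 1 ∨ Q' = -1) ∧
      {x : ℤ | ∃ n : ℕ, x = lucasV P₁ Q₁ n} ∩ {x : ℤ | ∃ m : ℕ, x = lucasV P₂ Q₂ m} =
        {x : ℤ | ∃ k : ℕ, x = lucasV P' Q' k} := by
  obtain ⟨s, hs⟩ := hsq
  have h₁ := IsUnitRoots.of_nondegenerate hP₁ hQ₁ hnd₁
  have h₂ := IsUnitRoots.of_nondegenerate hP₂ hQ₂ hnd₂
  obtain ⟨P, Q, z, z', a, b, hz, ha, hb, hx, hx', hy, hy'⟩ :=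
    h₁.exists_common_root h₂ (s := |s|) <| by
      have hD : 0 ≤ P₂ ^ 2 - 4 * Q₂ := by
        rcases h₂.pos_and_cases with ⟨-, h | ⟨h, h3⟩⟩ <;> rw [h] <;> nlinarith
      rw [Int.cast_abs, ← Real.sqrt_mul_self_eq_abs, ← Int.cast_mul, ← hs, Int.cast_mul,
        Real.sqrt_mul' _ (by exact_mod_cast hD)]
      ring
  have lucasV_eq {R S : ℤ} {k : ℕ} (hadd : z ^ k + z' ^ k = R) (hmul : z ^ k * z' ^ k = S)
      (n : ℕ) : lucasV R S n = lucasV P Q (k * n) := by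
    have : (lucasV R S n : ℝ) = lucasV P Q (k * n) := by
      rw [lucasV_eq_add_pow hadd hmul, lucasV_eq_add_pow hz.add_eq hz.mul_eq, pow_mul, pow_mul]
    exact_mod_cast this
  have hV₁ := lucasV_eq (hx ▸ hx' ▸ h₁.add_eq) (hx ▸ hx' ▸ h₁.mul_eq)
  have hV₂ := lucasV_eq (hy ▸ hy' ▸ h₂.add_eq) (hy ▸ hy' ▸ h₂.mul_eq)
  have hV := lucasV_eq (k := a.lcm b) (lucasV_eq_add_pow hz.add_eq hz.mul_eq _).symm
    (S := Q ^ a.lcm b) (by rw [← mul_pow, hz.mul_eq]; push_cast; rfl)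
  refine ⟨lucasV P Q (a.lcm b), Q ^ a.lcm b, hz.lucasV_pos (Nat.lcm_pos ha hb), ?_, ?_⟩
  · rcases hz.unit with h | h
    · simp [h]
    · rw [h]
      exact neg_one_pow_eq_or ℤ _
  ext v
  simp only [Set.mem_inter_iff, Set.mem_ofPred_eq, hV₁, hV₂, hV]
  constructor
  · rintro ⟨⟨n, hn⟩, m, hm⟩
    rcases Nat.eq_zero_or_pos (a * n) with h0 | hn0
    · exact ⟨0, by rw [hn, h0, mul_zero]⟩
    rcases Nat.eq_zero_or_pos (b * m) with h0 | hm0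
    · exact ⟨0, by rw [hm, h0, mul_zero]⟩
    have heq : a * n = b * m := hz.lucasV_injOn hn0 hm0 (hn.symm.trans hm)
    obtain ⟨k, hk⟩ := Nat.lcm_dvd (Dvd.intro n rfl) (heq ▸ Dvd.intro m rfl : b ∣ a * n)
    exact ⟨k, by rw [hn, hk]⟩
  · rintro ⟨k, rfl⟩
    obtain ⟨c, hc⟩ := Nat.dvd_lcm_left a b
    obtain ⟨d, hd⟩ := Nat.dvd_lcm_right a b
    exact ⟨⟨c * k, by rw [← mul_assoc, ← hc]⟩, d * k, by rw [← mul_assoc, ← hd]⟩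
end

section
/- The only numbers that are both Fibonacci numbers and Pell numbers are 0, 1, 2, and 5; that is, {U_n(1,-1) : n >= 0} ∩ {U_m(2,-1) : m >= 0} = {0, 1, 2, 5}. -/
/-! ### Powers of norm-one elements of `ℤ√d` -/

/-- A quadratic residue obstruction: a positive `w` cannot divide `y ^ 2 - c` when the Jacobi
symbol `(c | w)`, computed from `w` modulo `4 * |c|`, is `-1`. -/
theorem not_dvd_sq_sub_of_jacobiSym {c w y : ℤ} (r : ℕ) (hw : 0 < w)
    (hmod : w % (4 * c.natAbs : ℕ) = r) (hr : Odd r) (hj : jacobiSym c r = -1) :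
    ¬ w ∣ y ^ 2 - c := by
  lift w to ℕ using hw.le
  norm_cast at hmod
  have hodd : Odd w := by
    have h := Nat.div_add_mod w (4 * c.natAbs)
    rw [← h, hmod]
    exact Even.add_odd ((Even.mul_right (by decide) _).mul_right _) hr
  intro hdvd
  have h1 : jacobiSym c w = -1 := by rw [jacobiSym.mod_right c hodd, hmod, hj]
  have h2 : jacobiSym (y ^ 2) w = jacobiSym c w :=
    jacobiSym.mod_left' (Int.ModEq.symm (Int.modEq_iff_dvd.mpr hdvd))
  rw [jacobiSym.pow_left, h1] at h2
  nlinarith [sq_nonneg (jacobiSym y w)]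

theorem Zsqrtd.re_sq_sub_im_sq_pow {d : ℤ} {z : ℤ√d} (hz : z.norm = 1) (k : ℕ) :
    (z ^ k).re ^ 2 - d * (z ^ k).im ^ 2 = 1 := by
  have h : (z ^ k).norm = 1 := by
    have := map_pow (Zsqrtd.normMonoidHom (d := d)) z k
    simpa [Zsqrtd.normMonoidHom, hz] using this
  rw [Zsqrtd.norm_def] at h
  linarith

theorem Zsqrtd.re_pow_two_mul {d : ℤ} {z : ℤ√d} (hz : z.norm = 1) (k : ℕ) :
    (z ^ (k * 2)).re = 2 * (z ^ k).re ^ 2 - 1 := by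
  have h := Zsqrtd.re_sq_sub_im_sq_pow hz k
  rw [pow_mul, sq, Zsqrtd.re_mul]
  linarith

theorem Zsqrtd.re_dvd_re_pow {d : ℤ} (z : ℤ√d) {r : ℕ} (hr : Odd r) : z.re ∣ (z ^ r).re := by
  obtain ⟨s, rfl⟩ := hr
  induction s with
  | zero => simp
  | succ s ih =>
    rw [show 2 * (s + 1) + 1 = (2 * s + 1) + 2 by ring, pow_add, sq, Zsqrtd.re_mul,
      Zsqrtd.im_mul]
    exact dvd_add (ih.mul_right _) ⟨d * (z ^ (2 * s + 1)).im * (2 * z.im), by ring⟩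

/-- The residue modulo `M` of `re (z ^ (g * 2 ^ t))` is computed by iterating `x ↦ 2 * x ^ 2 - 1`. -/
theorem Zsqrtd.re_pow_two_pow_emod {d : ℤ} {z : ℤ√d} (hz : z.norm = 1) (g t : ℕ) (M : ℤ) :
    (z ^ (g * 2 ^ t)).re % M = (fun x : ℤ => (2 * x ^ 2 - 1) % M)^[t] ((z ^ g).re % M) := by
  induction t with
  | zero => simp
  | succ t ih =>
    rw [pow_succ, ← mul_assoc, Zsqrtd.re_pow_two_mul hz, Function.iterate_succ_apply', ← ih]
    simp [Int.sub_emod, Int.mul_emod, pow_two]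

theorem Zsqrtd.re_pow_two_pow_emod_mod {d : ℤ} {z : ℤ√d} (hz : z.norm = 1) (g : ℕ) {P : ℕ} {M : ℤ}
    (hP : (fun x : ℤ => (2 * x ^ 2 - 1) % M)^[P] ((2 * ((z ^ g).re % M) ^ 2 - 1) % M) =
      (2 * ((z ^ g).re % M) ^ 2 - 1) % M) (t : ℕ) :
    (z ^ (g * 2 ^ (t + 1))).re % M =
      (fun x : ℤ => (2 * x ^ 2 - 1) % M)^[t % P] ((2 * ((z ^ g).re % M) ^ 2 - 1) % M) := by
  rw [Zsqrtd.re_pow_two_pow_emod hz, Function.iterate_succ_apply]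
  exact (Function.IsPeriodicPt.iterate_mod_apply hP t).symm

theorem Zsqrtd.re_pow_pos {d : ℤ} {z : ℤ√d} (hd : 0 ≤ d)
    (hre : 0 < z.re) (him : 0 ≤ z.im) (k : ℕ) : 0 < (z ^ k).re ∧ 0 ≤ (z ^ k).im := by
  induction k with
  | zero => simp
  | succ k ih =>
    rw [pow_succ, Zsqrtd.re_mul, Zsqrtd.im_mul]
    obtain ⟨h1, h2⟩ := ih
    constructor <;> positivity

/-! ### The Pell equations `2 * L ^ 2 - 5 * q ^ 2 = N` -/

theorem exists_eq_mul_pow_of_two_mul_sq_sub {N L₀ q₀ : ℤ} (hN : |N| ≤ 13)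
    (hbase : ∀ L q : ℤ, 0 ≤ L → 0 ≤ q → q ≤ 30 → 2 * L ^ 2 - 5 * q ^ 2 = N →
      ∃ (L₁ q₁ : ℤ) (k : ℕ), L₁ ^ 2 = L₀ ^ 2 ∧ q₁ ^ 2 = q₀ ^ 2 ∧
        (⟨2 * L, q⟩ : ℤ√10) = ⟨2 * L₁, q₁⟩ * ⟨19, 6⟩ ^ k)
    (n : ℕ) (L q : ℤ) (hL : 0 ≤ L) (hq : 0 ≤ q) (hn : q ≤ n) (h : 2 * L ^ 2 - 5 * q ^ 2 = N) :
    ∃ (L₁ q₁ : ℤ) (k : ℕ), L₁ ^ 2 = L₀ ^ 2 ∧ q₁ ^ 2 = q₀ ^ 2 ∧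
      (⟨2 * L, q⟩ : ℤ√10) = ⟨2 * L₁, q₁⟩ * ⟨19, 6⟩ ^ k := by
  obtain ⟨hN1, hN2⟩ := abs_le.mp hN
  induction n generalizing L q with
  | zero => exact hbase L q hL hq (by push_cast at hn; linarith) h
  | succ n ih =>
    rcases le_or_gt q 30 with hq30 | hq30
    · exact hbase L q hL hq hq30 h
    · have hqq : 31 * 31 ≤ q * q := by nlinarith
      have h1 : 0 ≤ 19 * L - 30 * q := by
        by_contra! hlt
        nlinarith
      have h2 : 0 ≤ 19 * q - 12 * L := by
        by_contra! hlt
        nlinarith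
      have h3 : 3 * q < 2 * L := by
        by_contra! hlt
        nlinarith
      obtain ⟨L₁, q₁, k, hL₁, hq₁, hz⟩ := ih (19 * L - 30 * q) (19 * q - 12 * L) h1 h2
        (by push_cast at hn; linarith) (by linear_combination h)
      refine ⟨L₁, q₁, k + 1, hL₁, hq₁, ?_⟩
      rw [pow_succ, ← mul_assoc, ← hz]
      ext
      · rw [Zsqrtd.re_mul]; ring
      · rw [Zsqrtd.im_mul]; ring

/-- If all the Jacobi symbols `(-10 * (2 * L₀ ^ 2 + 5 * d) | re ((19 + 6√10) ^ (2 ^ t)))` are `-1`,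
then the class of `(L₀, q₀)` contains no further solution with `(q ^ 2 - d) / 2` a square. -/
theorem sq_eq_of_two_mul_sq_sub {N L₀ q₀ d : ℤ} (hN : |N| ≤ 13)
    (hbase : ∀ L q : ℤ, 0 ≤ L → 0 ≤ q → q ≤ 30 → 2 * L ^ 2 - 5 * q ^ 2 = N →
      ∃ (L₁ q₁ : ℤ) (k : ℕ), L₁ ^ 2 = L₀ ^ 2 ∧ q₁ ^ 2 = q₀ ^ 2 ∧
        (⟨2 * L, q⟩ : ℤ√10) = ⟨2 * L₁, q₁⟩ * ⟨19, 6⟩ ^ k)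
    (hjac : ∀ (t : ℕ) (y : ℤ), ¬ ((⟨19, 6⟩ : ℤ√10) ^ 2 ^ t).re ∣
      y ^ 2 - -10 * (2 * L₀ ^ 2 + 5 * d))
    {L q x : ℤ} (h : 2 * L ^ 2 - 5 * q ^ 2 = N) (hx : q ^ 2 = 2 * x ^ 2 + d) :
    q ^ 2 = q₀ ^ 2 := by
  obtain ⟨L₁, q₁, k, hL₁, hq₁, hz⟩ := exists_eq_mul_pow_of_two_mul_sq_sub hN hbase q.natAbs
    |L| |q| (abs_nonneg _) (abs_nonneg _) (by simp) (by simpa using h)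
  rcases Nat.eq_zero_or_pos k with rfl | hk
  · have := congrArg Zsqrtd.im hz
    simp only [pow_zero, mul_one] at this
    rw [← hq₁, ← this, sq_abs]
  · exfalso
    obtain ⟨t, r, hr, rfl⟩ := Nat.exists_eq_two_pow_mul_odd hk.ne'
    have hnorm : (⟨19, 6⟩ : ℤ√10).norm = 1 := by rw [Zsqrtd.norm_def]; norm_num
    have hw : ((⟨19, 6⟩ : ℤ√10) ^ 2 ^ t).re ∣ ((⟨19, 6⟩ : ℤ√10) ^ (2 ^ t * r)).re := by
      rw [pow_mul]; exact Zsqrtd.re_dvd_re_pow _ hr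
    have hab := Zsqrtd.re_sq_sub_im_sq_pow hnorm (2 ^ t * r)
    have him := congrArg Zsqrtd.im hz
    rw [Zsqrtd.im_mul] at him
    dsimp only at him
    set a := ((⟨19, 6⟩ : ℤ√10) ^ (2 ^ t * r)).re
    set b := ((⟨19, 6⟩ : ℤ√10) ^ (2 ^ t * r)).im
    refine hjac t (10 * x) (hw.trans ?_)
    have hq : q ^ 2 = (2 * L₁ * b + q₁ * a) ^ 2 := by rw [← him, sq_abs]
    refine ⟨50 * (4 * L₁ * b * q₁ + q₁ ^ 2 * a) + 20 * L₁ ^ 2 * a, ?_⟩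
    linear_combination -50 * hx + 50 * hq - 20 * L₁ ^ 2 * hab - 20 * hL₁

theorem not_re_dvd_sq_add {c : ℤ} (r : ℕ)
    (h19 : (19 : ℤ) % (4 * c.natAbs : ℕ) = 19) (hj19 : jacobiSym c 19 = -1)
    (h0 : (2 * 19 ^ 2 - 1) % ((4 * c.natAbs : ℕ) : ℤ) = r)
    (h1 : (2 * (r : ℤ) ^ 2 - 1) % ((4 * c.natAbs : ℕ) : ℤ) = r) (hr : Odd r)
    (hj : jacobiSym c r = -1) (t : ℕ) (y : ℤ) :
    ¬ ((⟨19, 6⟩ : ℤ√10) ^ 2 ^ t).re ∣ y ^ 2 - c := by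
  have hnorm : (⟨19, 6⟩ : ℤ√10).norm = 1 := by rw [Zsqrtd.norm_def]; norm_num
  have hpos := (Zsqrtd.re_pow_pos (z := (⟨19, 6⟩ : ℤ√10)) (by norm_num) (by norm_num)
    (by norm_num) (2 ^ t)).1
  cases t with
  | zero =>
    exact not_dvd_sq_sub_of_jacobiSym 19 hpos (by simpa using h19) (by decide) hj19
  | succ t =>
    refine not_dvd_sq_sub_of_jacobiSym r hpos ?_ hr hj
    have h := Zsqrtd.re_pow_two_pow_emod_mod hnorm 1 (P := 1) (M := (4 * c.natAbs : ℕ))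
      (by rw [pow_one, h19, h0]; exact h1) t
    rwa [pow_one, h19, h0, Nat.mod_one, one_mul] at h

/-! ### Numbers in both sequences, according to the parities of the indices -/

theorem exists_base_of_le (N L₀ q₀ : ℤ) (hN : N ≤ 13)
    (hfin : ∀ q ∈ Finset.Icc (0 : ℤ) 30, ∀ L ∈ Finset.Icc (0 : ℤ) 48, 2 * L ^ 2 - 5 * q ^ 2 = N →
      (L = L₀ ∧ q = q₀) ∨ ∃ s ∈ ({1, -1} : Finset ℤ), ∃ s' ∈ ({1, -1} : Finset ℤ),
        L = 19 * s * L₀ + 30 * s' * q₀ ∧ q = 12 * s * L₀ + 19 * s' * q₀)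
    (L q : ℤ) (hL : 0 ≤ L) (hq : 0 ≤ q) (hq' : q ≤ 30) (h : 2 * L ^ 2 - 5 * q ^ 2 = N) :
    ∃ (L₁ q₁ : ℤ) (k : ℕ), L₁ ^ 2 = L₀ ^ 2 ∧ q₁ ^ 2 = q₀ ^ 2 ∧
      (⟨2 * L, q⟩ : ℤ√10) = ⟨2 * L₁, q₁⟩ * ⟨19, 6⟩ ^ k := by
  have hL' : L ≤ 48 := by nlinarith
  rcases hfin q (by simp [hq, hq']) L (by simp [hL, hL']) h with
    ⟨rfl, rfl⟩ | ⟨s, hs, s', hs', rfl, rfl⟩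
  · exact ⟨L, q, 0, rfl, rfl, by simp⟩
  · refine ⟨s * L₀, s' * q₀, 1, ?_, ?_, ?_⟩
    · rcases Finset.mem_insert.mp hs with rfl | hs
      · ring
      · rw [Finset.mem_singleton.mp hs]; ring
    · rcases Finset.mem_insert.mp hs' with rfl | hs'
      · ring
      · rw [Finset.mem_singleton.mp hs']; ring
    · ext
      · rw [pow_one, Zsqrtd.re_mul]; ring
      · rw [pow_one, Zsqrtd.im_mul]; ring

theorem sq_eq_zero_of_even_even {x L q : ℤ} (hL : L ^ 2 = 5 * x ^ 2 + 4)
    (hq : q ^ 2 = 2 * x ^ 2 + 1) : x ^ 2 = 0 := by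
  have h : q ^ 2 = 1 ^ 2 := sq_eq_of_two_mul_sq_sub (N := 3) (L₀ := 2) (d := 1) (by norm_num)
    (exists_base_of_le 3 2 1 (by norm_num) (by decide +kernel))
    (not_re_dvd_sq_add 201 (by norm_num) (by norm_num) (by norm_num) (by norm_num) (by decide)
      (by norm_num)) (L := L) (x := x) (by linarith) hq
  linarith

theorem sq_eq_one_of_even_odd {x L q : ℤ} (hL : L ^ 2 = 5 * x ^ 2 + 4)
    (hq : q ^ 2 = 2 * x ^ 2 - 1) : x ^ 2 = 1 := by
  have h : q ^ 2 = 1 ^ 2 := sq_eq_of_two_mul_sq_sub (N := 13) (L₀ := 3) (d := -1) (by norm_num)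
    (exists_base_of_le 13 3 1 (by norm_num) (by decide +kernel))
    (not_re_dvd_sq_add 201 (by norm_num) (by norm_num) (by norm_num) (by norm_num) (by decide)
      (by norm_num)) (L := L) (x := x) (by linarith) (by linarith)
  linarith

theorem sq_eq_four_of_odd_even {x L q : ℤ} (hL : L ^ 2 = 5 * x ^ 2 - 4)
    (hq : q ^ 2 = 2 * x ^ 2 + 1) : x ^ 2 = 4 := by
  have h : q ^ 2 = 3 ^ 2 := sq_eq_of_two_mul_sq_sub (N := -13) (L₀ := 4) (d := 1) (by norm_num)
    (exists_base_of_le (-13) 4 3 (by norm_num) (by decide +kernel))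
    (not_re_dvd_sq_add 721 (by norm_num) (by norm_num) (by norm_num) (by norm_num) (by decide)
      (by norm_num)) (L := L) (x := x) (by linarith) hq
  linarith

/-- One step of `z ↦ z * (3 + 2√2)` on coordinates modulo `82181 = 11 * 31 * 241`. -/
def pellStep (v : ℤ × ℤ) : ℤ × ℤ :=
  ((3 * v.1 + 4 * v.2) % 82181, (2 * v.1 + 3 * v.2) % 82181)

theorem pellStep_iterate (k : ℕ) :
    pellStep^[k] (1, 1) = (((⟨1, 1⟩ : ℤ√2) * ⟨3, 2⟩ ^ k).re % 82181,
      ((⟨1, 1⟩ : ℤ√2) * ⟨3, 2⟩ ^ k).im % 82181) := by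
  induction k with
  | zero => simp
  | succ k ih =>
    rw [Function.iterate_succ_apply', ih, pow_succ, ← mul_assoc]
    generalize (⟨1, 1⟩ * ⟨3, 2⟩ ^ k : ℤ√2) = w
    simp only [pellStep, Prod.mk.injEq, Zsqrtd.re_mul, Zsqrtd.im_mul]
    constructor <;> omega

theorem pellStep_iterate_mod (k : ℕ) : pellStep^[k % 120] (1, 1) = pellStep^[k] (1, 1) :=
  Function.IsPeriodicPt.iterate_mod_apply (by decide +kernel : pellStep^[120] (1, 1) = (1, 1)) k

theorem euler_of_sq_modEq {p : ℕ} [Fact p.Prime] {L c : ℤ}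
    (h : L ^ 2 ≡ c [ZMOD p]) : c % p = 0 ∨ c ^ (p / 2) % p = 1 := by
  have hc : (c : ZMod p) = (L : ZMod p) ^ 2 := by
    have := (ZMod.intCast_eq_intCast_iff _ _ _).mpr h
    push_cast at this
    exact this.symm
  rcases eq_or_ne (c : ZMod p) 0 with h0 | h0
  · exact Or.inl (Int.emod_eq_zero_of_dvd ((ZMod.intCast_zmod_eq_zero_iff_dvd c p).mp h0))
  · right
    have h1 := (ZMod.euler_criterion p h0).mp ⟨L, by rw [hc, sq]⟩
    have h2 : c ^ (p / 2) ≡ 1 [ZMOD p] := by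
      rw [← ZMod.intCast_eq_intCast_iff]
      push_cast
      exact h1
    rw [h2, Int.emod_eq_of_lt one_pos.le (by exact_mod_cast (Fact.out : p.Prime).one_lt)]

theorem pellStep_sieve : ∀ r < 120, (∀ p ∈ [11, 31, 241],
      (5 * (pellStep^[r] (1, 1)).2 ^ 2 - 4) % (p : ℕ) = 0 ∨
      (5 * (pellStep^[r] (1, 1)).2 ^ 2 - 4) ^ (p / 2) % (p : ℕ) = 1) →
    r % 30 = 0 ∨ r % 30 = 1 ∨ r % 30 = 28 ∨ r % 30 = 29 := by
  decide +kernel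

theorem mod_thirty_of_sq {L : ℤ} {k : ℕ}
    (hL : L ^ 2 = 5 * ((⟨1, 1⟩ : ℤ√2) * ⟨3, 2⟩ ^ k).im ^ 2 - 4) :
    k % 30 = 0 ∨ k % 30 = 1 ∨ k % 30 = 28 ∨ k % 30 = 29 := by
  have h := pellStep_sieve (k % 120) (Nat.mod_lt _ (by norm_num))
  rw [pellStep_iterate_mod, pellStep_iterate, Nat.mod_mod_of_dvd k (by norm_num : 30 ∣ 120)] at h
  refine h fun p hp => ?_
  have hdvd : (p : ℤ) ∣ 82181 ∧ p.Prime := by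
    simp only [List.mem_cons, List.not_mem_nil, or_false] at hp
    rcases hp with rfl | rfl | rfl <;> norm_num
  have : Fact p.Prime := ⟨hdvd.2⟩
  refine euler_of_sq_modEq (L := L) ?_
  rw [hL]
  exact (((Int.mod_modEq _ _).symm.of_dvd hdvd.1).pow 2).mul_left 5 |>.sub_right 4

theorem exists_not_re_dvd_sq_add_26 (t : ℕ) : ∃ g ∈ [1, 3, 5, 15], ∀ y : ℤ,
    ¬ ((⟨3, 2⟩ : ℤ√2) ^ (g * 2 ^ (t + 1))).re ∣ y ^ 2 - -26 := by
  have hnorm : (⟨3, 2⟩ : ℤ√2).norm = 1 := by rw [Zsqrtd.norm_def]; norm_num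
  have hpos (k : ℕ) := (Zsqrtd.re_pow_pos (z := (⟨3, 2⟩ : ℤ√2)) (by norm_num) (by norm_num)
    (by norm_num) k).1
  have hmod (g : ℕ) := Zsqrtd.re_pow_two_pow_emod_mod hnorm g (P := 3) (M := 104) (t := t)
  have ht : t % 3 = 0 ∨ t % 3 = 1 ∨ t % 3 = 2 := by omega
  rcases ht with ht | ht | ht <;> simp only [ht] at hmod
  · exact ⟨5, by simp, fun y => not_dvd_sq_sub_of_jacobiSym 57 (hpos _) (hmod 5 (by decide +kernel))
      (by decide) (by norm_num)⟩
  · exact ⟨1, by simp, fun y => not_dvd_sq_sub_of_jacobiSym 57 (hpos _) (hmod 1 (by decide +kernel))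
      (by decide) (by norm_num)⟩
  · exact ⟨3, by simp, fun y => not_dvd_sq_sub_of_jacobiSym 57 (hpos _) (hmod 3 (by decide +kernel))
      (by decide) (by norm_num)⟩

theorem exists_not_re_dvd_sq_add_506 (t : ℕ) : ∃ g ∈ [1, 3, 5, 15], ∀ y : ℤ,
    ¬ ((⟨3, 2⟩ : ℤ√2) ^ (g * 2 ^ (t + 1))).re ∣ y ^ 2 - -506 := by
  have hnorm : (⟨3, 2⟩ : ℤ√2).norm = 1 := by rw [Zsqrtd.norm_def]; norm_num
  have hpos (k : ℕ) := (Zsqrtd.re_pow_pos (z := (⟨3, 2⟩ : ℤ√2)) (by norm_num) (by norm_num)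
    (by norm_num) k).1
  rcases t with - | t
  · exact ⟨5, by simp, fun y => not_dvd_sq_sub_of_jacobiSym 1337 (hpos _)
      (by decide +kernel) (by decide) (by norm_num)⟩
  have hmod (g : ℕ) := Zsqrtd.re_pow_two_pow_emod_mod hnorm (g * 2) (P := 5) (M := 2024) (t := t)
  simp only [mul_assoc _ 2, ← pow_succ'] at hmod
  have ht : t % 5 = 0 ∨ t % 5 = 1 ∨ t % 5 = 2 ∨ t % 5 = 3 ∨ t % 5 = 4 := by omega
  rcases ht with ht | ht | ht | ht | ht <;> simp only [ht] at hmod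
  · exact ⟨15, by simp, fun y => not_dvd_sq_sub_of_jacobiSym 1937 (hpos _)
      ((hmod 15 (by decide +kernel)).trans (by decide +kernel)) (by decide) (by norm_num)⟩
  · exact ⟨1, by simp, fun y => not_dvd_sq_sub_of_jacobiSym 1985 (hpos _)
      ((hmod 1 (by decide +kernel)).trans (by decide +kernel)) (by decide) (by norm_num)⟩
  · exact ⟨1, by simp, fun y => not_dvd_sq_sub_of_jacobiSym 1017 (hpos _)
      ((hmod 1 (by decide +kernel)).trans (by decide +kernel)) (by decide) (by norm_num)⟩
  · exact ⟨5, by simp, fun y => not_dvd_sq_sub_of_jacobiSym 1017 (hpos _)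
      ((hmod 5 (by decide +kernel)).trans (by decide +kernel)) (by decide) (by norm_num)⟩
  · exact ⟨3, by simp, fun y => not_dvd_sq_sub_of_jacobiSym 1937 (hpos _)
      ((hmod 3 (by decide +kernel)).trans (by decide +kernel)) (by decide) (by norm_num)⟩

/-- In the class of `A + B√2`, the equation `L ^ 2 = 5 * x ^ 2 - 4` has no solution `x` whose index
is a nonzero multiple of `30`. -/
theorem eq_zero_of_sq_eq {A B L : ℤ} {K : ℕ} (hK : 30 ∣ K)
    (hjac : ∀ t : ℕ, ∃ g ∈ [1, 3, 5, 15], ∀ y : ℤ,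
      ¬ ((⟨3, 2⟩ : ℤ√2) ^ (g * 2 ^ (t + 1))).re ∣ y ^ 2 - (-10 * A ^ 2 - 16))
    (hL : L ^ 2 = 5 * ((⟨A, B⟩ : ℤ√2) * ⟨3, 2⟩ ^ K).im ^ 2 - 4) : K = 0 := by
  by_contra hK0
  obtain ⟨j, rfl⟩ := hK
  obtain ⟨t, r, hr, rfl⟩ := Nat.exists_eq_two_pow_mul_odd (right_ne_zero_of_mul hK0)
  obtain ⟨g, hg, hw⟩ := hjac t
  have hnorm : (⟨3, 2⟩ : ℤ√2).norm = 1 := by rw [Zsqrtd.norm_def]; norm_num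
  have hdvd : ((⟨3, 2⟩ : ℤ√2) ^ (g * 2 ^ (t + 1))).re ∣
      ((⟨3, 2⟩ : ℤ√2) ^ (30 * (2 ^ t * r))).re := by
    obtain ⟨s, hs, hgs⟩ : ∃ s, Odd s ∧ g * s = 15 := by
      simp only [List.mem_cons, List.not_mem_nil, or_false] at hg
      rcases hg with rfl | rfl | rfl | rfl
      · exact ⟨15, by decide, rfl⟩
      · exact ⟨5, by decide, rfl⟩
      · exact ⟨3, by decide, rfl⟩
      · exact ⟨1, by decide, rfl⟩
    have h : 30 * (2 ^ t * r) = g * 2 ^ (t + 1) * (s * r) := by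
      rw [show 30 = 2 * (g * s) by omega]
      ring
    rw [h, pow_mul _ (g * 2 ^ (t + 1))]
    exact Zsqrtd.re_dvd_re_pow _ (hs.mul hr)
  have hab := Zsqrtd.re_sq_sub_im_sq_pow hnorm (30 * (2 ^ t * r))
  rw [Zsqrtd.im_mul] at hL
  dsimp only at hL
  set a := ((⟨3, 2⟩ : ℤ√2) ^ (30 * (2 ^ t * r))).re
  set b := ((⟨3, 2⟩ : ℤ√2) ^ (30 * (2 ^ t * r))).im
  refine hw (2 * L) (hdvd.trans ⟨20 * (2 * A * B * b + B ^ 2 * a) + 10 * A ^ 2 * a, ?_⟩)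
  linear_combination 4 * hL - 10 * A ^ 2 * hab

theorem eq_one_or_eq_five_of_odd_odd {L : ℤ} {k : ℕ}
    (hL : L ^ 2 = 5 * ((⟨1, 1⟩ : ℤ√2) * ⟨3, 2⟩ ^ k).im ^ 2 - 4) :
    ((⟨1, 1⟩ : ℤ√2) * ⟨3, 2⟩ ^ k).im = 1 ∨ ((⟨1, 1⟩ : ℤ√2) * ⟨3, 2⟩ ^ k).im = 5 := by
  have h1 : (⟨-1, 1⟩ : ℤ√2) * ⟨3, 2⟩ = ⟨1, 1⟩ := by decide
  have h7 : (⟨1, 1⟩ : ℤ√2) * ⟨3, 2⟩ = ⟨7, 5⟩ := by decide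
  have h7' : (⟨-7, 5⟩ : ℤ√2) * ⟨3, 2⟩ = ⟨-1, 1⟩ := by decide
  rcases mod_thirty_of_sq hL with h | h | h | h
  · have hk := eq_zero_of_sq_eq (Nat.dvd_of_mod_eq_zero h) exists_not_re_dvd_sq_add_26 hL
    simp [hk]
  · obtain ⟨j, rfl⟩ : ∃ j, k = j + 1 := ⟨k - 1, by omega⟩
    rw [pow_succ' (⟨3, 2⟩ : ℤ√2), ← mul_assoc, h7] at hL ⊢
    have hk := eq_zero_of_sq_eq (by omega) exists_not_re_dvd_sq_add_506 hL
    simp [hk]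
  · rw [← h1, ← h7', mul_assoc, mul_assoc, ← pow_succ', ← pow_succ'] at hL
    have hk := eq_zero_of_sq_eq (by omega) exists_not_re_dvd_sq_add_506 hL
    omega
  · rw [← h1, mul_assoc, ← pow_succ'] at hL
    have hk := eq_zero_of_sq_eq (by omega) exists_not_re_dvd_sq_add_26 hL
    omega

/-! ### Identities for Lucas sequences -/

theorem lucasU_succ_sq (P Q : ℤ) (n : ℕ) :
    lucasU P Q (n + 1) ^ 2 - P * lucasU P Q (n + 1) * lucasU P Q n + Q * lucasU P Q n ^ 2 =
      Q ^ n := by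
  induction n with
  | zero => simp [lucasU]
  | succ n ih =>
    rw [lucasU, pow_succ Q, ← ih]
    ring

theorem lucasU_one_neg_one_nonneg (n : ℕ) :
    0 ≤ lucasU 1 (-1) n ∧ 0 ≤ lucasU 1 (-1) (n + 1) := by
  induction n with
  | zero => simp [lucasU]
  | succ n ih =>
    refine ⟨ih.2, ?_⟩
    rw [lucasU]
    linarith

theorem mul_pow_eq_lucasU (k : ℕ) : (⟨1, 1⟩ : ℤ√2) * ⟨3, 2⟩ ^ k =
    ⟨lucasU 2 (-1) (2 * k + 1) + lucasU 2 (-1) (2 * k), lucasU 2 (-1) (2 * k + 1)⟩ := by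
  induction k with
  | zero => simp [lucasU]
  | succ k ih =>
    rw [pow_succ, ← mul_assoc, ih]
    ext
    · simp only [Zsqrtd.re_mul, mul_add, lucasU]
      ring
    · simp only [Zsqrtd.im_mul, mul_add, lucasU]
      ring

theorem fibonacci_inter_pell :
    {x : ℤ | ∃ n : ℕ, x = lucasU 1 (-1) n} ∩ {x : ℤ | ∃ m : ℕ, x = lucasU 2 (-1) m} =
      ({0, 1, 2, 5} : Set ℤ) := by
  ext x
  simp only [Set.mem_inter_iff, Set.mem_ofPred_eq, Set.mem_insert_iff, Set.mem_singleton_iff]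
  constructor
  · rintro ⟨⟨n, hn⟩, ⟨m, hm⟩⟩
    have hx : 0 ≤ x := hn ▸ (lucasU_one_neg_one_nonneg n).1
    have hL := lucasU_succ_sq 1 (-1) n
    have hq := lucasU_succ_sq 2 (-1) m
    rw [← hn] at hL
    rw [← hm] at hq
    rcases Nat.even_or_odd n with hne | hno <;> rcases Nat.even_or_odd m with hme | hmo
    · rw [hne.neg_one_pow] at hL
      rw [hme.neg_one_pow] at hq
      have h := sq_eq_zero_of_even_even (x := x) (L := 2 * lucasU 1 (-1) (n + 1) - x)
        (q := lucasU 2 (-1) (m + 1) - x) (by linear_combination 4 * hL) (by linear_combination hq)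
      exact Or.inl (by nlinarith)
    · rw [hne.neg_one_pow] at hL
      rw [hmo.neg_one_pow] at hq
      have h := sq_eq_one_of_even_odd (x := x) (L := 2 * lucasU 1 (-1) (n + 1) - x)
        (q := lucasU 2 (-1) (m + 1) - x) (by linear_combination 4 * hL) (by linear_combination hq)
      exact Or.inr (Or.inl (by nlinarith))
    · rw [hno.neg_one_pow] at hL
      rw [hme.neg_one_pow] at hq
      have h := sq_eq_four_of_odd_even (x := x) (L := 2 * lucasU 1 (-1) (n + 1) - x)
        (q := lucasU 2 (-1) (m + 1) - x) (by linear_combination 4 * hL) (by linear_combination hq)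
      exact Or.inr (Or.inr (Or.inl (by nlinarith)))
    · rw [hno.neg_one_pow] at hL
      obtain ⟨k, rfl⟩ := hmo
      have him : ((⟨1, 1⟩ : ℤ√2) * ⟨3, 2⟩ ^ k).im = x := by rw [mul_pow_eq_lucasU, hm]
      have h := eq_one_or_eq_five_of_odd_odd (L := 2 * lucasU 1 (-1) (n + 1) - x) (k := k)
        (by rw [him]; linear_combination 4 * hL)
      rw [him] at h
      tauto
  · rintro (rfl | rfl | rfl | rfl)
    · exact ⟨⟨0, rfl⟩, ⟨0, rfl⟩⟩
    · exact ⟨⟨1, rfl⟩, ⟨1, rfl⟩⟩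
    · exact ⟨⟨3, rfl⟩, ⟨2, rfl⟩⟩
    · exact ⟨⟨5, rfl⟩, ⟨3, rfl⟩⟩
end

section
/- The intersection of the Lucas sequences U_n(3,-1) and U_n(19,1) is {0, 1, 360}; that is, {U_n(3,-1) : n >= 0} ∩ {U_m(19,1) : m >= 0} = {0, 1, 360}. -/
namespace LucasIntersection

/-! ### Binet formulas and identities -/

lemma exists_roots (P Q : ℤ) : ∃ α β : ℂ, α + β = P ∧ α * β = Q := by
  obtain ⟨s, hs⟩ := IsAlgClosed.exists_pow_nat_eq ((P : ℂ) ^ 2 - 4 * Q) (n := 2) (by norm_num)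
  refine ⟨(P + s) / 2, (P - s) / 2, by ring, ?_⟩
  linear_combination -hs / 4

lemma lucasV_binet {P Q : ℤ} {α β : ℂ} (h₁ : α + β = P) (h₂ : α * β = Q) (n : ℕ) :
    (lucasV P Q n : ℂ) = α ^ n + β ^ n := by
  induction n using Nat.twoStepInduction with
  | zero => norm_num [lucasV]
  | one => simp [lucasV, h₁]
  | more n ih₁ ih₂ =>
    simp only [lucasV, Int.cast_sub, Int.cast_mul, ih₁, ih₂, ← h₁, ← h₂]
    ring

lemma lucasU_binet {P Q : ℤ} {α β : ℂ} (h₁ : α + β = P) (h₂ : α * β = Q) (n : ℕ) :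
    (α - β) * (lucasU P Q n : ℂ) = α ^ n - β ^ n := by
  induction n using Nat.twoStepInduction with
  | zero => simp [lucasU]
  | one => simp [lucasU]
  | more n ih₁ ih₂ =>
    simp only [lucasU, Int.cast_sub, Int.cast_mul, ← h₁, ← h₂]
    linear_combination (α + β) * ih₂ - α * β * ih₁

lemma lucasV_sq_sub (P Q : ℤ) (n : ℕ) :
    lucasV P Q n ^ 2 - (P ^ 2 - 4 * Q) * lucasU P Q n ^ 2 = 4 * Q ^ n := by
  obtain ⟨α, β, h₁, h₂⟩ := exists_roots P Q
  have hU := lucasU_binet h₁ h₂ n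
  have hV := lucasV_binet h₁ h₂ n
  have : (lucasV P Q n : ℂ) ^ 2 - ((P : ℂ) ^ 2 - 4 * Q) * (lucasU P Q n : ℂ) ^ 2
      = 4 * (Q : ℂ) ^ n := by
    have h : ((P : ℂ) ^ 2 - 4 * Q) * (lucasU P Q n : ℂ) ^ 2 = (α ^ n - β ^ n) ^ 2 := by
      rw [← hU, ← h₁, ← h₂]; ring
    rw [h, hV, ← h₂, mul_pow]; ring
  exact_mod_cast this

lemma lucasV_add_two_mul (P Q : ℤ) (a k : ℕ) :
    lucasV P Q (a + 2 * k) + Q ^ k * lucasV P Q a = lucasV P Q (a + k) * lucasV P Q k := by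
  obtain ⟨α, β, h₁, h₂⟩ := exists_roots P Q
  have : (lucasV P Q (a + 2 * k) : ℂ) + (Q : ℂ) ^ k * lucasV P Q a
      = lucasV P Q (a + k) * lucasV P Q k := by
    simp only [lucasV_binet h₁ h₂, ← h₂, mul_pow]; ring
  exact_mod_cast this

lemma lucasV_two_mul (P Q : ℤ) (k : ℕ) :
    lucasV P Q (2 * k) = lucasV P Q k ^ 2 - 2 * Q ^ k := by
  have := lucasV_add_two_mul P Q 0 k
  simp only [zero_add, lucasV] at this
  linarith

/-- The Lucas sequence `V_n(P, 1)` with `P = V_k(P', Q)` picks out the multiples of `k`. -/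
lemma lucasV_lucasV_one {P Q : ℤ} {k : ℕ} (hQ : Q ^ k = 1) (j : ℕ) :
    lucasV (lucasV P Q k) 1 j = lucasV P Q (j * k) := by
  induction j using Nat.twoStepInduction with
  | zero => simp [lucasV]
  | one => simp [lucasV]
  | more j ih₁ ih₂ =>
    have := lucasV_add_two_mul P Q (j * k) k
    rw [hQ] at this
    simp only [lucasV, ih₁, ih₂]
    rw [show (j + 2) * k = j * k + 2 * k by ring, show (j + 1) * k = j * k + k by ring]
    linarith

lemma lucasV_pos (n : ℕ) : 0 < lucasV 3 (-1) n := by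
  induction n using Nat.twoStepInduction with
  | zero => simp [lucasV]
  | one => simp [lucasV]
  | more n ih₁ ih₂ => simp only [lucasV]; linarith

/-- Shifting the index by an odd multiple of `2 * k` changes the sign modulo `V_k`. -/
lemma lucasV_dvd_of_odd {k : ℕ} (hk : Even k) {h : ℕ} (hh : Odd h) (a : ℕ) :
    lucasV 3 (-1) k ∣ lucasV 3 (-1) (a + 2 * (k * h)) + lucasV 3 (-1) a := by
  have step (b : ℕ) : lucasV 3 (-1) k ∣ lucasV 3 (-1) (b + 2 * k) + lucasV 3 (-1) b := by
    have := lucasV_add_two_mul 3 (-1) b k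
    rw [hk.neg_one_pow, one_mul] at this
    exact ⟨_, this.trans (mul_comm _ _)⟩
  obtain ⟨i, rfl⟩ := hh
  induction i with
  | zero => simpa using step a
  | succ i ih =>
    have h₁ := step (a + 2 * (k * (2 * i + 1)))
    have h₂ := step (a + 2 * (k * (2 * i + 1)) + 2 * k)
    rw [show a + 2 * (k * (2 * (i + 1) + 1)) = a + 2 * (k * (2 * i + 1)) + 2 * k + 2 * k by ring]
    obtain ⟨x, hx⟩ := h₁
    obtain ⟨y, hy⟩ := h₂
    obtain ⟨z, hz⟩ := ih
    exact ⟨y - x + z, by linear_combination hy - hx + hz⟩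

lemma lucasV_dvd_of_odd_sub {k : ℕ} (hk : Even k) {h : ℕ} (hh : Odd h) {a n : ℕ}
    (ha : Even a) (hak : a ≤ k) (hn : 2 * n + a = 2 * (k * h)) :
    lucasV 3 (-1) k ∣ lucasV 3 (-1) (2 * n) + lucasV 3 (-1) a := by
  obtain ⟨j, rfl⟩ := Nat.exists_eq_add_of_le hak
  have hj : Even j := by rw [Nat.even_add] at hk; exact hk.1 ha
  have h₁ : lucasV 3 (-1) (a + j) ∣ lucasV 3 (-1) (a + 2 * j) + lucasV 3 (-1) a := by
    have := lucasV_add_two_mul 3 (-1) a j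
    rw [hj.neg_one_pow, one_mul] at this
    exact ⟨_, this⟩
  have h₂ := lucasV_dvd_of_odd hk hh (a + 2 * j)
  have h₃ := lucasV_dvd_of_odd hk odd_one (2 * n)
  have e : 2 * n + 2 * ((a + j) * 1) = a + 2 * j + 2 * ((a + j) * h) := by omega
  rw [e] at h₃
  obtain ⟨x, hx⟩ := h₁
  obtain ⟨y, hy⟩ := h₂
  obtain ⟨z, hz⟩ := h₃
  exact ⟨z - y + x, by linear_combination hz - hy + hx⟩

/-! ### Kernel-friendly evaluation modulo `m` -/

/-- `force x f = f x`, arranged so that the kernel evaluates `x` first. -/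
def force {α : Type*} (x : ℕ) (f : ℕ → α) : α :=
  match x with
  | 0 => f 0
  | k + 1 => f (k + 1)

lemma force_eq {α : Type*} (x : ℕ) (f : ℕ → α) : force x f = f x := by
  cases x <;> rfl

/-- The `n`-th term of the sequence `a, b, …` with `s (n + 2) = P * s (n + 1) + c * s n`
modulo `m`. -/
def recMod (m P c : ℕ) : ℕ → ℕ → ℕ → ℕ
  | 0, a, _ => a
  | n + 1, a, b => force ((P * b + c * a) % m) fun d => recMod m P c n b d

lemma recMod_cast {m P c : ℕ} (s : ℕ → ZMod m) (hs : ∀ n, s (n + 2) = P * s (n + 1) + c * s n)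
    (n a b : ℕ) (i : ℕ) (ha : (a : ZMod m) = s i) (hb : (b : ZMod m) = s (i + 1)) :
    (recMod m P c n a b : ZMod m) = s (i + n) := by
  induction n generalizing a b i with
  | zero => simpa [recMod] using ha
  | succ n ih =>
    rw [recMod, force_eq, ih b _ (i + 1) hb]
    · congr 1; ring
    · rw [ZMod.natCast_mod, hs]; push_cast; rw [ha, hb]

/-- `U_n(3, -1)` modulo `m`. -/
def uMod (m n : ℕ) : ℕ := recMod m 3 1 n 0 1

/-- `V_n(x, 1)` modulo `m`. -/
def vMod (m n x : ℕ) : ℕ := recMod m x (m - 1) n 2 x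

lemma uMod_cast (m n : ℕ) : (uMod m n : ZMod m) = lucasU 3 (-1) n := by
  have := recMod_cast (m := m) (P := 3) (c := 1) (fun n => (lucasU 3 (-1) n : ZMod m))
    (fun n => by simp only [lucasU]; push_cast; ring) n 0 1 0 (by simp [lucasU]) (by simp [lucasU])
  simpa [uMod] using this

lemma vMod_cast {m : ℕ} (hm : 1 ≤ m) (n x k : ℕ) (hk : Even k)
    (hx : (x : ZMod m) = lucasV 3 (-1) k) :
    (vMod m n x : ZMod m) = lucasV 3 (-1) (n * k) := by
  rw [← lucasV_lucasV_one hk.neg_one_pow]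
  have := recMod_cast (m := m) (P := x) (c := m - 1)
    (fun n => (lucasV (lucasV 3 (-1) k) 1 n : ZMod m))
    (fun n => by simp only [lucasV]; push_cast [hm]; rw [hx, ZMod.natCast_self]; ring) n 2 x 0
    (by simp [lucasV]) (by simp [lucasV, hx])
  simpa [vMod] using this

lemma lucasV_cast_of_recMod (m n : ℕ) :
    (recMod m 3 1 n 2 3 : ZMod m) = lucasV 3 (-1) n := by
  have := recMod_cast (m := m) (P := 3) (c := 1) (fun n => (lucasV 3 (-1) n : ZMod m))
    (fun n => by simp only [lucasV]; push_cast; ring) n 2 3 0 (by simp [lucasV]) (by simp [lucasV])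
  simpa using this

/-! ### Orbits of the doubling map -/

/-- Checks `ok` along `n` iterates of `x ↦ V_2(x, 1)` modulo `m`, and that the orbit ends at `x₀`. -/
def orbitOk (m : ℕ) (ok : ℕ → Bool) (x₀ : ℕ) : ℕ → ℕ → Bool
  | 0, x => x == x₀
  | n + 1, x => ok x && force (vMod m 2 x) fun y => orbitOk m ok x₀ n y

lemma orbitOk_spec {m : ℕ} {ok : ℕ → Bool} {x₀ n x : ℕ} (h : orbitOk m ok x₀ n x = true) :
    (∀ i < n, ok ((vMod m 2)^[i] x) = true) ∧ (vMod m 2)^[n] x = x₀ := by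
  induction n generalizing x with
  | zero => simpa [orbitOk] using h
  | succ n ih =>
    rw [orbitOk, force_eq, Bool.and_eq_true] at h
    obtain ⟨h₁, h₂⟩ := ih h.2
    refine ⟨fun i hi => ?_, by simpa using h₂⟩
    cases i with
    | zero => exact h.1
    | succ i => exact h₁ i (by omega)

lemma ok_iterate {m : ℕ} {ok : ℕ → Bool} {x₀ n : ℕ} (hn : 0 < n)
    (h : orbitOk m ok x₀ n x₀ = true) (t : ℕ) : ok ((vMod m 2)^[t] x₀) = true := by
  obtain ⟨h₁, h₂⟩ := orbitOk_spec h
  rw [← Function.IsPeriodicPt.iterate_mod_apply h₂ t]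
  exact h₁ _ (Nat.mod_lt _ hn)

/-- Every `V_{2^t k}` is, modulo `m`, a value at which `ok` holds. -/
lemma exists_ok {m : ℕ} (hm : 1 ≤ m) {ok : ℕ → Bool} {x₀ n k : ℕ} (hk : Even k) (hn : 0 < n)
    (hx : recMod m 3 1 k 2 3 = x₀) (h : orbitOk m ok x₀ n x₀ = true) (t : ℕ) :
    ∃ x : ℕ, (x : ZMod m) = lucasV 3 (-1) (2 ^ t * k) ∧ ok x = true := by
  refine ⟨_, ?_, ok_iterate hn h t⟩
  induction t with
  | zero => simp [← hx, lucasV_cast_of_recMod]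
  | succ t ih =>
    rw [Function.iterate_succ_apply', vMod_cast hm 2 _ _ (hk.mul_left _) ih]
    congr 2; ring

/-! ### Evaluation of quadratic residue symbols -/

/-- Iterated powering modulo `p`, by the exponents in `fs`. -/
def powList (p : ℕ) (fs : List ℕ) (y : ℕ) : ℕ := fs.foldl (fun a f => a ^ f % p) y

lemma powList_cast (p : ℕ) (fs : List ℕ) (y : ℕ) :
    (powList p fs y : ZMod p) = (y : ZMod p) ^ fs.prod := by
  induction fs generalizing y with
  | nil => simp [powList]
  | cons f fs ih =>
    have := ih (y ^ f % p)
    rw [powList] at this ⊢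
    rw [List.foldl_cons, this, ZMod.natCast_mod, List.prod_cons, pow_mul]
    push_cast
    rfl

lemma jacobiSym_eq_of_powList {p : ℕ} (hp : p.Prime) (hp2 : 2 < p) {fs : List ℕ}
    (hfs : fs.prod = p / 2) {y : ℕ} {ε : ℤ} (hε : ε = 1 ∨ ε = -1)
    (h : (powList p fs y : ZMod p) = ε) : jacobiSym y p = ε := by
  have := Fact.mk hp
  have := Fact.mk hp2
  rw [← jacobiSym.legendreSym.to_jacobiSym]
  have h₁ := legendreSym.eq_pow p y
  rw [powList_cast, hfs] at h
  have h₂ : ((legendreSym p y : ℤ) : ZMod p) = ε := by rw [h₁, ← h]; push_cast; rfl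
  have hne : (1 : ZMod p) ≠ -1 := (ZMod.neg_one_ne_one).symm
  have h0 : ((y : ℤ) : ZMod p) ≠ 0 := by
    intro h0
    rw [legendreSym.eq_zero_iff p y |>.2 h0] at h₂
    rcases hε with rfl | rfl <;> simp at h₂
  rcases legendreSym.eq_one_or_neg_one p h0 with h₃ | h₃ <;> rw [h₃] at h₂ ⊢ <;>
    rcases hε with rfl | rfl
  · rfl
  · exact absurd (by simpa only [Int.cast_one, Int.cast_neg] using h₂) hne
  · exact absurd (by simpa only [Int.cast_one, Int.cast_neg] using h₂.symm) hne
  · rfl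

lemma jacobiSym_eq_one_of_powList {p : ℕ} (hp : p.Prime) (hp2 : 2 < p) {fs : List ℕ}
    (hfs : fs.prod = p / 2) {y : ℕ} (h : powList p fs y = 1) : jacobiSym y p = 1 :=
  jacobiSym_eq_of_powList hp hp2 hfs (Or.inl rfl) (by simp [h])

lemma jacobiSym_eq_neg_one_of_powList {p : ℕ} (hp : p.Prime) (hp2 : 2 < p) {fs : List ℕ}
    (hfs : fs.prod = p / 2) {y : ℕ} (h : powList p fs y = p - 1) : jacobiSym y p = -1 :=
  jacobiSym_eq_of_powList hp hp2 hfs (Or.inr rfl) (by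
    rw [h, Nat.cast_sub (by omega), ZMod.natCast_self]; simp)

/-- Certifies that the quadratic residue symbols of `y` modulo `p` and `q` are equal. -/
def symEq (p q : ℕ) (fs gs : List ℕ) (y : ℕ) : Bool :=
  (powList p fs y == 1 && powList q gs y == 1) ||
    (powList p fs y == p - 1 && powList q gs y == q - 1)

/-- Certifies that the quadratic residue symbols of `y` modulo `p` and `q` are opposite. -/
def symNe (p q : ℕ) (fs gs : List ℕ) (y : ℕ) : Bool :=
  (powList p fs y == 1 && powList q gs y == q - 1) ||
    (powList p fs y == p - 1 && powList q gs y == 1)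

lemma jacobiSym_of_symEq {p q : ℕ} (hp : p.Prime) (hp2 : 2 < p) (hq : q.Prime) (hq2 : 2 < q)
    {fs gs : List ℕ} (hfs : fs.prod = p / 2) (hgs : gs.prod = q / 2) {y : ℕ}
    (h : symEq p q fs gs y = true) : jacobiSym y (p * q) = 1 := by
  have := NeZero.mk hp.ne_zero
  have := NeZero.mk hq.ne_zero
  simp only [symEq, Bool.or_eq_true, Bool.and_eq_true, beq_iff_eq] at h
  rw [jacobiSym.mul_right]
  rcases h with ⟨h₁, h₂⟩ | ⟨h₁, h₂⟩
  · rw [jacobiSym_eq_one_of_powList hp hp2 hfs h₁, jacobiSym_eq_one_of_powList hq hq2 hgs h₂]; rfl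
  · rw [jacobiSym_eq_neg_one_of_powList hp hp2 hfs h₁,
      jacobiSym_eq_neg_one_of_powList hq hq2 hgs h₂]; rfl

lemma jacobiSym_of_symNe {p q : ℕ} (hp : p.Prime) (hp2 : 2 < p) (hq : q.Prime) (hq2 : 2 < q)
    {fs gs : List ℕ} (hfs : fs.prod = p / 2) (hgs : gs.prod = q / 2) {y : ℕ}
    (h : symNe p q fs gs y = true) : jacobiSym y (p * q) = -1 := by
  have := NeZero.mk hp.ne_zero
  have := NeZero.mk hq.ne_zero
  simp only [symNe, Bool.or_eq_true, Bool.and_eq_true, beq_iff_eq] at h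
  rw [jacobiSym.mul_right]
  rcases h with ⟨h₁, h₂⟩ | ⟨h₁, h₂⟩
  · rw [jacobiSym_eq_one_of_powList hp hp2 hfs h₁,
      jacobiSym_eq_neg_one_of_powList hq hq2 hgs h₂]; rfl
  · rw [jacobiSym_eq_neg_one_of_powList hp hp2 hfs h₁,
      jacobiSym_eq_one_of_powList hq hq2 hgs h₂]; rfl

/-! ### Quadratic residue obstructions modulo `V_k` -/

lemma lucasV_mod_208 (n : ℕ) : lucasV 3 (-1) n % 208 = lucasV 3 (-1) (n % 24) % 208 := by
  have step (n : ℕ) : (208 : ℤ) ∣ lucasV 3 (-1) (n + 24) - lucasV 3 (-1) n := by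
    induction n using Nat.twoStepInduction with
    | zero => norm_num [lucasV]
    | one => norm_num [lucasV]
    | more n ih₁ ih₂ =>
      have h₁ : lucasV 3 (-1) (n + 2) = 3 * lucasV 3 (-1) (n + 1) - -1 * lucasV 3 (-1) n := rfl
      have h₂ : lucasV 3 (-1) (n + 2 + 24) =
          3 * lucasV 3 (-1) (n + 1 + 24) - -1 * lucasV 3 (-1) (n + 24) := by
        rw [show n + 2 + 24 = (n + 24) + 2 by ring, show n + 1 + 24 = n + 24 + 1 by ring]
        rfl
      omega
  have h (j : ℕ) : lucasV 3 (-1) (n % 24 + 24 * j) % 208 = lucasV 3 (-1) (n % 24) % 208 := by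
    induction j with
    | zero => simp
    | succ j ih =>
      have := step (n % 24 + 24 * j)
      rw [show n % 24 + 24 * (j + 1) = n % 24 + 24 * j + 24 by ring]
      omega
  have := h (n / 24)
  rwa [Nat.mod_add_div] at this

lemma lucasV_mod_104 {k : ℕ} (hk : k % 12 = 4 ∨ k % 12 = 8) : lucasV 3 (-1) k % 104 = 15 := by
  have h := lucasV_mod_208 k
  have : k % 24 = 4 ∨ k % 24 = 8 ∨ k % 24 = 16 ∨ k % 24 = 20 := by omega
  rcases this with h' | h' | h' | h' <;> rw [h'] at h <;> norm_num [lucasV] at h <;> omega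

lemma lucasV_mod_208_of_dvd {k : ℕ} (hk : 24 ∣ k) : lucasV 3 (-1) k % 208 = 2 := by
  rw [lucasV_mod_208, Nat.mod_eq_zero_of_dvd hk]
  rfl

lemma jacobiSym_thirteen {w r : ℕ} (hw : Odd w) (hr : w % 13 = r) :
    jacobiSym 13 w = jacobiSym r 13 := by
  have h := jacobiSym.quadratic_reciprocity_one_mod_four (a := 13) (b := w) (by norm_num) hw
  rw [jacobiSym.mod_left w 13] at h
  rw [← hr]
  exact_mod_cast h

lemma jacobiSym_of_dvd {w : ℕ} {z C : ℤ} (h : (w : ℤ) ∣ 13 * z ^ 2 + C) :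
    jacobiSym (-C) w = jacobiSym 13 w * jacobiSym z w ^ 2 := by
  rw [← jacobiSym.pow_left, ← jacobiSym.mul_left, jacobiSym.mod_left,
    jacobiSym.mod_left (13 * z ^ 2)]
  congr 1
  exact Int.modEq_iff_dvd.2 (by rwa [sub_neg_eq_add])

lemma jacobiSym_neg_two_pow_mul {w : ℕ} (hw : w % 8 = 1 ∨ w % 8 = 7) (i c : ℕ) :
    jacobiSym (-(2 ^ i * c : ℕ)) w = (if w % 8 = 1 then 1 else -1) * jacobiSym c w := by
  have hodd : Odd w := Nat.odd_iff.2 (by omega)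
  have h2 : jacobiSym 2 w = 1 := by
    rw [jacobiSym.at_two hodd, ZMod.χ₈_nat_eq_if_mod_eight]
    rcases hw with h | h <;> simp [h, show w % 2 ≠ 0 by omega]
  have h1 : jacobiSym (-1) w = if w % 8 = 1 then 1 else -1 := by
    rw [jacobiSym.at_neg_one hodd]
    rcases hw with h | h
    · rw [ZMod.χ₄_nat_one_mod_four (by omega)]; simp [h]
    · rw [ZMod.χ₄_nat_three_mod_four (by omega)]; simp [h]
  rw [show (-(2 ^ i * c : ℕ) : ℤ) = -1 * 2 ^ i * c by push_cast; ring, jacobiSym.mul_left,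
    jacobiSym.mul_left, jacobiSym.pow_left, h1, h2]
  simp

lemma jacobiSym_ne_neg_one_of_dvd {k : ℕ} (hk : k % 12 = 4 ∨ k % 12 = 8) {w : ℕ}
    (hw : (w : ℤ) = lucasV 3 (-1) k) {z : ℤ} {i c : ℕ}
    (h : lucasV 3 (-1) k ∣ 13 * z ^ 2 + (2 ^ i * c : ℕ)) : jacobiSym c w ≠ -1 := by
  have hm := lucasV_mod_104 hk
  rw [← hw] at hm h
  have h₁ := jacobiSym_of_dvd h
  rw [jacobiSym_neg_two_pow_mul (by omega), if_neg (by omega),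
    jacobiSym_thirteen (r := 2) (Nat.odd_iff.2 (by omega)) (by omega),
    show jacobiSym (2 : ℕ) 13 = -1 by norm_num] at h₁
  intro h₂
  rw [h₂] at h₁
  nlinarith [sq_nonneg (jacobiSym z w)]

lemma jacobiSym_lucasV_ne_neg_one {k : ℕ} (hk : k % 12 = 4 ∨ k % 12 = 8) {z : ℤ} {i c : ℕ}
    (hc : c % 4 = 1) (h : lucasV 3 (-1) k ∣ 13 * z ^ 2 + (2 ^ i * c : ℕ)) :
    jacobiSym (lucasV 3 (-1) k) c ≠ -1 := by
  obtain ⟨w, hw⟩ := Int.eq_ofNat_of_zero_le (lucasV_pos k).le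
  have hm := lucasV_mod_104 hk
  have := jacobiSym_ne_neg_one_of_dvd hk hw.symm h
  rwa [jacobiSym.quadratic_reciprocity_one_mod_four hc (Nat.odd_iff.2 (by omega)), ← hw] at this

lemma jacobiSym_lucasV_ne_one {k : ℕ} (hk : k % 12 = 4 ∨ k % 12 = 8) {z : ℤ} {i c : ℕ}
    (hc : c % 4 = 3) (h : lucasV 3 (-1) k ∣ 13 * z ^ 2 + (2 ^ i * c : ℕ)) :
    jacobiSym (lucasV 3 (-1) k) c ≠ 1 := by
  obtain ⟨w, hw⟩ := Int.eq_ofNat_of_zero_le (lucasV_pos k).le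
  have hm := lucasV_mod_104 hk
  have := jacobiSym_ne_neg_one_of_dvd hk hw.symm h
  rw [jacobiSym.quadratic_reciprocity_three_mod_four hc (by omega), ← hw] at this
  exact fun h' => this (by rw [h'])

lemma jacobiSym_lucasV_ne_of_dvd {k : ℕ} (hk : 24 ∣ k) {z : ℤ} {i c : ℕ}
    (hc : c % 4 = 1) (h : lucasV 3 (-1) k ∣ 13 * z ^ 2 + (2 ^ i * c : ℕ)) :
    jacobiSym (lucasV 3 (-1) k) c ≠ -jacobiSym 2 c := by
  have hm := lucasV_mod_208_of_dvd hk
  have hpos := lucasV_pos k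
  obtain ⟨w, hw⟩ : ∃ w : ℕ, lucasV 3 (-1) k = 2 * w :=
    ⟨(lucasV 3 (-1) k / 2).toNat, by omega⟩
  rw [hw] at hm h ⊢
  have h₁ := jacobiSym_of_dvd ((Dvd.intro_left _ rfl).trans h)
  have hodd : Odd w := Nat.odd_iff.2 (by omega)
  rw [jacobiSym_neg_two_pow_mul (by omega), if_pos (by omega),
    jacobiSym_thirteen (r := 1) hodd (by omega),
    jacobiSym.quadratic_reciprocity_one_mod_four hc hodd] at h₁
  rw [jacobiSym.mul_left]
  have h2 : jacobiSym 2 c ≠ 0 := by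
    have : NeZero c := ⟨by omega⟩
    rw [Ne, jacobiSym.eq_zero_iff_not_coprime, not_not]
    exact Nat.coprime_two_left.2 (Nat.odd_iff.2 (by omega))
  intro h₂
  have h₃ : jacobiSym w c = -1 := mul_left_cancel₀ h2 (by linarith)
  rw [h₃] at h₁
  norm_num at h₁
  nlinarith [sq_nonneg (jacobiSym z w)]

/-! ### Excluding indices close to `e` -/

lemma lucasV_two_mul_eq (n : ℕ) :
    lucasV 3 (-1) (2 * n) = 13 * lucasU 3 (-1) n ^ 2 + 2 * (-1) ^ n := by
  have h₁ := lucasV_two_mul 3 (-1) n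
  have h₂ := lucasV_sq_sub 3 (-1) n
  linarith

lemma lucasV_dvd_of_sq {e n D k h : ℕ} {z : ℤ} (hn : n = e + D ∨ n + e = D) (hD : D = k * h)
    (hk : Even k) (hh : Odd h) (hek : 2 * e ≤ k)
    (hz : z ^ 2 = 357 * lucasU 3 (-1) n ^ 2 + 4) :
    lucasV 3 (-1) k ∣
      13 * z ^ 2 + (357 * lucasV 3 (-1) (2 * e) + 714 * (-1) ^ e - 52) := by
  have hD2 : Even D := hD ▸ hk.mul_right h
  have hpar : (-1 : ℤ) ^ n = (-1) ^ e := by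
    rcases hn with rfl | hn
    · rw [pow_add, hD2.neg_one_pow, mul_one]
    · have : (-1 : ℤ) ^ n * (-1) ^ e = 1 := by rw [← pow_add, hn, hD2.neg_one_pow]
      rcases neg_one_pow_eq_or ℤ e with h | h <;> rw [h] at this ⊢ <;> linarith
  have hdvd : lucasV 3 (-1) k ∣ lucasV 3 (-1) (2 * n) + lucasV 3 (-1) (2 * e) := by
    rcases hn with rfl | hn
    · rw [mul_add, hD]
      exact lucasV_dvd_of_odd hk hh _
    · exact lucasV_dvd_of_odd_sub hk hh (even_two_mul e) hek (by rw [← hD]; omega)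
  obtain ⟨y, hy⟩ := hdvd
  have h₂ := lucasV_two_mul_eq n
  rw [hpar] at h₂
  exact ⟨357 * y, by linear_combination 13 * hz + 357 * hy - 357 * h₂⟩

lemma exists_two_pow_mul {G D : ℕ} (hG : Odd G) (hD : D ≠ 0) (h : 16 * G ∣ D) :
    ∃ t, ∀ g, g ∣ G → ∃ h, Odd h ∧ D = 2 ^ t * (16 * g) * h := by
  obtain ⟨c, rfl⟩ := h
  have hc : c ≠ 0 := by rintro rfl; simp at hD
  obtain ⟨t, h, hh, rfl⟩ := Nat.exists_eq_two_pow_mul_odd hc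
  refine ⟨t, fun g hg => ?_⟩
  obtain ⟨g', rfl⟩ := hg
  exact ⟨g' * h, (Nat.odd_mul.1 hG).2.mul hh, by ring⟩

/-- No index `n ≠ ±e` with `n ≡ ±e` modulo `16 * G` gives a square, provided that for each `t` some
`V_{2^t * 16 * b * j}` with `b * j ∣ G` provides an obstruction. The multipliers `j` with `b * j`
prime to `3` are listed in `js`, the multiples of `3` in `is`. -/
lemma false_of_shift {c C b G e x₀ L : ℕ} {js is : List ℕ} {f g : ℕ → Bool} {ε δ : ℤ}
    (hc : 1 ≤ c) (hC : 357 * lucasV 3 (-1) (2 * e) + 714 * (-1) ^ e - 52 = C)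
    (hf : ∀ y, f y = true → jacobiSym y c = ε) (hg : ∀ y, g y = true → jacobiSym y c = δ)
    (hε : ∀ k z, k % 12 = 4 ∨ k % 12 = 8 → lucasV 3 (-1) k ∣ 13 * z ^ 2 + (C : ℤ) →
      jacobiSym (lucasV 3 (-1) k) c ≠ ε)
    (hδ : ∀ k z, 24 ∣ k → lucasV 3 (-1) k ∣ 13 * z ^ 2 + (C : ℤ) →
      jacobiSym (lucasV 3 (-1) k) c ≠ δ)
    (hL : 0 < L) (hx₀ : recMod c 3 1 (16 * b) 2 3 = x₀)
    (horb : orbitOk c (fun x => js.any (fun j => f (vMod c j x)) ||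
      is.any (fun j => g (vMod c j x))) x₀ L x₀ = true)
    (hjs : ∀ j ∈ js, b * j ∣ G ∧ ¬ 3 ∣ b * j) (his : ∀ j ∈ is, b * j ∣ G ∧ 3 ∣ b * j)
    (hG : Odd G) (he : e ≤ 8) {n D : ℕ} {z : ℤ} (hD : D ≠ 0) (hGD : 16 * G ∣ D)
    (hn : n = e + D ∨ n + e = D) (hz : z ^ 2 = 357 * lucasU 3 (-1) n ^ 2 + 4) : False := by
  obtain ⟨t, ht⟩ := exists_two_pow_mul hG hD hGD
  have hev : Even (16 * b) := ⟨8 * b, by ring⟩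
  obtain ⟨x, hx, hok⟩ := exists_ok hc hev hL hx₀ horb t
  have key (j : ℕ) (hj : b * j ∣ G) :
      lucasV 3 (-1) (2 ^ t * (16 * (b * j))) ∣ 13 * z ^ 2 + (C : ℤ) := by
    obtain ⟨h, hh, hDh⟩ := ht _ hj
    rw [← hC]
    refine lucasV_dvd_of_sq hn hDh ⟨2 ^ t * (8 * (b * j)), by ring⟩ hh ?_ hz
    have : 0 < 2 ^ t * (b * j) :=
      Nat.pos_of_ne_zero fun h0 => hD (by rw [hDh]; linear_combination 16 * h * h0)
    nlinarith
  have hsym (j : ℕ) : jacobiSym (vMod c j x) c =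
      jacobiSym (lucasV 3 (-1) (2 ^ t * (16 * (b * j)))) c := by
    have h := vMod_cast hc j x _ (hev.mul_left _) hx
    rw [show j * (2 ^ t * (16 * b)) = 2 ^ t * (16 * (b * j)) by ring] at h
    rw [jacobiSym.mod_left, jacobiSym.mod_left (lucasV _ _ _)]
    congr 1
    exact (ZMod.intCast_eq_intCast_iff _ _ _).1 (by exact_mod_cast h)
  have three_dvd (r : ℕ) : 3 ∣ 2 ^ t * (16 * r) ↔ 3 ∣ r := by
    rw [← mul_assoc]
    refine Nat.Coprime.dvd_mul_left ?_
    exact Nat.Coprime.mul_right (Nat.Coprime.pow_right _ (by norm_num)) (by norm_num)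
  have four_dvd (r : ℕ) : 8 ∣ 2 ^ t * (16 * r) := ⟨2 ^ t * (2 * r), by ring⟩
  rw [Bool.or_eq_true, List.any_eq_true, List.any_eq_true] at hok
  rcases hok with ⟨j, hj, hfj⟩ | ⟨j, hj, hgj⟩
  · have h3 := (three_dvd (b * j)).not.2 (hjs j hj).2
    have h4 := four_dvd (b * j)
    exact hε _ z (by omega) (key j (hjs j hj).1) ((hsym j).symm.trans (hf _ hfj))
  · have h3 := (three_dvd (b * j)).2 (his j hj).2
    have h4 := four_dvd (b * j)
    exact hδ _ z (by omega) (key j (his j hj).1) ((hsym j).symm.trans (hg _ hgj))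

lemma false_of_shift_zero {n D : ℕ} {z : ℤ} (hD : D ≠ 0) (hGD : 1680 ∣ D)
    (hn : n = D) (hz : z ^ 2 = 357 * lucasU 3 (-1) n ^ 2 + 4) : False := by
  have hp : Nat.Prime 43 := by norm_num
  refine false_of_shift (c := 43) (C := 1376) (b := 1) (G := 5) (e := 0) (L := 6) (js := [1, 5])
    (is := []) (f := fun y => powList 43 [21] y == 1) (g := fun _ => false) (ε := 1) (δ := 2)
    (by norm_num) (by norm_num [lucasV]) ?_ (by simp) ?_ ?_ (by norm_num) rfl (by decide +kernel)
    (by decide) (by simp) (by decide) (by norm_num) hD (dvd_trans (by norm_num) hGD)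
    (Or.inl (by simpa using hn)) hz
  · intro y hy
    exact jacobiSym_eq_one_of_powList hp (by norm_num) (by norm_num) (beq_iff_eq.1 hy)
  · intro k z hk h
    exact jacobiSym_lucasV_ne_one (i := 5) (c := 43) hk (by norm_num) h
  · intro k z _ _ h
    rcases jacobiSym.trichotomy (lucasV 3 (-1) k) 43 with h' | h' | h' <;> omega

lemma false_of_shift_one {n D : ℕ} {z : ℤ} (hD : D ≠ 0) (hGD : 1680 ∣ D)
    (hn : n = 1 + D ∨ n + 1 = D) (hz : z ^ 2 = 357 * lucasU 3 (-1) n ^ 2 + 4) : False := by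
  have hp : Nat.Prime 29 := by norm_num
  have hq : Nat.Prime 109 := by norm_num
  have hf (y : ℕ) (hy : symNe 29 109 [14] [54] y = true) : jacobiSym y 3161 = -1 :=
    jacobiSym_of_symNe hp (by norm_num) hq (by norm_num) (by norm_num) (by norm_num) hy
  refine false_of_shift (c := 3161) (C := 3161) (b := 1) (G := 15) (e := 1) (L := 6)
    (js := [1, 5]) (is := [3]) (f := symNe 29 109 [14] [54]) (g := symNe 29 109 [14] [54])
    (ε := -1) (δ := -1) (by norm_num) (by norm_num [lucasV]) hf hf ?_ ?_ (by norm_num) rfl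
    (by decide +kernel) (by decide) (by decide) (by decide) (by norm_num) hD
    (dvd_trans (by norm_num) hGD) hn hz
  · intro k z hk h
    exact jacobiSym_lucasV_ne_neg_one (i := 0) hk (by norm_num) (by simpa using h)
  · intro k z hk h
    have := jacobiSym_lucasV_ne_of_dvd (i := 0) (c := 3161) hk (by norm_num) (by simpa using h)
    rwa [show jacobiSym 2 3161 = 1 by norm_num] at this

lemma false_of_shift_six {n D : ℕ} {z : ℤ} (hD : D ≠ 0) (hGD : 277200 ∣ D)
    (hn : n = 6 + D ∨ n + 6 = D) (hz : z ^ 2 = 357 * lucasU 3 (-1) n ^ 2 + 4) : False := by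
  have hp : Nat.Prime 349 := by norm_num
  have hq : Nat.Prime 53857 := by norm_num
  refine false_of_shift (c := 18796093) (C := 601474976) (b := 35) (G := 17325) (e := 6)
    (L := 3846) (js := [1, 5, 11, 55]) (is := [3, 9, 15, 33, 45])
    (f := symNe 349 53857 [6, 29] [16, 9, 11, 17]) (g := symEq 349 53857 [6, 29] [16, 9, 11, 17])
    (ε := -1) (δ := 1) (by norm_num) (by norm_num [lucasV]) ?_ ?_ ?_ ?_ (by norm_num) rfl
    (by decide +kernel) (by decide) (by decide) (by decide) (by norm_num) hD
    (dvd_trans (by norm_num) hGD) hn hz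
  · intro y hy
    exact jacobiSym_of_symNe hp (by norm_num) hq (by norm_num) (by norm_num) (by norm_num) hy
  · intro y hy
    exact jacobiSym_of_symEq hp (by norm_num) hq (by norm_num) (by norm_num) (by norm_num) hy
  · intro k z hk h
    exact jacobiSym_lucasV_ne_neg_one (i := 5) (c := 18796093) hk (by norm_num) h
  · intro k z hk h
    have := jacobiSym_lucasV_ne_of_dvd (i := 5) (c := 18796093) hk (by norm_num) h
    rwa [show jacobiSym 2 18796093 = -1 by norm_num, neg_neg] at this

/-! ### Sieving indices by quadratic residues -/

/-- Checks that `357 * U_n ^ 2 + 4` is not a quadratic nonresidue modulo the prime `p`. -/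
def notNonresidue (p n : ℕ) : Bool := (357 * uMod p n ^ 2 + 4) ^ (p / 2) % p != p - 1

lemma lucasU_add_cast {p d : ℕ} (hd : (lucasU 3 (-1) d : ZMod p) = 0) (n : ℕ) :
    (lucasU 3 (-1) (n + d) : ZMod p) = lucasU 3 (-1) (d + 1) * lucasU 3 (-1) n := by
  induction n using Nat.twoStepInduction with
  | zero => simp [lucasU, hd]
  | one => simp [lucasU, add_comm]
  | more n ih₁ ih₂ =>
    rw [show n + 2 + d = n + d + 2 by ring]
    simp only [lucasU]
    rw [show n + d + 1 = n + 1 + d by ring]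
    push_cast
    rw [ih₁, ih₂]
    ring

lemma lucasU_mod_sq_cast {p d : ℕ} (h₀ : uMod p d = 0) (h₁ : uMod p (d + 1) ^ 2 % p = 1)
    (n : ℕ) : (lucasU 3 (-1) n : ZMod p) ^ 2 = lucasU 3 (-1) (n % d) ^ 2 := by
  have hd : (lucasU 3 (-1) d : ZMod p) = 0 := by rw [← uMod_cast, h₀, Nat.cast_zero]
  have hd₁ : (lucasU 3 (-1) (d + 1) : ZMod p) ^ 2 = 1 := by
    rw [← uMod_cast, ← Nat.cast_pow, ← ZMod.natCast_mod, h₁, Nat.cast_one]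
  have h (j : ℕ) :
      (lucasU 3 (-1) (n % d + d * j) : ZMod p) ^ 2 = lucasU 3 (-1) (n % d) ^ 2 := by
    induction j with
    | zero => simp
    | succ j ih =>
      rw [mul_add_one, ← add_assoc, lucasU_add_cast hd, mul_pow, hd₁, one_mul, ih]
  rw [← h (n / d), Nat.mod_add_div]

lemma notNonresidue_of_sq {p d n : ℕ} {z : ℤ} (hp : p.Prime) (hp2 : 2 < p)
    (h₀ : uMod p d = 0) (h₁ : uMod p (d + 1) ^ 2 % p = 1)
    (hz : z ^ 2 = 357 * lucasU 3 (-1) n ^ 2 + 4) : notNonresidue p (n % d) = true := by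
  have := Fact.mk hp
  have := Fact.mk hp2
  rw [notNonresidue, bne_iff_ne]
  intro h
  have hc := congrArg (Nat.cast : ℕ → ZMod p) h
  rw [ZMod.natCast_mod, Nat.cast_sub (by omega), ZMod.natCast_self] at hc
  push_cast at hc
  have hz' := congrArg (Int.cast : ℤ → ZMod p) hz
  push_cast at hz'
  rw [uMod_cast, ← lucasU_mod_sq_cast h₀ h₁, ← hz', ← pow_mul,
    Nat.two_mul_odd_div_two (Nat.odd_iff.1 (hp.odd_of_ne_two (by omega)))] at hc
  by_cases hz0 : (z : ZMod p) = 0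
  · rw [hz0, zero_pow (by omega)] at hc
    simp at hc
  · rw [ZMod.pow_card_sub_one_eq_one hz0] at hc
    exact ZMod.neg_one_ne_one (by simpa using hc.symm)

/-- Refines a list `A` of residues modulo `M` to a list `B` of residues modulo `M * q`, using pairs
`(p, d)` such that `U_n ^ 2` has period `d` modulo the prime `p`. -/
lemma mod_mem_of_sieve {l : List (ℕ × ℕ)} {M q : ℕ} {A B : List ℕ} {n : ℕ} {z : ℤ}
    (hz : z ^ 2 = 357 * lucasU 3 (-1) n ^ 2 + 4) (hA : n % M ∈ A)
    (hp : ∀ s ∈ l, s.1.Prime ∧ 2 < s.1)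
    (hl : (l.all fun s => uMod s.1 s.2 == 0 && uMod s.1 (s.2 + 1) ^ 2 % s.1 == 1 &&
      M * q % s.2 == 0) = true)
    (hB : (A.all fun a => (List.range q).all fun j =>
      !(l.all fun s => notNonresidue s.1 ((a + M * j) % s.2)) || B.contains (a + M * j)) = true)
    (hq : 0 < q) : n % (M * q) ∈ B := by
  simp only [List.all_eq_true, Bool.and_eq_true, beq_iff_eq] at hl
  rw [List.all_eq_true] at hB
  have h := List.all_eq_true.1 (hB _ hA) (n / M % q) (List.mem_range.2 (Nat.mod_lt _ hq))
  rw [← Nat.mod_mul, Bool.or_eq_true, Bool.not_eq_true', List.contains_iff_mem] at h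
  refine h.resolve_left fun hf => ?_
  rw [Bool.eq_false_iff] at hf
  refine hf (List.all_eq_true.2 fun s hs => ?_)
  obtain ⟨⟨h₀, h₁⟩, h₂⟩ := hl s hs
  rw [Nat.mod_mod_of_dvd _ (Nat.dvd_of_mod_eq_zero h₂)]
  exact notNonresidue_of_sq (hp s hs).1 (hp s hs).2 h₀ h₁ hz

lemma mod_1680_mem {n : ℕ} {z : ℤ} (hz : z ^ 2 = 357 * lucasU 3 (-1) n ^ 2 + 4) :
    n % 1680 ∈ [0, 1, 6, 678, 1002, 1674, 1679] := by
  have h : n % (1 * 336) ∈ [0, 1, 6, 330, 335] :=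
    mod_mem_of_sieve (l := [(41, 14), (167, 168), (47, 48), (83, 84), (337, 168), (113, 56),
      (673, 48)]) (A := [0]) hz (by simp [Nat.mod_one]) (by norm_num) (by decide +kernel)
      (by decide +kernel) (by norm_num)
  exact mod_mem_of_sieve (l := [(19, 20), (239, 80), (61, 30)]) (M := 336) (q := 5) hz h
    (by norm_num) (by decide +kernel) (by decide +kernel) (by norm_num)

lemma mod_277200_mem {n : ℕ} {z : ℤ} (hz : z ^ 2 = 357 * lucasU 3 (-1) n ^ 2 + 4)
    (h : n % 1680 ∈ [6, 678, 1002, 1674]) : n % 277200 ∈ [6, 277194] := by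
  have h₁ : n % (1680 * 5) ∈ [6, 8394] :=
    mod_mem_of_sieve (l := [(349, 350), (149, 150), (101, 50)]) hz h
      (by norm_num) (by decide +kernel) (by decide +kernel) (by norm_num)
  have h₂ : n % (8400 * 3) ∈ [6, 25194] :=
    mod_mem_of_sieve (l := [(449, 450)]) hz h₁
      (by norm_num) (by decide +kernel) (by decide +kernel) (by norm_num)
  exact mod_mem_of_sieve (l := [(307, 308), (197, 198)]) (M := 25200) (q := 11) hz h₂
    (by norm_num) (by decide +kernel) (by decide +kernel) (by norm_num)

lemma eq_zero_or_one_or_six {n : ℕ} {z : ℤ} (hz : z ^ 2 = 357 * lucasU 3 (-1) n ^ 2 + 4) :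
    n = 0 ∨ n = 1 ∨ n = 6 := by
  by_contra! hn
  have h := mod_1680_mem hz
  have h₆ : n % 1680 ∈ [6, 678, 1002, 1674] → False := fun h => by
    have h₁ := mod_277200_mem hz h
    simp only [List.mem_cons, List.not_mem_nil, or_false] at h₁
    rcases h₁ with h₁ | h₁
    · exact false_of_shift_six (D := n - 6) (by omega) (by omega) (by omega) hz
    · exact false_of_shift_six (D := n + 6) (by omega) (by omega) (by omega) hz
  simp only [List.mem_cons, List.not_mem_nil, or_false] at h h₆
  rcases h with h | h | h | h | h | h | h
  · exact false_of_shift_zero (D := n) (by omega) (by omega) rfl hz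
  · exact false_of_shift_one (D := n - 1) (by omega) (by omega) (by omega) hz
  · exact h₆ (by omega)
  · exact h₆ (by omega)
  · exact h₆ (by omega)
  · exact h₆ (by omega)
  · exact false_of_shift_one (D := n + 1) (by omega) (by omega) (by omega) hz

end LucasIntersection

theorem U3neg1_inter_U19_1 :
    {x : ℤ | ∃ n : ℕ, x = lucasU 3 (-1) n} ∩ {x : ℤ | ∃ m : ℕ, x = lucasU 19 1 m} =
      ({0, 1, 360} : Set ℤ) := by
  ext x
  simp only [Set.mem_inter_iff, Set.mem_ofPred_eq, Set.mem_insert_iff, Set.mem_singleton_iff]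
  constructor
  · rintro ⟨⟨n, rfl⟩, m, hm⟩
    have hV := LucasIntersection.lucasV_sq_sub 19 1 m
    rw [← hm, one_pow] at hV
    rcases LucasIntersection.eq_zero_or_one_or_six (n := n) (z := lucasV 19 1 m)
      (by linarith) with rfl | rfl | rfl <;> norm_num [lucasU]
  · rintro (rfl | rfl | rfl)
    · exact ⟨⟨0, rfl⟩, 0, rfl⟩
    · exact ⟨⟨1, rfl⟩, 1, rfl⟩
    · exact ⟨⟨6, by norm_num [lucasU]⟩, 3, by norm_num [lucasU]⟩
end

section
/- The intersection of the Lucas sequences U_n(8,-1) and U_n(23,1) is {0, 1, 528}; that is, {U_n(8,-1) : n >= 0} ∩ {U_m(23,1) : m >= 0} = {0, 1, 528}. -/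
namespace PellLucas

/-- The pair `(u n, v n)` with `(4 + √17) ^ n = v n + u n * √17`. -/
def pell : ℕ → ℕ × ℕ
  | 0 => (0, 1)
  | n + 1 => ((pell n).2 + 4 * (pell n).1, 4 * (pell n).2 + 17 * (pell n).1)

/-- The coefficient of `√17` in `(4 + √17) ^ n`. -/
def u (n : ℕ) : ℕ := (pell n).1

/-- The rational part of `(4 + √17) ^ n`. -/
def v (n : ℕ) : ℕ := (pell n).2

@[simp] lemma u_zero : u 0 = 0 := rfl

@[simp] lemma v_zero : v 0 = 1 := rfl

lemma u_succ (n : ℕ) : u (n + 1) = v n + 4 * u n := rfl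

lemma v_succ (n : ℕ) : v (n + 1) = 4 * v n + 17 * u n := rfl

lemma add_formulas (m n : ℕ) :
    u (m + n) = u m * v n + v m * u n ∧ v (m + n) = v m * v n + 17 * (u m * u n) := by
  induction n with
  | zero => simp
  | succ n ih =>
    rw [← add_assoc, u_succ, v_succ, u_succ, v_succ, ih.1, ih.2]
    constructor <;> ring

lemma u_add (m n : ℕ) : u (m + n) = u m * v n + v m * u n := (add_formulas m n).1

lemma v_add (m n : ℕ) : v (m + n) = v m * v n + 17 * (u m * u n) := (add_formulas m n).2

lemma norm_eq (n : ℕ) : (v n : ℤ) ^ 2 - 17 * (u n : ℤ) ^ 2 = (-1) ^ n := by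
  induction n with
  | zero => simp
  | succ n ih =>
    rw [u_succ, v_succ, pow_succ (-1 : ℤ), ← ih]
    push_cast
    ring

lemma norm_eq_of_even {n : ℕ} (hn : Even n) : (v n : ℤ) ^ 2 - 17 * (u n : ℤ) ^ 2 = 1 := by
  rw [norm_eq, hn.neg_one_pow]

lemma v_mul_recurrence {k : ℕ} (hk : Even k) (j : ℕ) :
    v (k * (j + 2)) + v (k * j) = 2 * v k * v (k * (j + 1)) := by
  have h := norm_eq_of_even hk
  have e1 : k * (j + 2) = k * j + k + k := by ring
  have e2 : k * (j + 1) = k * j + k := by ring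
  rw [e1, e2]
  simp only [v_add, u_add]
  zify
  linear_combination (-(v (k * j) : ℤ)) * h

lemma v_dvd_v_mul_odd (k : ℕ) {r : ℕ} (hr : Odd r) : v k ∣ v (k * r) := by
  obtain ⟨j, rfl⟩ := hr
  induction j with
  | zero => simp
  | succ j ih =>
    obtain ⟨w, hw⟩ := ih
    have e : k * (2 * (j + 1) + 1) = k * (2 * j + 1) + (k + k) := by ring
    rw [e, v_add, u_add, hw]
    exact ⟨w * v (k + k) + 17 * u (k * (2 * j + 1)) * (2 * u k), by ring⟩

lemma v_four_mul_mod (j : ℕ) : v (4 * j) % 272 = 1 := by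
  induction j with
  | zero => rfl
  | succ j ih =>
    have h1 : v 4 = 2177 := rfl
    have h2 : u 4 = 528 := rfl
    rw [mul_add, mul_one, v_add, h1, h2]
    omega

lemma lucasU_eq_u (n : ℕ) : lucasU 8 (-1) n = u n ∧ lucasU 8 (-1) (n + 1) = u (n + 1) := by
  induction n with
  | zero => constructor <;> rfl
  | succ n ih =>
    refine ⟨ih.2, ?_⟩
    rw [lucasU, ih.1, ih.2, u_succ (n + 1), v_succ, u_succ]
    push_cast
    ring

lemma lucasU_23_invariant (m : ℕ) :
    lucasU 23 1 (m + 1) ^ 2 - 23 * lucasU 23 1 (m + 1) * lucasU 23 1 m + lucasU 23 1 m ^ 2 = 1 := by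
  induction m with
  | zero => simp [lucasU]
  | succ m ih =>
    rw [lucasU]
    linear_combination ih

/-- Fuelled evaluation of the Jacobi symbol: `true` certifies that the symbol `J(a | b)` is `-1`
if `s` is set and `1` otherwise. -/
def jacobiCert : ℕ → ℕ → ℕ → Bool → Bool
  | 0, _, _, _ => false
  | f + 1, a, b, s =>
    if a = 0 then false
    else if a = 1 then !s
    else if a % 2 = 0 then jacobiCert f (a / 2) b (s ^^ (b % 8 == 3 || b % 8 == 5))
    else jacobiCert f (b % a) a (s ^^ (a % 4 == 3 && b % 4 == 3))

open NumberTheorySymbols in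
lemma jacobiSym_of_jacobiCert (f a b : ℕ) (s : Bool) (hb : Odd b) (h : jacobiCert f a b s = true) :
    J(a | b) = if s then -1 else 1 := by
  induction f generalizing a b s with
  | zero => simp [jacobiCert] at h
  | succ f ih =>
    rw [jacobiCert] at h
    split_ifs at h with h0 h1 h2
    · simp_all
    · have := ih _ _ _ hb h
      have ha : ((a : ℕ) : ℤ) = 2 * ((a / 2 : ℕ) : ℤ) := by omega
      rw [ha, jacobiSym.mul_left, this, jacobiSym.at_two hb, ZMod.χ₈_nat_eq_if_mod_eight]
      have hb2 : b % 2 = 1 := Nat.odd_iff.mp hb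
      have h8 : b % 8 = 1 ∨ b % 8 = 3 ∨ b % 8 = 5 ∨ b % 8 = 7 := by omega
      rcases h8 with h8 | h8 | h8 | h8 <;> cases s <;> simp [h8, hb2]
    · have ha : Odd a := Nat.odd_iff.mpr (by omega)
      have := ih _ _ _ ha h
      rw [Int.natCast_mod, ← jacobiSym.mod_left] at this
      have ha' := Nat.odd_iff.mp ha
      have hb' := Nat.odd_iff.mp hb
      have ha4 : a % 4 = 1 ∨ a % 4 = 3 := by omega
      have hb4 : b % 4 = 1 ∨ b % 4 = 3 := by omega
      rcases ha4 with ha4 | ha4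
      · rw [jacobiSym.quadratic_reciprocity_one_mod_four ha4 hb, this]
        simp [ha4]
      · rcases hb4 with hb4 | hb4
        · rw [← jacobiSym.quadratic_reciprocity_one_mod_four hb4 ha, this]
          simp [hb4]
        · rw [jacobiSym.quadratic_reciprocity_three_mod_four ha4 hb4, this]
          cases s <;> simp [ha4, hb4]

/-- Check `P` along the first `T` points of the orbit of `s` under `f`. -/
def orbitAll {α : Type} (P : α → Bool) (f : α → α) : ℕ → α → Bool
  | 0, _ => true
  | T + 1, s => P s && orbitAll P f T (f s)

lemma orbitAll_spec {α : Type} {P : α → Bool} {f : α → α} {T : ℕ} {s : α}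
    (h : orbitAll P f T s = true) {i : ℕ} (hi : i < T) : P (f^[i] s) = true := by
  induction T generalizing s i with
  | zero => omega
  | succ T ih =>
    rw [orbitAll, Bool.and_eq_true] at h
    cases i with
    | zero => exact h.1
    | succ i => exact ih h.2 (by omega)

lemma forall_of_orbitAll {α : Type} {P : α → Bool} {f : α → α} {T : ℕ} {s : α} (hT : 0 < T)
    (h : orbitAll P f T s = true) (hs : f^[T] s = s) (n : ℕ) : P (f^[n] s) = true := by
  have hp : Function.IsPeriodicPt f T s := hs
  rw [← hp.iterate_mod_apply]
  exact orbitAll_spec h (Nat.mod_lt _ hT)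

/-- One step of the Pell pair modulo `Q`, together with the index modulo `M`. -/
def sieveStep (M Q : ℕ) (s : ℕ × ℕ × ℕ) : ℕ × ℕ × ℕ :=
  ((s.1 + 1) % M, (s.2.2 + 4 * s.2.1) % Q, (4 * s.2.2 + 17 * s.2.1) % Q)

lemma sieveStep_iterate (M Q n : ℕ) :
    (sieveStep M Q)^[n] (0 % M, 0 % Q, 1 % Q) = (n % M, u n % Q, v n % Q) := by
  induction n with
  | zero => rfl
  | succ n ih =>
    rw [Function.iterate_succ_apply', ih, sieveStep, u_succ, v_succ]
    simp [Nat.add_mod, Nat.mul_mod]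

/-- The index lies in `L` modulo `m`, or `525 * u ^ 2 + 4` is a nonresidue for some `q` in `qs`. -/
def sieveTest (m : ℕ) (L qs : List ℕ) (s : ℕ × ℕ × ℕ) : Bool :=
  L.any (fun l => Nat.beq (s.1 % m) l) ||
    qs.any fun q => jacobiCert 60 ((525 * s.2.1 ^ 2 + 4) % q) q true

open NumberTheorySymbols in
lemma mod_mem_of_sieve {m M Q : ℕ} {L qs : List ℕ} (hM : 0 < M) (hm : m ∣ M)
    (hqs : ∀ q ∈ qs, Odd q ∧ q ∣ Q)
    (h : orbitAll (sieveTest m L qs) (sieveStep M Q) M (0 % M, 0 % Q, 1 % Q) = true)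
    (hp : (sieveStep M Q)^[M] (0 % M, 0 % Q, 1 % Q) = (0 % M, 0 % Q, 1 % Q))
    {n : ℕ} {z : ℤ} (hz : 525 * (u n : ℤ) ^ 2 + 4 = z ^ 2) : n % m ∈ L := by
  have hn := forall_of_orbitAll hM h hp n
  rw [sieveStep_iterate, sieveTest, Bool.or_eq_true, List.any_eq_true, List.any_eq_true] at hn
  rcases hn with ⟨l, hl, hnl⟩ | ⟨q, hq, hnq⟩
  · rw [Nat.beq_eq, Nat.mod_mod_of_dvd _ hm] at hnl
    exact hnl ▸ hl
  · obtain ⟨hodd, hdvd⟩ := hqs q hq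
    have hj := jacobiSym_of_jacobiCert _ _ _ _ hodd hnq
    have e : (((525 * (u n % Q) ^ 2 + 4) % q : ℕ) : ℤ) % q = (z ^ 2) % q := by
      rw [← hz, Int.natCast_mod, Int.emod_emod]
      have : (u n % Q : ℕ) ≡ u n [MOD q] := (Nat.mod_modEq (u n) Q).of_dvd hdvd
      have := ((this.pow 2).mul_left 525).add_right 4
      exact_mod_cast this
    rw [jacobiSym.mod_left, e, ← jacobiSym.mod_left, jacobiSym.pow_left] at hj
    simp only [if_true] at hj
    nlinarith [sq_nonneg J(z | q)]

/-- The recurrence `(a, b) ↦ (b, 2 * s * b - a)` modulo `N`, iterated. -/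
def cheb (N s : ℕ) : ℕ → ℕ → ℕ → ℕ
  | 0, a, _ => a
  | n + 1, a, b => cheb N s n b ((2 * s * b + (N - a)) % N)

lemma cheb_eq {N k : ℕ} (hN : 0 < N) (hk : Even k) (n j : ℕ) :
    cheb N (v k % N) n (v (k * j) % N) (v (k * (j + 1)) % N) = v (k * (j + n)) % N := by
  induction n generalizing j with
  | zero => rfl
  | succ n ih =>
    have e : (2 * (v k % N) * (v (k * (j + 1)) % N) + (N - v (k * j) % N)) % N =
        v (k * (j + 1 + 1)) % N := by
      have h := congrArg (Nat.cast : ℕ → ZMod N) (v_mul_recurrence hk j)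
      rw [← ZMod.natCast_eq_natCast_iff']
      push_cast [Nat.cast_sub (Nat.mod_lt (v (k * j)) hN).le] at h ⊢
      simp only [ZMod.natCast_mod, CharP.cast_eq_zero]
      linear_combination -h
    rw [cheb, e, ih (j + 1)]
    congr 3
    ring

/-- The doubling map `x ↦ 2 * x ^ 2 - 1` modulo `N`. -/
def double (N s : ℕ) : ℕ := (2 * s * s + (N - 1)) % N

lemma double_iterate {N : ℕ} (hN : 0 < N) (i : ℕ) :
    (double N)^[i] (v 8 % N) = v (2 ^ (i + 3)) % N := by
  induction i with
  | zero => rfl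
  | succ i ih =>
    have hk : Even (2 ^ (i + 3)) := ⟨2 ^ (i + 2), by ring⟩
    have hr := congrArg (Nat.cast : ℕ → ZMod N) (v_mul_recurrence hk 0)
    rw [Function.iterate_succ_apply', ih, double, ← ZMod.natCast_eq_natCast_iff']
    push_cast [Nat.cast_sub (Nat.one_le_iff_ne_zero.mpr hN.ne')] at hr ⊢
    simp only [ZMod.natCast_mod, CharP.cast_eq_zero]
    simp only [mul_zero, v_zero, mul_one, Nat.cast_one] at hr
    rw [show 2 ^ (i + 1 + 3) = 2 ^ (i + 3) * 2 by ring]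
    linear_combination -hr

/-- Some `v (k * c)` with `c ∣ 315` is a nonresidue modulo `N`, given `s = v k % N`. -/
def nonresidueTest (N s : ℕ) : Bool :=
  [1, 3, 5, 7, 9, 15, 21, 35, 45, 63, 105, 315].any fun c =>
    jacobiCert 120 (cheb N s c (1 % N) s) N true

open NumberTheorySymbols in
/-- If `v k` is a nonresidue modulo `N`, where `525 * v a ^ 2 - 68 = e ^ 2 * N`, then indices
`±a` plus an odd multiple of `k` are impossible. -/
lemma false_of_nonresidue {a n k r e N : ℕ} {z : ℤ} (hz : 525 * (u n : ℤ) ^ 2 + 4 = z ^ 2)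
    (hk : 4 ∣ k) (hr : Odd r) (hn : n = k * r + a ∨ k * r = n + a)
    (hN : 525 * (v a) ^ 2 = e ^ 2 * N + 68) (hNodd : Odd N) (he : e = 1 ∨ e = 2)
    (hJ : J((v k : ℤ) | N) = -1) : False := by
  obtain ⟨j, rfl⟩ := hk
  have hmod := v_four_mul_mod j
  have hdvd := v_dvd_v_mul_odd (4 * j) hr
  have hnorm := norm_eq_of_even (n := 4 * j * r) ⟨2 * j * r, by ring⟩
  have hna := norm_eq a
  generalize 4 * j * r = K at *
  generalize v (4 * j) = m at *
  have hm4 : m % 4 = 1 := by omega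
  have hmodd : Odd m := Nat.odd_iff.mpr (by omega)
  have hε : ((-1 : ℤ) ^ a) ^ 2 = 1 := by rw [← pow_mul, mul_comm, pow_mul]; norm_num
  have hu : (m : ℤ) ∣ (u n : ℤ) ^ 2 - (u K : ℤ) ^ 2 * (v a : ℤ) ^ 2 := by
    obtain ⟨w, hw⟩ := hdvd
    have hw' : (v K : ℤ) = m * w := by exact_mod_cast hw
    rcases hn with rfl | rfl
    · have h1 : (u (K + a) : ℤ) = u K * v a + v K * u a := by exact_mod_cast u_add K a
      refine ⟨w * u a * (2 * u K * v a + v K * u a), ?_⟩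
      rw [h1]
      linear_combination (u a : ℤ) * (2 * u K * v a + v K * u a) * hw'
    · have h1 : (u (n + a) : ℤ) = u n * v a + v n * u a := by exact_mod_cast u_add n a
      have h2 : (v (n + a) : ℤ) = v n * v a + 17 * (u n * u a) := by exact_mod_cast v_add n a
      have h3 : (u n : ℤ) * (-1) ^ a = u (n + a) * v a - v (n + a) * u a := by
        rw [h1, h2, ← hna]; ring
      refine ⟨w * u a * (v (n + a) * u a - 2 * u (n + a) * v a), ?_⟩
      have h4 : (u n : ℤ) ^ 2 = (u (n + a) * v a - v (n + a) * u a) ^ 2 := by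
        rw [← h3, mul_pow, hε, mul_one]
      rw [h4]
      linear_combination (u a : ℤ) * (v (n + a) * u a - 2 * u (n + a) * v a) * hw'
  have hN' : 525 * (v a : ℤ) ^ 2 = e ^ 2 * N + 68 := by exact_mod_cast hN
  have hcong : (17 * z ^ 2) % (m : ℤ) = (-1 * (e : ℤ) ^ 2 * N) % (m : ℤ) := by
    apply Int.ModEq.symm
    rw [Int.modEq_iff_dvd]
    have hK : (m : ℤ) ∣ (v K : ℤ) := by exact_mod_cast hdvd
    have h5 : 17 * z ^ 2 - -1 * (e : ℤ) ^ 2 * N =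
        525 * 17 * ((u n : ℤ) ^ 2 - (u K : ℤ) ^ 2 * (v a : ℤ) ^ 2) +
          v K * (525 * v K * (v a : ℤ) ^ 2) := by
      linear_combination -17 * hz - hN' - 525 * (v a : ℤ) ^ 2 * hnorm
    rw [h5]
    exact dvd_add (hu.mul_left _) (hK.mul_right _)
  have h17 : J(17 | m) = 1 := by
    have h := jacobiSym.quadratic_reciprocity_one_mod_four (a := 17) (b := m) (by norm_num) hmodd
    have h6 : ((m : ℤ)) % ((17 : ℕ) : ℤ) = 1 := by omega
    rw [jacobiSym.mod_left (m : ℤ), h6, jacobiSym.one_left] at h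
    exact_mod_cast h
  have hneg : J(-1 | m) = 1 := by
    rw [jacobiSym.at_neg_one hmodd, ZMod.χ₄_nat_one_mod_four hm4]
  have hNm : J((N : ℤ) | m) = -1 := by
    rw [← hJ, jacobiSym.quadratic_reciprocity_one_mod_four hm4 hNodd]
  have hem : J((e : ℤ) | m) ^ 2 = 1 := by
    rcases he with rfl | rfl
    · simp
    · apply jacobiSym.sq_one
      rw [Int.gcd_natCast_natCast]
      exact (Nat.coprime_two_left).mpr hmodd
  have := congrArg (fun x => J(x | m)) hcong
  simp only [← jacobiSym.mod_left] at this
  rw [jacobiSym.mul_left, jacobiSym.mul_left, jacobiSym.mul_left, jacobiSym.pow_left,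
    jacobiSym.pow_left, h17, hneg, hNm, hem] at this
  nlinarith [sq_nonneg J(z | m)]

lemma false_of_orbit {a e N T : ℕ} (hN : 525 * (v a) ^ 2 = e ^ 2 * N + 68) (hNodd : Odd N)
    (he : e = 1 ∨ e = 2) (hT : 0 < T)
    (h : orbitAll (nonresidueTest N) (double N) T (v 8 % N) = true)
    (hp : (double N)^[T] (v 8 % N) = v 8 % N) {n K : ℕ} {z : ℤ}
    (hz : 525 * (u n : ℤ) ^ 2 + 4 = z ^ 2) (hK : 2520 ∣ K) (hK0 : K ≠ 0)
    (hn : n = K + a ∨ K = n + a) : False := by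
  obtain ⟨j, rfl⟩ := hK
  obtain ⟨i, w, hw, rfl⟩ := Nat.exists_eq_two_pow_mul_odd (n := j) (by rintro rfl; simp at hK0)
  have ht := forall_of_orbitAll hT h hp i
  have hk : Even (2 ^ (i + 3)) := ⟨2 ^ (i + 2), by ring⟩
  rw [double_iterate hNodd.pos, nonresidueTest, List.any_eq_true] at ht
  obtain ⟨c, hc, hcert⟩ := ht
  have hc315 : c ∣ 315 := by
    have hall : ∀ c ∈ [1, 3, 5, 7, 9, 15, 21, 35, 45, 63, 105, 315], c ∣ 315 := by decide
    exact hall c hc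
  obtain ⟨d, hd⟩ := hc315
  have hch := cheb_eq hNodd.pos hk c 0
  simp only [mul_zero, v_zero, zero_add, mul_one] at hch
  have hJ := jacobiSym_of_jacobiCert _ _ _ _ hNodd hcert
  rw [hch, Int.natCast_mod, ← jacobiSym.mod_left, if_pos rfl] at hJ
  have hdodd : Odd d := by
    have : Odd (c * d) := hd ▸ (by decide)
    exact (Nat.odd_mul.mp this).2
  have e : 2520 * (2 ^ i * w) = 2 ^ (i + 3) * c * (d * w) := by
    calc 2520 * (2 ^ i * w) = 2 ^ (i + 3) * 315 * w := by ring
      _ = _ := by rw [hd]; ring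
  rw [e] at hn
  exact false_of_nonresidue hz (Dvd.dvd.mul_right ⟨2 ^ (i + 1), by ring⟩ _) (hdodd.mul hw) hn hN
    hNodd he hJ

lemma mod_360_mem {n : ℕ} {z : ℤ} (hz : 525 * (u n : ℤ) ^ 2 + 4 = z ^ 2) :
    n % 360 ∈ [0, 1, 4, 356, 359] :=
  mod_mem_of_sieve (M := 720) (Q := 11 * 19 * 23 * 29 * 67 * 71 * 269 * 271 * 311 * 2069 * 4861)
    (qs := [11, 19, 23, 29, 67, 71, 269, 271, 311, 2069, 4861]) (by norm_num) (by norm_num)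
    (by decide +kernel) (by decide +kernel) (by decide +kernel) hz

lemma mod_420_mem {n : ℕ} {z : ℤ} (hz : 525 * (u n : ℤ) ^ 2 + 4 = z ^ 2) :
    n % 420 ∈ [0, 1, 4, 416, 419] :=
  mod_mem_of_sieve (M := 840) (Q := 11 * 29 * 41 * 43 * 139 * 281 * 419 * 421 * 2297)
    (qs := [11, 29, 41, 43, 139, 281, 419, 421, 2297]) (by norm_num) (by norm_num)
    (by decide +kernel) (by decide +kernel) (by decide +kernel) hz

lemma index_eq {n : ℕ} {z : ℤ} (hz : 525 * (u n : ℤ) ^ 2 + 4 = z ^ 2) :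
    n = 0 ∨ n = 1 ∨ n = 4 := by
  have key_zero : ∀ K, 2520 ∣ K → K ≠ 0 → (n = K + 0 ∨ K = n + 0) → False := fun K =>
    false_of_orbit (e := 1) (N := 457) (T := 9) (by decide) (by decide) (.inl rfl) (by norm_num)
      (by decide +kernel) (by decide +kernel) hz
  have key_one : ∀ K, 2520 ∣ K → K ≠ 0 → (n = K + 1 ∨ K = n + 1) → False := fun K =>
    false_of_orbit (e := 2) (N := 2083) (T := 173) (by decide) (by decide) (.inr rfl) (by norm_num)
      (by decide +kernel) (by decide +kernel) hz
  have key_four : ∀ K, 2520 ∣ K → K ≠ 0 → (n = K + 4 ∨ K = n + 4) → False := fun K =>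
    false_of_orbit (e := 1) (N := 2488147657) (T := 1980) (by decide) (by decide) (.inl rfl)
      (by norm_num) (by decide +kernel) (by decide +kernel) hz
  have h1 := mod_360_mem hz
  have h2 := mod_420_mem hz
  simp only [List.mem_cons, List.not_mem_nil, or_false] at h1 h2
  by_contra! hne
  obtain ⟨hne0, hne1, hne4⟩ := hne
  have h : n % 2520 = 0 ∨ n % 2520 = 1 ∨ n % 2520 = 4 ∨ n % 2520 = 2516 ∨ n % 2520 = 2519 := by
    omega
  rcases h with h | h | h | h | h
  · exact key_zero n (by omega) hne0 (.inl rfl)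
  · exact key_one (n - 1) (by omega) (by omega) (.inl (by omega))
  · exact key_four (n - 4) (by omega) (by omega) (.inl (by omega))
  · exact key_four (n + 4) (by omega) (by omega) (.inr rfl)
  · exact key_one (n + 1) (by omega) (by omega) (.inr rfl)

end PellLucas

open PellLucas in
theorem U8neg1_inter_U23_1 :
    {x : ℤ | ∃ n : ℕ, x = lucasU 8 (-1) n} ∩ {x : ℤ | ∃ m : ℕ, x = lucasU 23 1 m} =
      ({0, 1, 528} : Set ℤ) := by
  ext x
  simp only [Set.mem_inter_iff, Set.mem_ofPred_eq, Set.mem_insert_iff, Set.mem_singleton_iff]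
  constructor
  · rintro ⟨⟨n, rfl⟩, m, hm⟩
    rw [(lucasU_eq_u n).1] at hm ⊢
    have hz : 525 * (u n : ℤ) ^ 2 + 4 = (2 * lucasU 23 1 (m + 1) - 23 * lucasU 23 1 m) ^ 2 := by
      rw [hm]
      linear_combination -4 * lucasU_23_invariant m
    rcases index_eq hz with rfl | rfl | rfl
    · exact .inl rfl
    · exact .inr (.inl rfl)
    · exact .inr (.inr rfl)
  · rintro (rfl | rfl | rfl)
    · exact ⟨⟨0, rfl⟩, 0, rfl⟩
    · exact ⟨⟨1, rfl⟩, 1, rfl⟩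
    · exact ⟨⟨4, by norm_num [lucasU]⟩, 3, by norm_num [lucasU]⟩
end
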